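/- arXiv:1212.6860 — 2 statements merged into one kernel-verified Lean document; each statement's English description precedes it below -/
import Mathlib

section
/- Let R be a commutative ring of finite Krull dimension d such that the Krull dimension of the polynomial ring A = R[Y_1,…,Y_n] equals d + n. Then every finitely generated stably free A-module of rank ≥ d+1 is free; that is, if P is a finitely generated A-module with P ⊕ A^s ≅ A^{r+s} for some s ∈ ℕ and r ≥ d+1, then P ≅ A^r. -/
namespace SF12

/-- Equivalence of vectors under the general linear group. -/
def Rel {ι A : Type*} [Fintype ι] [DecidableEq ι] [CommRing A] (v w : ι → A) : Prop :=
  ∃ G H : Matrix ι ι A, G * H = 1 ∧ H * G = 1 ∧ G.mulVec v = w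

section
variable {ι A B : Type*} [Fintype ι] [DecidableEq ι] [CommRing A] [CommRing B]

lemma Rel.refl (v : ι → A) : Rel v v := ⟨1, 1, by simp, by simp, by simp⟩

lemma Rel.symm {v w : ι → A} (h : Rel v w) : Rel w v := by
  obtain ⟨G, H, h1, h2, h3⟩ := h
  exact ⟨H, G, h2, h1, by rw [← h3, Matrix.mulVec_mulVec, h2, Matrix.one_mulVec]⟩

lemma Rel.trans {u v w : ι → A} (h : Rel u v) (h' : Rel v w) : Rel u w := by
  obtain ⟨G, H, h1, h2, h3⟩ := h
  obtain ⟨G', H', h1', h2', h3'⟩ := h'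
  refine ⟨G' * G, H * H', ?_, ?_, ?_⟩
  · rw [Matrix.mul_assoc, ← Matrix.mul_assoc G, h1, Matrix.one_mul, h1']
  · rw [Matrix.mul_assoc, ← Matrix.mul_assoc H', h2', Matrix.one_mul, h2]
  · rw [← Matrix.mulVec_mulVec, h3, h3']

lemma Rel.map {v w : ι → A} (h : Rel v w) (f : A →+* B) :
    Rel (fun i => f (v i)) (fun i => f (w i)) := by
  obtain ⟨G, H, h1, h2, h3⟩ := h
  refine ⟨G.map f, H.map f, ?_, ?_, ?_⟩
  · rw [← Matrix.map_mul, h1, Matrix.map_one f (map_zero f) (map_one f)]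
  · rw [← Matrix.map_mul, h2, Matrix.map_one f (map_zero f) (map_one f)]
  · ext i
    rw [← h3, RingHom.map_mulVec]
    rfl

lemma Rel.transvection (v x y : ι → A) (h : y ⬝ᵥ x = 0) : Rel v (v + (y ⬝ᵥ v) • x) := by
  have hz : Matrix.vecMulVec x y * Matrix.vecMulVec x y = 0 := by
    rw [Matrix.vecMulVec_mul_vecMulVec, h]; ext; simp [Matrix.vecMulVec]
  refine ⟨1 + Matrix.vecMulVec x y, 1 - Matrix.vecMulVec x y, ?_, ?_, ?_⟩
  · rw [mul_sub, add_mul, add_mul, hz]; simp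
  · rw [mul_add, sub_mul, sub_mul, hz]; simp
  · rw [Matrix.add_mulVec, Matrix.one_mulVec, Matrix.vecMulVec_mulVec]
    simp

/-- Unimodularity. -/
def Um (v : ι → A) : Prop := ∃ w : ι → A, w ⬝ᵥ v = 1

lemma Um.map {v : ι → A} (h : Um v) (f : A →+* B) : Um (fun i => f (v i)) := by
  obtain ⟨w, hw⟩ := h
  refine ⟨fun i => f (w i), ?_⟩
  have := congrArg f hw
  simpa [dotProduct, map_sum] using this

end

/-- Nonminimality of primes containing the boundary ideal lowers the dimension. -/
lemma kron_dim {R : Type*} [CommRing R] (b : R) (J : Ideal R) (hb : b ∈ J)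
    (hJ : ∀ x, IsNilpotent (x * b) → x ∈ J) (n : ℕ)
    (h : ringKrullDim R < (n + 1 : ℕ)) : ringKrullDim (R ⧸ J) < n := by
  by_contra hlt
  rw [not_lt, ringKrullDim_quotient, Order.le_krullDim_iff] at hlt
  obtain ⟨l, hl⟩ := hlt
  obtain ⟨p, hp, hp'⟩ := Ideal.exists_minimalPrimes_le (J := l.head.1.asIdeal) bot_le
  let p' : PrimeSpectrum R := ⟨p, hp.1.1⟩
  have hp' : p' < l.head.1 := by
    refine lt_of_le_of_ne hp' fun h => ?_
    have hJp : (J : Set R) ⊆ p := by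
      have := l.head.2
      rw [← h] at this
      exact this
    have hpp : p.IsPrime := hp.1.1
    by_cases hdis : Disjoint ((⊥ : Ideal R) : Set R)
        ((p.primeCompl ⊔ Submonoid.powers b : Submonoid R) : Set R)
    · obtain ⟨q, hq, -, hqd⟩ := Ideal.exists_le_prime_disjoint _ _ hdis
      have hqp : q ≤ p := fun z hz => by
        by_contra hzp
        exact Set.disjoint_left.1 hqd hz ((le_sup_left : p.primeCompl ≤ _) hzp)
      have hbq : b ∈ q := hp.2 ⟨hq, bot_le⟩ hqp (hJp hb)
      exact Set.disjoint_left.1 hqd hbq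
        ((le_sup_right : Submonoid.powers b ≤ p.primeCompl ⊔ _) (Submonoid.mem_powers b))
    · rw [Set.not_disjoint_iff] at hdis
      obtain ⟨z, hz0, hz⟩ := hdis
      obtain ⟨y, hy, _, ⟨k, rfl⟩, hyk⟩ := Submonoid.mem_sup.1 hz
      refine hy (hJp (hJ y ⟨k + 1, ?_⟩))
      have hz0' : z = 0 := by simpa using hz0
      have hyk' : y * b ^ k = 0 := by rw [← hz0', ← hyk]
      rw [mul_pow, pow_succ y, pow_succ b]
      linear_combination (y ^ k * b) * hyk'
  have hlen : ∀ l' : LTSeries (PrimeSpectrum R), l'.length = n → p' < l'.head →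
      ∃ l'' : LTSeries (PrimeSpectrum R), l''.length = n + 1 := fun l' h1 h2 =>
    ⟨l'.cons p' h2, by rw [RelSeries.cons_length, h1]⟩
  have := (Order.le_krullDim_iff (α := PrimeSpectrum R) (n := n + 1)).2
    (hlen (l.map Subtype.val (Subtype.strictMono_coe _)) hl hp')
  exact absurd h (not_lt.2 this)

theorem kronecker (n : ℕ) : ∀ (R : Type*) [CommRing R], ringKrullDim R < n →
    ∀ (a : R) (b : Fin n → R), ∃ x : Fin n → R,
      ∀ p : Ideal R, p.IsPrime → (∀ i, b i + a * x i ∈ p) → a ∈ p := by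
  induction n with
  | zero =>
    intro R _ h a b
    refine ⟨0, fun p hp _ => ?_⟩
    have : Nontrivial R := by
      refine ⟨0, 1, fun h => hp.ne_top ((Ideal.eq_top_iff_one p).2 (h ▸ p.zero_mem))⟩
    exact absurd (ringKrullDim_nonneg_of_nontrivial (R := R)) (not_le.2 (by simpa using h))
  | succ n ih =>
    intro R _ h a b
    let J1 : Ideal R := Submodule.comap (LinearMap.mulRight R (b 0)) (nilradical R)
    have hJ1 : ∀ x, x ∈ J1 ↔ IsNilpotent (x * b 0) := fun x => by
      simp [J1, mem_nilradical]
    let J : Ideal R := Ideal.span {b 0} ⊔ J1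
    have hd := kron_dim (b 0) J (Ideal.mem_sup_left (Ideal.mem_span_singleton_self _))
      (fun x hx => Ideal.mem_sup_right ((hJ1 x).2 hx)) n h
    obtain ⟨y, hy⟩ := ih (R ⧸ J) hd (Ideal.Quotient.mk J a)
      (fun i => Ideal.Quotient.mk J (b i.succ))
    choose x hx using fun i => Ideal.Quotient.mk_surjective (y i)
    let I : Ideal R := Ideal.span (Set.range fun i => b i.succ + a * x i)
    have hI : a ∈ (I ⊔ J).radical := by
      rw [Ideal.radical_eq_sInf, Ideal.mem_sInf]
      rintro p ⟨hp, hpp⟩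
      have hJp : J ≤ p := le_trans le_sup_right hp
      have hker : RingHom.ker (Ideal.Quotient.mk J) ≤ p := by rwa [Ideal.mk_ker]
      have hp' := Ideal.map_isPrime_of_surjective (Ideal.Quotient.mk_surjective (I := J)) hker
      have := hy (p.map (Ideal.Quotient.mk J)) hp' (fun i => by
        rw [← hx i, ← map_mul, ← map_add]
        exact Ideal.mem_map_of_mem _
          (hp (Ideal.mem_sup_left (Ideal.subset_span ⟨i, rfl⟩))))
      have h2 : a ∈ (p.map (Ideal.Quotient.mk J)).comap (Ideal.Quotient.mk J) := this
      rwa [Ideal.comap_map_of_surjective' _ Ideal.Quotient.mk_surjective, Ideal.mk_ker,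
        sup_eq_left.2 hJp] at h2
    obtain ⟨k, hk⟩ := hI
    obtain ⟨c, hc, j, hj, hcj⟩ := Submodule.mem_sup.1 hk
    obtain ⟨e, he, x0, hx0, hex⟩ := Submodule.mem_sup.1 hj
    refine ⟨Fin.cons x0 x, fun p hp hmem => ?_⟩
    have h0 : b 0 + a * x0 ∈ p := by simpa using hmem 0
    have hIp : I ≤ p := by
      rw [Ideal.span_le]
      rintro _ ⟨i, rfl⟩
      simpa using hmem i.succ
    have hn : x0 * b 0 ∈ p := by
      obtain ⟨m, hm⟩ := (hJ1 x0).1 hx0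
      exact hp.mem_of_pow_mem m (hm ▸ p.zero_mem)
    have fin : b 0 ∈ p → x0 ∈ p → a ∈ p := by
      intro hb hx
      refine hp.mem_of_pow_mem k ?_
      rw [← hcj, ← hex]
      refine p.add_mem (hIp hc) (p.add_mem ?_ hx)
      exact (Ideal.span_singleton_le_iff_mem p).2 hb he
    rcases hp.mem_or_mem hn with hx | hb
    · refine fin ?_ hx
      exact (Ideal.add_mem_iff_left p (p.mul_mem_left a hx)).1 h0
    · have : a * x0 ∈ p := (Ideal.add_mem_iff_right p hb).1 h0
      rcases hp.mem_or_mem this with ha | hx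
      · exact ha
      · exact fin hb hx

theorem bass {R : Type*} [CommRing R] {M : ℕ} (h : ringKrullDim R < M) (v : Fin (M + 1) → R)
    (hv : Um v) : Rel v (Pi.single 0 1) := by
  obtain ⟨x, hx⟩ := kronecker M R h (v 0) (fun i => v i.succ)
  have h1 : Rel v (v + v 0 • (Fin.cons 0 x : Fin (M + 1) → R)) := by
    have := Rel.transvection v (Fin.cons 0 x) (Pi.single 0 1) (by simp)
    simpa using this
  set v' := v + v 0 • (Fin.cons 0 x : Fin (M + 1) → R) with hv'
  have hs : Ideal.span (Set.range fun i : Fin M => v' i.succ) = ⊤ := by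
    by_contra hne
    obtain ⟨m, hm, hle⟩ := Ideal.exists_le_maximal _ hne
    have hmem : ∀ i : Fin M, v i.succ + v 0 * x i ∈ m := fun i => by
      have := hle (Ideal.subset_span ⟨i, rfl⟩)
      simpa [hv'] using this
    have ha := hx m hm.isPrime hmem
    have hb : ∀ i, v i ∈ m := by
      intro i
      refine Fin.cases ha (fun i => ?_) i
      exact (Ideal.add_mem_iff_left m (m.mul_mem_right _ ha)).1 (hmem i)
    obtain ⟨w, hw⟩ := hv
    refine hm.ne_top ((Ideal.eq_top_iff_one m).2 (hw ▸ ?_))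
    exact m.sum_mem fun i _ => m.mul_mem_left _ (hb i)
  have h1' : (1 : R) ∈ Ideal.span (Set.range fun i : Fin M => v' i.succ) := hs ▸ Submodule.mem_top
  obtain ⟨c, hc⟩ := (Ideal.mem_span_range_iff_exists_fun).1 h1'
  have h2 : Rel v' (v' + (1 - v' 0) • (Pi.single 0 1 : Fin (M + 1) → R)) := by
    have := Rel.transvection v' (Pi.single 0 1) (Fin.cons 0 (fun i => (1 - v' 0) * c i)) (by simp)
    convert this using 3
    simp only [dotProduct, Fin.sum_univ_succ, Fin.cons_zero, Fin.cons_succ, mul_assoc,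
      ← Finset.mul_sum, hc]
    ring
  set v'' := v' + (1 - v' 0) • (Pi.single 0 1 : Fin (M + 1) → R) with hv''
  have h0 : v'' 0 = 1 := by simp [hv'']
  have h3 : Rel v'' (Pi.single 0 1) := by
    have := Rel.transvection v'' (Fin.cons 0 (fun i => - v'' i.succ)) (Pi.single 0 1) (by simp)
    convert this using 1
    ext i
    refine Fin.cases ?_ (fun i => ?_) i
    · simp [h0]
    · simp [h0]
  exact h1.trans (h2.trans h3)

end SF12

namespace SF12
open Polynomial

lemma ideal_top {B : Type*} [CommRing B] [IsLocalRing B] (O : Ideal B[X]) (f : B[X])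
    (hf : f.Monic) (hfO : f ∈ O) (g : B[X]) (hgO : g ∈ O)
    (hg : g.map (IsLocalRing.residue B) = 1) : O = ⊤ := by
  by_contra hne
  obtain ⟨n, hn, hle⟩ := Ideal.exists_le_maximal _ hne
  have hintg := hf.quotient_isIntegral (hle hfO)
  have : (n.comap (C : B →+* B[X])).IsMaximal := by
    let _ := Ideal.Quotient.field n
    have h1 := Ideal.isMaximal_comap_of_isIntegral_of_isMaximal' _ hintg (⊥ : Ideal (B[X] ⧸ n))
    convert h1 using 1
    ext z
    rw [Ideal.mem_comap, Ideal.mem_comap, Ideal.mem_bot]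
    exact Ideal.Quotient.eq_zero_iff_mem.symm
  have hm := IsLocalRing.eq_maximalIdeal this
  have h1 : 1 - g ∈ n := by
    have hc : ∀ i, C ((1 - g).coeff i) ∈ n := by
      intro i
      have : (1 - g).coeff i ∈ n.comap (C : B →+* B[X]) := by
        rw [hm, ← IsLocalRing.residue_eq_zero_iff, ← coeff_map]
        simp [hg]
      exact this
    rw [(1 - g).as_sum_range_C_mul_X_pow]
    exact n.sum_mem fun i _ => n.mul_mem_right _ (hc i)
  exact hn.ne_top ((Ideal.eq_top_iff_one n).2 (by simpa using n.add_mem h1 (hle hgO)))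

lemma prim {ι A : Type*} [Fintype ι] [CommRing A] [IsDomain A] [IsPrincipalIdealRing A]
    (l : ι → A) (hl : l ≠ 0) : ∃ (g : A) (l' q : ι → A), g ≠ 0 ∧ l = g • l' ∧ l' ⬝ᵥ q = 1 := by
  obtain ⟨g, hg⟩ := (IsPrincipalIdealRing.principal (Ideal.span (Set.range l))).principal
  have h1 : ∀ i, ∃ c, l i = g * c := fun i => by
    have : l i ∈ Ideal.span (Set.range l) := Ideal.subset_span ⟨i, rfl⟩
    rw [hg] at this
    obtain ⟨c, hc⟩ := Ideal.mem_span_singleton'.1 this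
    exact ⟨c, by rw [← hc, mul_comm]⟩
  choose l' hl' using h1
  have hg0 : g ≠ 0 := by
    rintro rfl
    exact hl (funext fun i => by simp [hl' i])
  have h2 : g ∈ Ideal.span (Set.range l) := by rw [hg]; exact Ideal.mem_span_singleton_self g
  obtain ⟨c, hc⟩ := (Ideal.mem_span_range_iff_exists_fun).1 h2
  refine ⟨g, l', c, hg0, funext hl', ?_⟩
  apply mul_left_cancel₀ hg0
  rw [mul_one]
  conv_rhs => rw [← hc]
  simp only [dotProduct, Finset.mul_sum]
  refine Finset.sum_congr rfl fun i _ => ?_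
  rw [hl' i]; ring

/-- The first `j` columns of `W` form a unimodular frame, and `det W` divides a monic. -/
def Good {B : Type*} [CommRing B] {N : ℕ} (j : ℕ) (W : Matrix (Fin N) (Fin N) B[X]) : Prop :=
  (∃ D, (D * W.det).Monic) ∧ ∃ V : Matrix (Fin N) (Fin N) B[X],
    ∀ a b : Fin N, a.val < j → b.val < j → (V * W) a b = if a = b then 1 else 0

open Matrix in
lemma good_step {B : Type*} [CommRing B] [IsLocalRing B] {N : ℕ} (j : ℕ) (hj : j + 1 < N)
    (W : Matrix (Fin N) (Fin N) B[X]) (hW : Good j W) :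
    ∃ c, Good (j + 1) (W.updateCol ⟨j, by omega⟩ c) := by
  obtain ⟨⟨D, hD⟩, V, hV⟩ := hW
  set J : Fin N := ⟨j, by omega⟩ with hJ
  let ρ : B[X] →+* (IsLocalRing.ResidueField B)[X] := mapRingHom (IsLocalRing.residue B)
  have hρ : Function.Surjective ρ := Polynomial.map_surjective _ IsLocalRing.residue_surjective
  let Wb : Matrix (Fin N) (Fin N) (IsLocalRing.ResidueField B)[X] :=
    Matrix.of fun a b => if b.val ≤ j then ρ (W a b) else 0
  have hdet : Wb.det = 0 := by
    refine Matrix.det_eq_zero_of_column_eq_zero ⟨j + 1, hj⟩ fun i => ?_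
    simp [Wb]
  obtain ⟨l0, hl0, hl0W⟩ := Matrix.exists_vecMul_eq_zero_iff.2 hdet
  obtain ⟨g, lb, qb, hg, hlg, hlq⟩ := prim l0 hl0
  have hlW : lb ᵥ* Wb = 0 := by
    rw [hlg, Matrix.smul_vecMul] at hl0W
    exact (smul_eq_zero.1 hl0W).resolve_left hg
  choose lt hlt using fun i => hρ (lb i)
  choose q hq using fun i => hρ (qb i)
  have hltW : ∀ b : Fin N, b.val ≤ j → ρ ((lt ᵥ* W) b) = 0 := by
    intro b hb
    have := congrFun hlW b
    simp only [Matrix.vecMul, dotProduct, Pi.zero_apply] at this ⊢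
    rw [map_sum, ← this]
    refine Finset.sum_congr rfl fun i _ => ?_
    simp [Wb, hb, hlt]
  have hltq : ρ (lt ⬝ᵥ q) = 1 := by
    rw [← hlq]
    simp only [dotProduct, map_sum, map_mul, hlt, hq]
  set E := (W.updateCol J q).det with hE
  set L := (D * E).natDegree + 1 with hL
  let c : Fin N → B[X] := q + (X ^ L : B[X]) • (fun i => W i J)
  have hWW : W.updateCol J (fun i => W i J) = W := Matrix.updateCol_eq_self W J
  have hdet' : (W.updateCol J c).det = E + X ^ L * W.det := by
    simp only [c]
    rw [Matrix.det_updateCol_add, Matrix.det_updateCol_smul, hWW]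
  have hmon : (D * (W.updateCol J c).det).Monic := by
    have : D * (W.updateCol J c).det = D * E + X ^ L * (D * W.det) := by rw [hdet']; ring
    rw [this]
    have hm := (monic_X_pow (R := B) L).mul hD
    refine hm.add_of_right ?_
    refine lt_of_le_of_lt degree_le_natDegree ?_
    rw [degree_eq_natDegree hm.ne_zero, (monic_X_pow (R := B) L).natDegree_mul hD, natDegree_X_pow]
    exact_mod_cast (by omega : (D * E).natDegree < L + (D * W.det).natDegree)
  refine ⟨c, ⟨D, hmon⟩, ?_⟩
  set W' := W.updateCol J c with hW'
  have hW'b : ∀ i (b : Fin N), b.val < j → W' i b = W i b := by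
    intro i b hb
    rw [hW', Matrix.updateCol_ne]
    intro h; rw [h] at hb; simp [hJ] at hb
  have hW'J : ∀ i, W' i J = c i := fun i => by rw [hW', Matrix.updateCol_self]
  -- the order ideal
  let O : Ideal B[X] :=
    { carrier := {z | ∃ l : Fin N → B[X], (∀ b : Fin N, b.val < j → (l ᵥ* W) b = 0) ∧ l ⬝ᵥ c = z}
      add_mem' := by
        rintro _ _ ⟨l, hl, rfl⟩ ⟨l', hl', rfl⟩
        refine ⟨l + l', fun b hb => ?_, by rw [add_dotProduct]⟩
        rw [Matrix.add_vecMul, Pi.add_apply, hl b hb, hl' b hb, add_zero]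
      zero_mem' := ⟨0, fun b _ => by simp, by simp⟩
      smul_mem' := by
        rintro z _ ⟨l, hl, rfl⟩
        refine ⟨z • l, fun b hb => ?_, by rw [smul_dotProduct]⟩
        rw [Matrix.smul_vecMul, Pi.smul_apply, hl b hb, smul_zero] }
  have hO1 : D * W'.det ∈ O := by
    refine ⟨D • (W'.adjugate J), fun b hb => ?_, ?_⟩
    · have h1 := congrFun (congrFun (Matrix.adjugate_mul W') J) b
      have hne : J ≠ b := by intro h; rw [← h] at hb; simp [hJ] at hb
      rw [Matrix.smul_apply, Matrix.one_apply_ne hne, smul_zero, Matrix.mul_apply] at h1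
      rw [Matrix.smul_vecMul, Pi.smul_apply]
      have : (W'.adjugate J ᵥ* W) b = 0 := by
        rw [← h1]
        simp only [Matrix.vecMul, dotProduct]
        exact Finset.sum_congr rfl fun i _ => by rw [hW'b i b hb]
      rw [this, smul_zero]
    · have h1 := congrFun (congrFun (Matrix.adjugate_mul W') J) J
      rw [Matrix.smul_apply, Matrix.one_apply_eq, Matrix.mul_apply] at h1
      rw [smul_dotProduct, smul_eq_mul]
      congr 1
      rw [smul_eq_mul, mul_one] at h1
      rw [← h1]
      exact Finset.sum_congr rfl fun i _ => by rw [hW'J i]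
  let y : Fin N → B[X] := fun a => if a.val < j then (lt ᵥ* W) a else 0
  have hy : ∀ a, ρ (y a) = 0 := by
    intro a
    simp only [y]
    split_ifs with h
    · exact hltW a h.le
    · exact map_zero _
  let l1 : Fin N → B[X] := lt - y ᵥ* V
  have hl1 : ∀ b : Fin N, b.val < j → (l1 ᵥ* W) b = 0 := by
    intro b hb
    simp only [l1]
    rw [Matrix.sub_vecMul, Matrix.vecMul_vecMul, Pi.sub_apply, sub_eq_zero]
    have : (y ᵥ* (V * W)) b = ∑ a, if a = b then y a else 0 := by
      simp only [Matrix.vecMul, dotProduct]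
      refine Finset.sum_congr rfl fun a _ => ?_
      by_cases ha : a.val < j
      · rw [hV a b ha hb]; simp
      · have h0 : y a = 0 := by simp [y, ha]
        rw [h0, zero_mul, ite_self]
    rw [this]
    simp [y, hb]
  have hO2 : l1 ⬝ᵥ c ∈ O := ⟨l1, hl1, rfl⟩
  have hO3 : (l1 ⬝ᵥ c).map (IsLocalRing.residue B) = 1 := by
    change ρ (l1 ⬝ᵥ c) = 1
    simp only [l1, c, sub_dotProduct, dotProduct_add, dotProduct_smul, map_sub, map_add]
    rw [hltq]
    have h1 : ρ (lt ⬝ᵥ (fun i => W i J)) = 0 := hltW J (by simp [hJ])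
    have h2 : ∀ z : Fin N → B[X], ρ ((y ᵥ* V) ⬝ᵥ z) = 0 := by
      intro z
      rw [← Matrix.dotProduct_mulVec, dotProduct, map_sum]
      exact Finset.sum_eq_zero fun i _ => by rw [map_mul, hy, zero_mul]
    rw [smul_eq_mul, map_mul, map_sub, h1, h2, h2]
    simp
  have htop := ideal_top O _ hmon hO1 _ hO2 hO3
  obtain ⟨l, hl, hlc⟩ : (1 : B[X]) ∈ O := htop ▸ Submodule.mem_top
  refine ⟨Matrix.of fun a k => if a = J then l k else V a k - ((fun k => V a k) ⬝ᵥ c) * l k, ?_⟩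
  have hlW' : ∀ b : Fin N, b.val < j + 1 → l ⬝ᵥ (fun i => W' i b) = if J = b then 1 else 0 := by
    intro b hb
    by_cases hbJ : J = b
    · subst hbJ
      simp only [hW'J, if_true]; exact hlc
    · have hbj : b.val < j := by
        have : b.val ≠ j := fun h => hbJ (Fin.ext (by simp [hJ, h]))
        omega
      rw [if_neg hbJ, ← hl b hbj]
      simp only [hW'b _ b hbj]; rfl
  intro a b ha hb
  rw [Matrix.mul_apply]
  by_cases haJ : a = J
  · subst haJ
    simp only [Matrix.of_apply, if_true]
    exact hlW' b hb
  · have haj : a.val < j := by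
      have : a.val ≠ j := fun h => haJ (Fin.ext (by simp [hJ, h]))
      omega
    have hlW'b := hlW' b hb
    rw [dotProduct] at hlW'b
    simp only [Matrix.of_apply, if_neg haJ, sub_mul, Finset.sum_sub_distrib, mul_assoc,
      ← Finset.mul_sum, hlW'b]
    by_cases hbJ : J = b
    · subst hbJ
      simp only [hW'J, if_true, if_neg haJ, dotProduct]
      simp
    · have hbj : b.val < j := by
        have : b.val ≠ j := fun h => hbJ (Fin.ext (by simp [hJ, h]))
        omega
      rw [if_neg hbJ, mul_zero, sub_zero, ← hV a b haj hbj, Matrix.mul_apply]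
      simp only [hW'b _ b hbj]

open Matrix in
lemma good_last {A : Type*} [CommRing A] {M : ℕ} (W V : Matrix (Fin (M + 1)) (Fin (M + 1)) A)
    (hV : ∀ a b : Fin M, (V * W) a.castSucc b.castSucc = if a = b then 1 else 0) :
    ∃ c, (W.updateCol (Fin.last M) c).det = 1 := by
  let p : Fin (M + 1) → Fin (M + 1) → A := fun i k =>
    (if k = i then 1 else 0) - ∑ a : Fin M, W k a.castSucc * V a.castSucc i
  have hp : ∀ i (a : Fin M), V a.castSucc ⬝ᵥ p i = 0 := by
    intro i a
    simp only [p, dotProduct, mul_sub, Finset.sum_sub_distrib, Finset.mul_sum]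
    rw [Finset.sum_comm]
    have : ∀ b : Fin M, ∑ k, V a.castSucc k * (W k b.castSucc * V b.castSucc i)
        = (if a = b then 1 else 0) * V b.castSucc i := by
      intro b
      rw [← hV a b, Matrix.mul_apply, Finset.sum_mul]
      exact Finset.sum_congr rfl fun _ _ => by ring
    simp [this]
  have hdet : ∀ i, (V.updateRow (Fin.last M) (Pi.single i 1)).det *
      (W.updateCol (Fin.last M) (p i)).det = p i i := by
    intro i
    rw [← Matrix.det_mul, Matrix.det_of_isLowerTriangular, Fin.prod_univ_castSucc]
    · have h1 : ∀ a : Fin M, ((V.updateRow (Fin.last M) (Pi.single i 1)) *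
          (W.updateCol (Fin.last M) (p i))) a.castSucc a.castSucc = 1 := by
        intro a
        have := hV a a
        rw [if_pos rfl] at this
        rw [← this, Matrix.mul_apply, Matrix.mul_apply]
        refine Finset.sum_congr rfl fun k _ => ?_
        rw [Matrix.updateRow_ne (Fin.castSucc_lt_last a).ne,
          Matrix.updateCol_ne (Fin.castSucc_lt_last a).ne]
      rw [Finset.prod_eq_one fun a _ => h1 a, one_mul, Matrix.mul_apply]
      simp [Matrix.updateRow_self, Matrix.updateCol_self, Pi.single_apply]
    · intro a b hab
      have hab : a < b := hab
      have ha : a ≠ Fin.last M := (lt_of_lt_of_le hab (Fin.le_last b)).ne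
      obtain ⟨a, rfl⟩ := Fin.exists_castSucc_eq.2 ha
      by_cases hb : b = Fin.last M
      · subst hb
        rw [← hp i a, Matrix.mul_apply]
        refine Finset.sum_congr rfl fun k _ => ?_
        rw [Matrix.updateRow_ne ha, Matrix.updateCol_self]
      · obtain ⟨b, rfl⟩ := Fin.exists_castSucc_eq.2 hb
        have := hV a b
        rw [if_neg (by rintro rfl; exact lt_irrefl _ hab)] at this
        rw [← this, Matrix.mul_apply, Matrix.mul_apply]
        refine Finset.sum_congr rfl fun k _ => ?_
        rw [Matrix.updateRow_ne ha, Matrix.updateCol_ne hb]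
  have htr : ∑ i, p i i = 1 := by
    simp only [p, Finset.sum_sub_distrib, if_true]
    rw [Finset.sum_comm]
    have : ∀ b : Fin M, ∑ k, W k b.castSucc * V b.castSucc k = 1 := by
      intro b
      have := hV b b
      rw [if_pos rfl, Matrix.mul_apply] at this
      rw [← this]
      exact Finset.sum_congr rfl fun _ _ => by ring
    simp [this]
  refine ⟨∑ i, (V.updateRow (Fin.last M) (Pi.single i 1)).det • p i, ?_⟩
  rw [← Matrix.cramer_apply, map_sum, Finset.sum_apply]
  refine Eq.trans ?_ htr
  refine Finset.sum_congr rfl fun i _ => ?_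
  rw [map_smul, Pi.smul_apply, Matrix.cramer_apply, smul_eq_mul, hdet]

lemma good_iter {B : Type*} [CommRing B] [IsLocalRing B] {M : ℕ} (v : Fin (M + 1) → B[X])
    (W : Matrix (Fin (M + 1)) (Fin (M + 1)) B[X]) (hW : Good 1 W) (hv : ∀ i, W i 0 = v i)
    (j : ℕ) (hj : j + 1 ≤ M) : ∃ W' : Matrix (Fin (M + 1)) (Fin (M + 1)) B[X],
      Good (j + 1) W' ∧ ∀ i, W' i 0 = v i := by
  induction j with
  | zero => exact ⟨W, hW, hv⟩
  | succ j ih =>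
    obtain ⟨W', h1, h2⟩ := ih (by omega)
    obtain ⟨c, hc⟩ := good_step (j + 1) (by omega) W' h1
    refine ⟨_, hc, fun i => ?_⟩
    rw [Matrix.updateCol_ne, h2]
    intro h
    have := congrArg Fin.val h
    simp at this

theorem horrocks {B : Type*} [CommRing B] [IsLocalRing B] {M : ℕ} (hM : 1 ≤ M)
    (v : Fin (M + 1) → B[X]) (hv : Um v)
    (W : Matrix (Fin (M + 1)) (Fin (M + 1)) B[X]) (hWv : ∀ i, W i 0 = v i)
    (D : B[X]) (hD : (D * W.det).Monic) : Rel v (Pi.single 0 1) := by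
  obtain ⟨w, hw⟩ := hv
  have h1 : Good 1 W := by
    refine ⟨⟨D, hD⟩, Matrix.of fun _ => w, ?_⟩
    intro a b ha hb
    obtain rfl : a = 0 := Fin.ext (by simpa using ha)
    obtain rfl : b = 0 := Fin.ext (by simpa using hb)
    rw [if_pos rfl, Matrix.mul_apply, ← hw]
    exact Finset.sum_congr rfl fun i _ => by rw [hWv]; rfl
  obtain ⟨j, rfl⟩ : ∃ j, M = j + 1 := ⟨M - 1, by omega⟩
  obtain ⟨W', ⟨-, V, hV⟩, hW'⟩ := good_iter v W h1 hWv j le_rfl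
  obtain ⟨c, hc⟩ := good_last W' V (fun a b => by
    rw [hV _ _ (by simpa using a.2) (by simpa using b.2)]
    simp)
  set Z := W'.updateCol (Fin.last (j + 1)) c with hZdef
  have hZ : ∀ i, Z i 0 = v i := fun i => by
    rw [hZdef, Matrix.updateCol_ne, hW']
    exact (Fin.last_pos).ne
  refine Rel.symm ⟨Z, Z.adjugate, by rw [Matrix.mul_adjugate, hc, one_smul],
    by rw [Matrix.adjugate_mul, hc, one_smul], ?_⟩
  ext1 i
  simp [hZ]

end SF12

namespace SF12
open Polynomial

/-- The substitution `X ↦ s X`. -/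
noncomputable def sub {A : Type*} [CommRing A] (s : A) : A[X] →+* A[X] := compRingHom (C s * X)

lemma sub_coeff {A : Type*} [CommRing A] (s : A) (f : A[X]) (n : ℕ) :
    (sub s f).coeff n = f.coeff n * s ^ n := by
  simp [sub, comp_C_mul_X_coeff]

lemma sub_sub {A : Type*} [CommRing A] (s t : A) (f : A[X]) : sub t (sub s f) = sub (s * t) f := by
  ext n
  simp only [sub_coeff]; ring

lemma sub_map {A A' : Type*} [CommRing A] [CommRing A'] (φ : A →+* A') (s : A) (f : A[X]) :
    (sub s f).map φ = sub (φ s) (f.map φ) := by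
  ext n
  simp [sub_coeff]

lemma exists_lift {A A' : Type*} [CommRing A] [CommRing A'] [Algebra A A'] (S : Submonoid A)
    [IsLocalization S A'] {κ : Type*} [Fintype κ] (F : κ → A'[X]) (z : κ → A)
    (hz : ∀ k, (F k).coeff 0 = algebraMap A A' (z k)) :
    ∃ s ∈ S, ∃ f : κ → A[X], ∀ k, (f k).coeff 0 = z k ∧
      (f k).map (algebraMap A A') = sub (algebraMap A A' s) (F k) := by
  classical
  obtain ⟨s, hs⟩ := IsLocalization.exist_integer_multiples_of_finset S
    (Finset.univ.biUnion fun k => (F k).coeffs)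
  have h1 : ∀ k i, ∃ g : A, algebraMap A A' g = algebraMap A A' s * (F k).coeff i := by
    intro k i
    by_cases h0 : (F k).coeff i = 0
    · exact ⟨0, by simp [h0]⟩
    · obtain ⟨g, hg⟩ := hs ((F k).coeff i)
        (Finset.mem_biUnion.2 ⟨k, Finset.mem_univ _, coeff_mem_coeffs h0⟩)
      exact ⟨g, by rw [hg, Algebra.smul_def]⟩
  choose g hg using h1
  refine ⟨s, s.2, fun k => C (z k) + ∑ i ∈ Finset.range (F k).natDegree,
    C (g k (i + 1) * (s : A) ^ i) * X ^ (i + 1), fun k => ⟨?_, ?_⟩⟩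
  · simp [coeff_X_pow]
  · ext n
    rw [coeff_map, sub_coeff]
    cases n with
    | zero => simp [hz, coeff_X_pow]
    | succ n =>
      simp only [coeff_add, coeff_C_succ, zero_add, finsetSum_coeff, coeff_C_mul, coeff_X_pow,
        add_left_inj, mul_ite, mul_one, mul_zero, Finset.sum_ite_eq, Finset.mem_range]
      split_ifs with h
      · rw [map_mul, hg, map_pow]; ring
      · rw [coeff_eq_zero_of_natDegree_lt (by omega)]; simp

lemma exists_kill {A A' : Type*} [CommRing A] [CommRing A'] [Algebra A A'] (S : Submonoid A)
    [IsLocalization S A'] {κ : Type*} [Fintype κ] (f : κ → A[X])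
    (h0 : ∀ k, (f k).coeff 0 = 0) (hf : ∀ k, (f k).map (algebraMap A A') = 0) :
    ∃ t ∈ S, ∀ k, sub t (f k) = 0 := by
  classical
  have h1 : ∀ k i, ∃ t : S, (t : A) * (f k).coeff i = 0 := by
    intro k i
    refine (IsLocalization.map_eq_zero_iff S A' _).1 ?_
    rw [← coeff_map, hf, coeff_zero]
  choose t ht using h1
  refine ⟨∏ k, ∏ i ∈ Finset.range ((f k).natDegree + 1), (t k i : A), ?_, fun k => ?_⟩
  · exact S.prod_mem fun k _ => S.prod_mem fun i _ => (t k i).2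
  · ext n
    rw [sub_coeff, coeff_zero]
    cases n with
    | zero => rw [h0, zero_mul]
    | succ n =>
      by_cases hn : n + 1 < (f k).natDegree + 1
      · have hd : (t k (n + 1) : A) ∣ ∏ k, ∏ i ∈ Finset.range ((f k).natDegree + 1), (t k i : A) :=
          (Finset.dvd_prod_of_mem (fun i => (t k i : A)) (Finset.mem_range.2 hn)).trans
            (Finset.dvd_prod_of_mem
              (fun k => ∏ i ∈ Finset.range ((f k).natDegree + 1), (t k i : A)) (Finset.mem_univ k))
        obtain ⟨c, hc⟩ := hd
        rw [hc, mul_pow, pow_succ (t k (n + 1) : A)]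
        linear_combination ((t k (n + 1) : A) ^ n * c ^ (n + 1)) * ht k (n + 1)
      · rw [coeff_eq_zero_of_natDegree_lt (by omega), zero_mul]

section
variable {ι : Type*} [Fintype ι] [DecidableEq ι]

lemma mone {R₁ R₂ : Type*} [CommRing R₁] [CommRing R₂] (g : R₁ →+* R₂) :
    (1 : Matrix ι ι R₁).map g = 1 := Matrix.map_one g (map_zero g) (map_one g)

lemma patch1 {A A' : Type*} [CommRing A] [CommRing A'] [Algebra A A'] (S : Submonoid A)
    [IsLocalization S A'] (a b : ι → A[X]) (hab : ∀ i, (a i).coeff 0 = (b i).coeff 0)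
    (H H' : Matrix ι ι A'[X]) (h1 : H * H' = 1) (h2 : H' * H = 1)
    (h0 : H.map (fun f => f.coeff 0) = 1) (h0' : H'.map (fun f => f.coeff 0) = 1)
    (hH : H.mulVec (fun i => (a i).map (algebraMap A A')) =
      fun i => (b i).map (algebraMap A A')) :
    ∃ s ∈ S, Rel (fun i => sub s (a i)) (fun i => sub s (b i)) := by
  have e0 : ∀ i j, (H i j).coeff 0 = algebraMap A A' ((1 : Matrix ι ι A) i j) := by
    intro i j
    have := congrFun (congrFun h0 i) j
    rw [Matrix.map_apply] at this
    rw [this, Matrix.one_apply, Matrix.one_apply]; split_ifs <;> simp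
  have e0' : ∀ i j, (H' i j).coeff 0 = algebraMap A A' ((1 : Matrix ι ι A) i j) := by
    intro i j
    have := congrFun (congrFun h0' i) j
    rw [Matrix.map_apply] at this
    rw [this, Matrix.one_apply, Matrix.one_apply]; split_ifs <;> simp
  obtain ⟨s, hs, f, hf⟩ := exists_lift S
    (fun k : Bool × ι × ι => if k.1 then H k.2.1 k.2.2 else H' k.2.1 k.2.2)
    (fun k => (1 : Matrix ι ι A) k.2.1 k.2.2) (by
      rintro ⟨_ | _, i, j⟩
      · simpa using e0' i j
      · simpa using e0 i j)
  let G : Matrix ι ι A[X] := Matrix.of fun i j => f (true, i, j)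
  let G' : Matrix ι ι A[X] := Matrix.of fun i j => f (false, i, j)
  let φ : A[X] →+* A'[X] := mapRingHom (algebraMap A A')
  let c0 : A[X] →+* A := constantCoeff
  have hG : G.map φ = H.map (sub (algebraMap A A' s)) := by
    ext1 i j; exact (hf (true, i, j)).2
  have hG' : G'.map φ = H'.map (sub (algebraMap A A' s)) := by
    ext1 i j; exact (hf (false, i, j)).2
  have cG : G.map c0 = 1 := by
    ext1 i j; exact (hf (true, i, j)).1
  have cG' : G'.map c0 = 1 := by
    ext1 i j; exact (hf (false, i, j)).1
  have k1 : (G * G').map φ = 1 := by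
    rw [Matrix.map_mul, hG, hG', ← Matrix.map_mul, h1, Matrix.map_one _ (map_zero _) (map_one _)]
  have k2 : (G' * G).map φ = 1 := by
    rw [Matrix.map_mul, hG, hG', ← Matrix.map_mul, h2, Matrix.map_one _ (map_zero _) (map_one _)]
  have k1c : (G * G').map c0 = 1 := by rw [Matrix.map_mul, cG, cG', one_mul]
  have k2c : (G' * G).map c0 = 1 := by rw [Matrix.map_mul, cG, cG', one_mul]
  have k3 : ∀ i, φ (G.mulVec (fun i => sub s (a i)) i) = φ (sub s (b i)) := by
    intro i
    rw [RingHom.map_mulVec, hG]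
    have e1 : (φ ∘ fun i => sub s (a i)) =
        sub (algebraMap A A' s) ∘ (fun i => (a i).map (algebraMap A A')) := by
      funext i; exact sub_map _ _ _
    rw [e1, ← RingHom.map_mulVec, hH]
    exact (sub_map _ _ _).symm
  have k3c : ∀ i, c0 (G.mulVec (fun i => sub s (a i)) i) = c0 (sub s (b i)) := by
    intro i
    rw [RingHom.map_mulVec, cG, Matrix.one_mulVec]
    have := hab i
    simp only [Function.comp, c0, constantCoeff_apply, sub_coeff, pow_zero, mul_one, this]
  obtain ⟨t, ht, hkill⟩ := exists_kill (A' := A') S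
    (Sum.elim (fun k : ι × ι => (G * G' - 1) k.1 k.2) (Sum.elim
      (fun k : ι × ι => (G' * G - 1) k.1 k.2)
      (fun i => G.mulVec (fun i => sub s (a i)) i - sub s (b i)))) (by
      rintro (⟨i, j⟩ | ⟨i, j⟩ | i)
      · have := congrFun (congrFun k1c i) j
        have h1 := congrFun (congrFun (mone c0) i) j
        change c0 ((G * G') i j - (1 : Matrix ι ι A[X]) i j) = 0
        rw [map_sub, sub_eq_zero]; exact this.trans h1.symm
      · have := congrFun (congrFun k2c i) j
        have h1 := congrFun (congrFun (mone c0) i) j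
        change c0 ((G' * G) i j - (1 : Matrix ι ι A[X]) i j) = 0
        rw [map_sub, sub_eq_zero]; exact this.trans h1.symm
      · change c0 (G.mulVec (fun i => sub s (a i)) i - sub s (b i)) = 0
        rw [map_sub, k3c, sub_self]) (by
      rintro (⟨i, j⟩ | ⟨i, j⟩ | i)
      · have := congrFun (congrFun k1 i) j
        have h1 := congrFun (congrFun (Matrix.map_one φ (map_zero φ) (map_one φ)) i) j
        change φ ((G * G') i j - (1 : Matrix ι ι A[X]) i j) = 0
        rw [map_sub, sub_eq_zero]; exact this.trans h1.symm
      · have := congrFun (congrFun k2 i) j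
        have h1 := congrFun (congrFun (Matrix.map_one φ (map_zero φ) (map_one φ)) i) j
        change φ ((G' * G) i j - (1 : Matrix ι ι A[X]) i j) = 0
        rw [map_sub, sub_eq_zero]; exact this.trans h1.symm
      · change φ (G.mulVec (fun i => sub s (a i)) i - sub s (b i)) = 0
        rw [map_sub, k3, sub_self])
  refine ⟨s * t, S.mul_mem hs ht, G.map (sub t), G'.map (sub t), ?_, ?_, ?_⟩
  · rw [← Matrix.map_mul]
    ext1 i j
    have h1 := hkill (Sum.inl (i, j))
    have h2 := congrFun (congrFun (mone (sub t)) i) j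
    simp only [Sum.elim_inl, Matrix.sub_apply, map_sub, sub_eq_zero] at h1
    exact h1.trans h2
  · rw [← Matrix.map_mul]
    ext1 i j
    have h1 := hkill (Sum.inr (Sum.inl (i, j)))
    have h2 := congrFun (congrFun (mone (sub t)) i) j
    simp only [Sum.elim_inl, Sum.elim_inr, Matrix.sub_apply, map_sub, sub_eq_zero] at h1
    exact h1.trans h2
  · ext1 i
    have h1 := hkill (Sum.inr (Sum.inr i))
    simp only [Sum.elim_inr, map_sub, sub_eq_zero] at h1
    rw [sub_sub, RingHom.map_mulVec] at h1
    rw [← h1]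
    congr 1
    funext i
    simp [sub_sub]

/-- The translation `f(X) ↦ f(X + sY)`. -/
noncomputable def tr {B : Type*} [CommRing B] (s : B) : B[X] →+* B[X][X] :=
  eval₂RingHom (C.comp C) (C X + C (C s) * X)

lemma tr_zero {B : Type*} [CommRing B] : tr (0 : B) = C := by
  apply Polynomial.ringHom_ext <;> simp [tr]

attribute [local instance] Polynomial.algebra Polynomial.isLocalization in
lemma patch_local {B : Type*} [CommRing B] (v : ι → B[X]) (m : Ideal B) [m.IsPrime]
    (B' : Type*) [CommRing B'] [Algebra B B'] [IsLocalization.AtPrime B' m]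
    (h : Rel (fun i => (v i).map (algebraMap B B'))
      (fun i => C (algebraMap B B' ((v i).coeff 0)))) :
    ∃ s ∉ m, Rel (fun i => C (v i)) (fun i => tr s (v i)) := by
  obtain ⟨G, G', h1, h2, h3⟩ := h
  let τ : B'[X] →+* B'[X][X] := tr 1
  have alg : algebraMap B[X] B'[X] = mapRingHom (algebraMap B B') := rfl
  have hcτ : (constantCoeff : B'[X][X] →+* B'[X]).comp τ = RingHom.id _ := by
    apply Polynomial.ringHom_ext <;> simp [τ, tr]
  have hcτ' : (constantCoeff : B[X][X] →+* B[X]).comp (tr 1) = RingHom.id _ := by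
    apply Polynomial.ringHom_ext <;> simp [tr]
  have hτφ : ∀ f : B[X], (tr 1 f).map (algebraMap B[X] B'[X]) = τ (f.map (algebraMap B B')) := by
    intro f
    have : (mapRingHom (algebraMap B[X] B'[X])).comp (tr 1) =
        τ.comp (mapRingHom (algebraMap B B')) := by
      apply Polynomial.ringHom_ext <;> simp [tr, alg, τ]
    exact RingHom.congr_fun this f
  have mapc : ∀ Z : Matrix ι ι B'[X], (Z.map τ).map (constantCoeff : B'[X][X] →+* B'[X]) = Z := by
    intro Z
    ext1 i j
    exact RingHom.congr_fun hcτ (Z i j)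
  have mapc' : ∀ Z : Matrix ι ι B'[X],
      (Z.map (C : B'[X] →+* B'[X][X])).map (constantCoeff : B'[X][X] →+* B'[X]) = Z := by
    intro Z
    ext1 i j
    simp
  obtain ⟨s', hs', hrel⟩ := patch1 (A' := B'[X]) (m.primeCompl.map (C : B →+* B[X]))
    (fun i => C (v i)) (fun i => tr 1 (v i))
    (fun i => by
      have := RingHom.congr_fun hcτ' (v i)
      simpa using this.symm)
    (G'.map τ * G.map (C : B'[X] →+* B'[X][X])) (G'.map (C : B'[X] →+* B'[X][X]) * G.map τ)
    (by
      rw [Matrix.mul_assoc, ← Matrix.mul_assoc (G.map _), ← Matrix.map_mul, h1, mone, one_mul,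
        ← Matrix.map_mul, h2, mone])
    (by
      rw [Matrix.mul_assoc, ← Matrix.mul_assoc (G.map _), ← Matrix.map_mul, h1, mone, one_mul,
        ← Matrix.map_mul, h2, mone])
    (by
      change (_ : Matrix ι ι B'[X][X]).map (constantCoeff : B'[X][X] →+* B'[X]) = 1
      rw [Matrix.map_mul, mapc, mapc', h2])
    (by
      change (_ : Matrix ι ι B'[X][X]).map (constantCoeff : B'[X][X] →+* B'[X]) = 1
      rw [Matrix.map_mul, mapc, mapc', h2])
    (by
      have e1 : (fun i => (C (v i)).map (algebraMap B[X] B'[X])) =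
          (C : B'[X] →+* B'[X][X]) ∘ (fun i => (v i).map (algebraMap B B')) := by
        funext i; simp [alg]
      have e2 : (C : B'[X] →+* B'[X][X]) ∘ (fun i => C (algebraMap B B' ((v i).coeff 0))) =
          τ ∘ (fun i => C (algebraMap B B' ((v i).coeff 0))) := by
        funext i; simp [τ, tr]
      have e3 : (G.map (C : B'[X] →+* B'[X][X])).mulVec
          ((C : B'[X] →+* B'[X][X]) ∘ (fun i => (v i).map (algebraMap B B'))) =
          (C : B'[X] →+* B'[X][X]) ∘ (fun i => C (algebraMap B B' ((v i).coeff 0))) := by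
        funext i
        rw [← RingHom.map_mulVec, h3]; rfl
      have e4 : G'.mulVec (fun i => C (algebraMap B B' ((v i).coeff 0))) =
          fun i => (v i).map (algebraMap B B') := by
        rw [← h3, Matrix.mulVec_mulVec, h2, Matrix.one_mulVec]
      rw [e1, ← Matrix.mulVec_mulVec, e3, e2]
      funext i
      rw [← RingHom.map_mulVec, e4, hτφ])
  obtain ⟨s, hs, rfl⟩ := hs'
  refine ⟨s, hs, ?_⟩
  have f1 : (sub (C s)).comp (C : B[X] →+* B[X][X]) = C := by
    apply Polynomial.ringHom_ext <;> simp [sub]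
  have f2 : (sub (C s)).comp (tr (1 : B)) = tr s := by
    apply Polynomial.ringHom_ext <;> simp [sub, tr]
  convert hrel using 2 with i i
  · exact (RingHom.congr_fun f1 (v i)).symm
  · exact (RingHom.congr_fun f2 (v i)).symm

theorem quillen {B : Type*} [CommRing B] (v : ι → B[X])
    (h : ∀ (m : Ideal B) [m.IsMaximal],
      Rel (fun i => (v i).map (algebraMap B (Localization.AtPrime m)))
      (fun i => C (algebraMap B (Localization.AtPrime m) ((v i).coeff 0)))) :
    Rel v (fun i => C ((v i).coeff 0)) := by
  let I : Ideal B :=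
    { carrier := {s | Rel (fun i => C (v i)) (fun i => tr s (v i))}
      zero_mem' := by
        change Rel _ _
        rw [tr_zero]
        exact Rel.refl _
      add_mem' := by
        intro s s' hs hs'
        have h1 := Rel.map hs (eval₂RingHom (tr s') X)
        have f1 : (eval₂RingHom (tr s') X).comp (C : B[X] →+* B[X][X]) = tr s' := by
          apply Polynomial.ringHom_ext <;> simp
        have f2 : (eval₂RingHom (tr s') X).comp (tr s) = tr (s + s') := by
          apply Polynomial.ringHom_ext
          · simp [tr]
          · simp [tr]; ring
        refine Rel.trans hs' ?_
        convert h1 using 2 with i i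
        · exact (RingHom.congr_fun f1 (v i)).symm
        · exact (RingHom.congr_fun f2 (v i)).symm
      smul_mem' := by
        intro r s hs
        have h1 := Rel.map hs (sub (C r))
        have f1 : (sub (C r)).comp (C : B[X] →+* B[X][X]) = C := by
          apply Polynomial.ringHom_ext <;> simp [sub]
        have f2 : (sub (C r)).comp (tr s) = tr (r • s) := by
          apply Polynomial.ringHom_ext
          · simp [tr, sub]
          · simp [tr, sub]; ring
        change Rel _ _
        convert h1 using 2 with i i
        · exact (RingHom.congr_fun f1 (v i)).symm
        · exact (RingHom.congr_fun f2 (v i)).symm }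
  have hI : I = ⊤ := by
    by_contra hne
    obtain ⟨m, hm, hle⟩ := Ideal.exists_le_maximal _ hne
    obtain ⟨s, hs, hrel⟩ := patch_local v m (Localization.AtPrime m) (h m)
    exact hs (hle hrel)
  have h1 : Rel (fun i => C (v i)) (fun i => tr (1 : B) (v i)) :=
    show (1 : B) ∈ I from hI ▸ Submodule.mem_top
  have h2 := Rel.map h1 (eval₂RingHom ((C : B →+* B[X]).comp constantCoeff) X)
  have f2 : (eval₂RingHom ((C : B →+* B[X]).comp constantCoeff) X).comp (tr (1 : B)) =
      RingHom.id _ := by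
    apply Polynomial.ringHom_ext <;> simp [tr]
  refine Rel.symm ?_
  convert h2 using 2 with i i
  · simp
  · exact (RingHom.congr_fun f2 (v i)).symm

end
end SF12

namespace SF12
open Polynomial

/-- Dimension hypothesis used in the induction. -/
def Hyp (d n : ℕ) (R : Type*) [CommRing R] : Prop :=
  ∀ k ≤ n, ∀ p : PrimeSpectrum (MvPolynomial (Fin k) R),
    (∀ i, MvPolynomial.X i ∈ p.asIdeal) → Order.height p ≤ ((d + k : ℕ) : ℕ∞)

lemma Hyp.dim {d n : ℕ} {R : Type*} [CommRing R] (h : Hyp d n R) : ringKrullDim R ≤ d := by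
  rw [← ringKrullDim_mvPolynomial_of_isEmpty (R := R) (Fin 0)]
  rw [ringKrullDim, Order.krullDim_eq_iSup_height]
  refine iSup_le fun p => ?_
  have := h 0 (Nat.zero_le _) p (fun i => i.elim0)
  exact_mod_cast this

lemma Hyp.mono {d n : ℕ} {R : Type*} [CommRing R] (h : Hyp d (n + 1) R) : Hyp d n R :=
  fun k hk => h k (by omega)

lemma dim_add (R : Type*) [CommRing R] (k j : ℕ) :
    ringKrullDim (MvPolynomial (Fin k) R) + j ≤ ringKrullDim (MvPolynomial (Fin (k + j)) R) := by
  induction j with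
  | zero => simp
  | succ j ih =>
    have h1 : ringKrullDim (MvPolynomial (Fin (k + (j + 1))) R) =
        ringKrullDim (Polynomial (MvPolynomial (Fin (k + j)) R)) :=
      ringKrullDim_eq_of_ringEquiv (MvPolynomial.finSuccEquiv R (k + j)).toRingEquiv
    rw [h1]
    refine le_trans ?_ (ringKrullDim_succ_le_ringKrullDim_polynomial)
    push_cast
    rw [← add_assoc]
    gcongr

lemma hyp_of_dim (R : Type*) [CommRing R] (d n : ℕ)
    (hdimA : ringKrullDim (MvPolynomial (Fin n) R) = (d + n : ℕ)) : Hyp d n R := by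
  intro k hk p _
  obtain ⟨j, rfl⟩ := Nat.exists_eq_add_of_le hk
  have h1 := dim_add R k j
  rw [hdimA] at h1
  have h2 : (Order.height p : WithBot ℕ∞) ≤ ringKrullDim (MvPolynomial (Fin k) R) :=
    Order.height_le_krullDim p
  have h3 : (Order.height p : WithBot ℕ∞) + j ≤ (d + (k + j) : ℕ) := le_trans (by gcongr) h1
  have h4 : Order.height p + j ≤ ((d + (k + j) : ℕ) : ℕ∞) := by exact_mod_cast h3
  have h5 : Order.height p + j ≤ ((d + k : ℕ) : ℕ∞) + j := by
    refine h4.trans (le_of_eq ?_); push_cast; ring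
  exact (ENat.add_le_add_iff_right (ENat.natCast_ne_top j)).1 h5

/-- The multiplicative set of polynomials `t^k (1 + t g)`. -/
def TM (R : Type*) [CommRing R] : Submonoid R[X] where
  carrier := {f | ∃ (k : ℕ) (g : R[X]), f = X ^ k * (1 + X * g)}
  one_mem' := ⟨0, 0, by simp⟩
  mul_mem' := by
    rintro _ _ ⟨k, g, rfl⟩ ⟨l, h, rfl⟩
    exact ⟨k + l, g + h + X * g * h, by ring⟩

/-- The ring `R⟨t⁻¹⟩`. -/
abbrev Rt (R : Type*) [CommRing R] := Localization (TM R)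

lemma sub_constantCoeff_mem {σ A : Type*} [CommRing A] (Q : Ideal (MvPolynomial σ A))
    (hQ : ∀ i, MvPolynomial.X i ∈ Q) (f : MvPolynomial σ A) :
    f - MvPolynomial.C (MvPolynomial.constantCoeff f) ∈ Q := by
  induction f using MvPolynomial.induction_on with
  | C a => simp
  | add p q hp hq =>
    have := Q.add_mem hp hq
    rw [map_add, map_add]
    convert this using 1; ring
  | mul_X p i hp =>
    simp only [map_mul, MvPolynomial.constantCoeff_X, mul_zero, map_zero, sub_zero]
    exact Q.mul_mem_left _ (hQ i)

attribute [local instance] MvPolynomial.algebraMvPolynomial in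
lemma Hyp.step {d n : ℕ} {R : Type*} [CommRing R] (h : Hyp d (n + 1) R) : Hyp d n (Rt R) := by
  intro k hk p hp
  let e : MvPolynomial (Fin (k + 1)) R ≃ₐ[R] MvPolynomial (Fin k) R[X] :=
    (MvPolynomial.renameEquiv R (finSuccEquiv k)).trans (MvPolynomial.optionEquivRight R (Fin k))
  have e0 : e (MvPolynomial.X 0) = MvPolynomial.C X := by
    simp [e]
  have es : ∀ i : Fin k, e (MvPolynomial.X i.succ) = MvPolynomial.X i := by
    intro i; simp [e]
  let f := algebraMap (MvPolynomial (Fin k) R[X]) (MvPolynomial (Fin k) (Rt R))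
  have hf : f = MvPolynomial.map (algebraMap R[X] (Rt R)) := rfl
  let Q := PrimeSpectrum.comap f p
  have hmono : StrictMono (PrimeSpectrum.comap f) :=
    Monotone.strictMono_of_injective (fun a b hab => Ideal.comap_mono hab)
      (PrimeSpectrum.localization_comap_injective (MvPolynomial (Fin k) (Rt R))
        ((TM R).map (MvPolynomial.C (σ := Fin k))))
  have hQX : ∀ i, MvPolynomial.X i ∈ Q.asIdeal := by
    intro i
    change f _ ∈ p.asIdeal
    rw [hf, MvPolynomial.map_X]; exact hp i
  have hQM : ∀ m ∈ TM R, MvPolynomial.C m ∉ Q.asIdeal := by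
    intro m hm hmem
    change f _ ∈ p.asIdeal at hmem
    rw [hf, MvPolynomial.map_C] at hmem
    exact p.2.ne_top (Ideal.eq_top_of_isUnit_mem _ hmem
      ((IsLocalization.map_units (Rt R) (⟨m, hm⟩ : TM R)).map MvPolynomial.C))
  have hne : Q.asIdeal ⊔ Ideal.span {MvPolynomial.C X} ≠ ⊤ := by
    intro htop
    have h1 : (1 : MvPolynomial (Fin k) R[X]) ∈ Q.asIdeal ⊔ Ideal.span {MvPolynomial.C X} :=
      htop ▸ Submodule.mem_top
    obtain ⟨q, hq, y, hy, hqy⟩ := Submodule.mem_sup.1 h1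
    obtain ⟨g, rfl⟩ := Ideal.mem_span_singleton.1 hy
    have h2 := Q.asIdeal.sub_mem hq (sub_constantCoeff_mem _ hQX q)
    rw [sub_sub_cancel] at h2
    refine hQM _ ⟨0, -(MvPolynomial.constantCoeff g), ?_⟩ h2
    have h3 := congrArg MvPolynomial.constantCoeff hqy
    simp only [map_add, map_mul, MvPolynomial.constantCoeff_C, map_one] at h3
    rw [← h3]; ring
  obtain ⟨m, hm, hle⟩ := Ideal.exists_le_maximal _ hne
  let Q' : PrimeSpectrum (MvPolynomial (Fin k) R[X]) := ⟨m, hm.isPrime⟩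
  have hXm : MvPolynomial.C X ∈ m :=
    hle (Ideal.mem_sup_right (Ideal.mem_span_singleton_self _))
  have hlt : Q < Q' := by
    refine lt_of_le_of_ne (fun x hx => hle (Ideal.mem_sup_left hx)) ?_
    intro heq
    refine hQM X ⟨1, 0, by simp⟩ ?_
    rw [heq]; exact hXm
  have hh1 : Order.height p ≤ Order.height Q :=
    Order.height_le_height_apply_of_strictMono _ hmono p
  have hh2 : Order.height Q + 1 ≤ Order.height Q' := Order.height_add_one_le hlt
  have hh3 : Order.height Q' ≤ ((d + (k + 1) : ℕ) : ℕ∞) := by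
    rw [← Order.height_orderIso (PrimeSpectrum.comapEquiv e.symm.toRingEquiv) Q']
    refine h (k + 1) (by omega) _ ?_
    intro i
    change e (MvPolynomial.X i) ∈ m
    refine Fin.cases ?_ (fun i => ?_) i
    · rw [e0]; exact hXm
    · rw [es]; exact hle (Ideal.mem_sup_left (hQX i))
  have hh : Order.height p + 1 ≤ ((d + k : ℕ) : ℕ∞) + 1 := by
    calc Order.height p + 1 ≤ Order.height Q + 1 := by gcongr
      _ ≤ _ := hh2.trans hh3
      _ = _ := by push_cast; ring
  exact (ENat.add_le_add_iff_right (by simp)).1 hh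

end SF12

namespace SF12
open Polynomial

/-- The multiplicative set of monic polynomials. -/
def MS (B : Type*) [CommRing B] : Submonoid B[X] where
  carrier := {f | f.Monic}
  one_mem' := monic_one
  mul_mem' := fun ha hb => Monic.mul ha hb

lemma monic_col {B K : Type*} [CommRing B] [CommRing K] [Algebra B[X] K] [IsLocalization (MS B) K]
    {M : ℕ} (v : Fin (M + 1) → B[X])
    (h : Rel (fun i => algebraMap B[X] K (v i)) (Pi.single 0 1)) :
    ∃ (W : Matrix (Fin (M + 1)) (Fin (M + 1)) B[X]) (D : B[X]),
      (∀ i, W i 0 = v i) ∧ (D * W.det).Monic := by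
  obtain ⟨G, H, h1, h2, h3⟩ := h
  have h4 : ∀ i, H i 0 = algebraMap B[X] K (v i) := by
    intro i
    have : H.mulVec (Pi.single 0 1) = fun i => algebraMap B[X] K (v i) := by
      rw [← h3, Matrix.mulVec_mulVec, h2, Matrix.one_mulVec]
    have := congrFun this i
    rw [← this, Matrix.mulVec_single_one]; rfl
  obtain ⟨b, hb⟩ := IsLocalization.exist_integer_multiples_of_finite (MS B)
    (fun k : Fin (M + 1) × Fin (M + 1) => H k.1 k.2)
  have hb' : ∀ i j, ∃ g : B[X], algebraMap B[X] K g = algebraMap B[X] K b * H i j := by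
    intro i j
    obtain ⟨g, hg⟩ := hb (i, j)
    exact ⟨g, by rw [hg, Algebra.smul_def]⟩
  choose g hg using hb'
  let W : Matrix (Fin (M + 1)) (Fin (M + 1)) B[X] :=
    Matrix.of fun i j => if j = 0 then v i else g i j
  have hW : W.map (algebraMap B[X] K) = H * Matrix.diagonal
      (fun j => if j = 0 then 1 else algebraMap B[X] K b) := by
    ext i j
    rw [Matrix.mul_diagonal, Matrix.map_apply]
    change algebraMap B[X] K (if j = 0 then v i else g i j) = _
    split_ifs with hj
    · rw [hj, h4, mul_one]
    · rw [hg, mul_comm]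
  have hdet : IsUnit (algebraMap B[X] K W.det) := by
    rw [RingHom.map_det, RingHom.mapMatrix_apply, hW, Matrix.det_mul, Matrix.det_diagonal]
    refine IsUnit.mul ?_ ?_
    · refine IsUnit.of_mul_eq_one G.det ?_
      rw [← Matrix.det_mul, h2, Matrix.det_one]
    · rw [IsUnit.prod_univ_iff]
      intro j
      split_ifs
      · exact isUnit_one
      · exact IsLocalization.map_units K b
  obtain ⟨y, hy⟩ := hdet.exists_right_inv
  obtain ⟨⟨a, s⟩, hs⟩ := IsLocalization.surj (MS B) y
  have h5 : algebraMap B[X] K (W.det * a) = algebraMap B[X] K s := by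
    rw [map_mul, ← hs, ← mul_assoc, hy, one_mul]
  obtain ⟨c, hc⟩ := (IsLocalization.eq_iff_exists (MS B) K).1 h5
  refine ⟨W, c * a, fun i => ?_, ?_⟩
  · simp [W]
  · have : (c : B[X]) * a * W.det = c * s := by rw [← hc]; ring
    rw [this]
    exact (c * s).2

lemma exists_psi {R K : Type*} [CommRing R] [CommRing K] (n : ℕ)
    (η : (MvPolynomial (Fin n) R)[X] →+* K)
    (hη : ∀ f : R[X], f.Monic → IsUnit (η (f.map MvPolynomial.C))) :
    ∃ (θ : (MvPolynomial (Fin n) R)[X] →+* MvPolynomial (Fin n) (Rt R))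
      (ψ : MvPolynomial (Fin n) (Rt R) →+* K), ψ.comp θ = η := by
  have hx : IsUnit (η X) := by simpa using hη X monic_X
  obtain ⟨y, hy⟩ := hx.exists_right_inv
  have hXt : IsUnit (algebraMap R[X] (Rt R) X) :=
    IsLocalization.map_units (Rt R) (⟨X, 1, 0, by simp⟩ : TM R)
  obtain ⟨u, hu⟩ := hXt.exists_right_inv
  let i0 : R →+* K := (η.comp C).comp MvPolynomial.C
  let ρ : R[X] →+* K := eval₂RingHom i0 y
  have hη' : ∀ f : R[X], η (f.map MvPolynomial.C) = eval₂ i0 (η X) f := by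
    intro f
    have : η.comp (mapRingHom MvPolynomial.C) = eval₂RingHom i0 (η X) := by
      apply Polynomial.ringHom_ext <;> simp [i0]
    exact RingHom.congr_fun this f
  have hρ : ∀ m : TM R, IsUnit (ρ m) := by
    rintro ⟨_, k, g, rfl⟩
    have hyu : IsUnit y := IsUnit.of_mul_eq_one _ ((mul_comm _ _).trans hy)
    simp only [map_mul, map_pow]
    refine IsUnit.mul (IsUnit.pow _ ?_) ?_
    · simpa [ρ] using hyu
    · let _ : Invertible y := ⟨η X, hy, (mul_comm _ _).trans hy⟩
      have h1 := eval₂_reverse_mul_pow i0 y (1 + X * g)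
      change IsUnit (eval₂ i0 y (1 + X * g))
      rw [← h1]
      refine IsUnit.mul ?_ (hyu.pow _)
      change IsUnit (eval₂ i0 (η X) _)
      rw [← hη']
      apply hη
      nontriviality R
      rw [Monic, reverse_leadingCoeff, trailingCoeff]
      have h0 : (1 + X * g).coeff 0 = 1 := by simp
      rw [natTrailingDegree_eq_zero_of_constantCoeff_ne_zero (by simp), h0]
  refine ⟨eval₂RingHom (MvPolynomial.map ((algebraMap R[X] (Rt R)).comp C)) (MvPolynomial.C u),
    MvPolynomial.eval₂Hom (IsLocalization.lift hρ) (fun i => η (C (MvPolynomial.X i))), ?_⟩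
  apply Polynomial.ringHom_ext'
  · apply MvPolynomial.ringHom_ext
    · intro r
      simp [ρ, i0]
    · intro i
      simp
  · simp only [RingHom.comp_apply, coe_eval₂RingHom, eval₂_X, MvPolynomial.coe_eval₂Hom,
      MvPolynomial.eval₂_C]
    have h1 := congrArg (IsLocalization.lift hρ : Rt R →+* K) hu
    rw [map_mul, IsLocalization.lift_eq, map_one] at h1
    have h2 : ρ X = y := by simp [ρ]
    rw [h2] at h1
    calc _ = (η X * y) * (IsLocalization.lift hρ : Rt R →+* K) u := by rw [hy, one_mul]
      _ = η X * (y * (IsLocalization.lift hρ : Rt R →+* K) u) := by ring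
      _ = η X := by rw [h1, mul_one]

lemma map_e0 {A B : Type*} [CommRing A] [CommRing B] (f : A →+* B) (M : ℕ) :
    (fun i => f ((Pi.single 0 1 : Fin (M + 1) → A) i)) = Pi.single 0 1 := by
  funext i
  refine Fin.cases ?_ (fun i => ?_) i <;> simp

lemma rel_of_equiv {A B : Type*} [CommRing A] [CommRing B] (e : A ≃+* B) {M : ℕ}
    (v : Fin (M + 1) → A) (h : Rel (fun i => e (v i)) (Pi.single 0 1)) :
    Rel v (Pi.single 0 1) := by
  have h1 := Rel.map h (e.symm : B →+* A)
  rw [map_e0] at h1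
  simpa using h1

lemma um_equiv {A B : Type*} [CommRing A] [CommRing B] (e : A ≃+* B) {M : ℕ}
    (v : Fin (M + 1) → A) (h : Um v) : Um (fun i => e (v i)) :=
  h.map (e : A →+* B)

lemma rel_const {B : Type*} [CommRing B] {M : ℕ} (v : Fin (M + 1) → B[X])
    (h : Rel v (Pi.single 0 1)) : Rel v (fun i => C ((v i).coeff 0)) := by
  have h5 := h.map ((C : B →+* B[X]).comp constantCoeff)
  rw [map_e0] at h5
  exact h.trans h5.symm

universe u

theorem main (d n : ℕ) : ∀ (R : Type u) [CommRing R], Hyp d n R → ∀ M, d + 1 ≤ M →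
    ∀ v : Fin (M + 1) → MvPolynomial (Fin n) R, Um v → Rel v (Pi.single 0 1) := by
  induction n with
  | zero =>
    intro R _ h M hM v hv
    refine rel_of_equiv (MvPolynomial.isEmptyRingEquiv R (Fin 0)) v ?_
    refine bass ?_ _ (hv.map (MvPolynomial.isEmptyRingEquiv R (Fin 0) : _ →+* R))
    refine lt_of_le_of_lt h.dim ?_
    exact_mod_cast hM
  | succ n ih =>
    intro R _ h M hM v hv
    let e := (MvPolynomial.finSuccEquiv R n).toRingEquiv
    refine rel_of_equiv e v ?_
    replace hv : Um (fun i => e (v i)) := um_equiv e v hv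
    generalize (fun i => e (v i)) = w at hv
    have hq : Rel w (fun i => C ((w i).coeff 0)) := by
      refine quillen w ?_
      intro m _
      let B' := Localization.AtPrime m
      let φ : (MvPolynomial (Fin n) R)[X] →+* B'[X] :=
        mapRingHom (algebraMap (MvPolynomial (Fin n) R) B')
      let K := Localization (MS B')
      obtain ⟨θ, ψ, hψ⟩ := exists_psi n ((algebraMap B'[X] K).comp φ) (by
        intro f hf
        have hm : (φ (f.map MvPolynomial.C)).Monic := (hf.map _).map _
        exact IsLocalization.map_units K (⟨_, hm⟩ : MS B'))
      have h1 := ih (Rt R) h.step M hM _ (hv.map θ)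
      have h2 := h1.map ψ
      rw [map_e0] at h2
      have h3 : (fun i => ψ (θ (w i))) = fun i => algebraMap B'[X] K (φ (w i)) := by
        funext i
        exact RingHom.congr_fun hψ (w i)
      rw [h3] at h2
      obtain ⟨W, D, hW, hD⟩ := monic_col _ h2
      have h4 := horrocks (by omega) _ (hv.map φ) W hW D hD
      have h6 := rel_const _ h4
      have h9 : (fun i => C ((φ (w i)).coeff 0)) =
          fun i => C (algebraMap (MvPolynomial (Fin n) R) B' ((w i).coeff 0)) := by
        funext i
        congr 1
        exact coeff_map _ _
      rw [h9] at h6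
      exact h6
    refine hq.trans ?_
    have h7 := ih R h.mono M hM _ (hv.map constantCoeff)
    have h8 := h7.map (C : MvPolynomial (Fin n) R →+* _)
    rw [map_e0] at h8
    exact h8

end SF12

namespace SF12

lemma mod_one {A P : Type*} [CommRing A] [AddCommGroup P] [Module A P] (r : ℕ)
    (hA : ∀ v : Fin (r + 1) → A, Um v → Rel v (Pi.single 0 1))
    (e : (P × A) ≃ₗ[A] (Fin (r + 1) → A)) : Nonempty (P ≃ₗ[A] (Fin r → A)) := by
  let v := e (0, 1)
  have hv : Um v := by
    let f : (Fin (r + 1) → A) →ₗ[A] A := LinearMap.snd A P A ∘ₗ e.symm.toLinearMap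
    refine ⟨fun i => f (Pi.single i 1), ?_⟩
    have h1 : f v = 1 := by simp [f, v]
    refine Eq.trans ?_ h1
    rw [LinearMap.pi_apply_eq_sum_univ f v, dotProduct]
    refine Finset.sum_congr rfl fun i _ => ?_
    rw [smul_eq_mul, mul_comm]
    congr 2
    funext j
    simp [Pi.single_apply, eq_comm]
  obtain ⟨G, H, h1, h2, h3⟩ := hA v hv
  let g : (Fin (r + 1) → A) ≃ₗ[A] (Fin (r + 1) → A) :=
    LinearEquiv.ofLinearMap G.mulVecLin H.mulVecLin
      (by rw [← Matrix.mulVecLin_mul, h1, Matrix.mulVecLin_one])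
      (by rw [← Matrix.mulVecLin_mul, h2, Matrix.mulVecLin_one])
  let E := e.trans g
  have hE : E (0, 1) = Pi.single 0 1 := h3
  have hE' : ∀ a, E (0, a) = Pi.single 0 a := by
    intro a
    have : ((0 : P), a) = a • ((0 : P), (1 : A)) := by simp
    rw [this, map_smul, hE, ← Pi.single_smul]; simp
  -- the restriction
  let F : P →ₗ[A] (Fin r → A) :=
    LinearMap.funLeft A A Fin.succ ∘ₗ E.toLinearMap ∘ₗ LinearMap.inl A P A
  refine ⟨LinearEquiv.ofBijective F ⟨?_, ?_⟩⟩
  · rw [← LinearMap.ker_eq_bot, LinearMap.ker_eq_bot']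
    intro p hp
    have h4 : E (p, 0) = E (0, E (p, 0) 0) := by
      rw [hE']
      funext i
      refine Fin.cases ?_ (fun i => ?_) i
      · simp
      · have := congrFun hp i
        simpa [F] using this
    exact congrArg Prod.fst (E.injective h4)
  · intro w
    let q := E.symm (Fin.cons 0 w)
    refine ⟨q.1, ?_⟩
    have h4 : E (q.1, 0) = Fin.cons 0 w - Pi.single 0 q.2 := by
      rw [← hE', eq_sub_iff_add_eq, ← map_add]
      simp [q]
    funext i
    change E (q.1, 0) i.succ = w i
    rw [h4]
    simp

lemma mod_all {A : Type*} [CommRing A] (d : ℕ)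
    (hA : ∀ M, d + 1 ≤ M → ∀ v : Fin (M + 1) → A, Um v → Rel v (Pi.single 0 1))
    (s : ℕ) : ∀ {P : Type*} [AddCommGroup P] [Module A P] (r : ℕ), d + 1 ≤ r →
    ((P × (Fin s → A)) ≃ₗ[A] (Fin (r + s) → A)) → Nonempty (P ≃ₗ[A] (Fin r → A)) := by
  induction s with
  | zero =>
    intro P _ _ r _ e
    exact ⟨(LinearEquiv.prodUnique (R := A) (M := P) (M₂ := Fin 0 → A)).symm.trans e⟩
  | succ s ih =>
    intro P _ _ r hr e
    let c : (A × (Fin s → A)) ≃ₗ[A] (Fin (s + 1) → A) := Fin.consLinearEquiv A (fun _ => A)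
    let e1 : ((P × (Fin s → A)) × A) ≃ₗ[A] (P × (Fin (s + 1) → A)) :=
      (LinearEquiv.prodAssoc A P (Fin s → A) A).trans
        ((LinearEquiv.refl A P).prodCongr ((LinearEquiv.prodComm A _ _).trans c))
    obtain ⟨e2⟩ := mod_one (r + s) (hA _ (by omega)) (e1.trans e)
    exact ih r hr e2

end SF12

/-- Let `R` be a commutative ring of finite Krull dimension `d` such that
the polynomial ring `A = R[Y₁,…,Yₙ]` has Krull dimension `d + n`. Then every finitely
generated stably free `A`-module of rank `r ≥ d + 1` is free. -/
theorem statement_12 (R : Type*) [CommRing R] (d n : ℕ)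
    (hdim : ringKrullDim R = d)
    (hdimA : ringKrullDim (MvPolynomial (Fin n) R) = (d + n : ℕ))
    (P : Type*) [AddCommGroup P] [Module (MvPolynomial (Fin n) R) P]
    [Module.Finite (MvPolynomial (Fin n) R) P]
    (r s : ℕ) (hr : d + 1 ≤ r)
    (hstab : Nonempty ((P × (Fin s → MvPolynomial (Fin n) R)) ≃ₗ[MvPolynomial (Fin n) R]
      (Fin (r + s) → MvPolynomial (Fin n) R))) :
    Nonempty (P ≃ₗ[MvPolynomial (Fin n) R] (Fin r → MvPolynomial (Fin n) R)) := by
  obtain ⟨e⟩ := hstab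
  exact SF12.mod_all d (SF12.main d n R (SF12.hyp_of_dim R d n hdimA)) s r hr e
end

section
/- Let R be a commutative ring of finite Krull dimension d such that the Krull dimension of the polynomial ring R[Y_1,…,Y_n] equals d + n. Let A = R[Y_1,…,Y_n][(f_1⋯f_m)^{-1}], where m ≤ n and each f_i ∈ R[Y_i] is a monic polynomial in Y_i. Then every finitely generated stably free A-module of rank r ≥ d+1 is free. -/
open Polynomial


/-- The ring `R[Y₁,…,Yₙ][(f₁⋯f_m)⁻¹]`: the localization of the polynomial ring
`R[Y₁,…,Yₙ]` away from the product `f₁⋯f_m`, where each `fᵢ ∈ R[Yᵢ]`. -/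
abbrev LocalizedPolynomialRing (R : Type*) [CommRing R] (n m : ℕ) (hmn : m ≤ n)
    (f : Fin m → Polynomial R) : Type _ :=
  Localization.Away
    (∏ i : Fin m, Polynomial.aeval (MvPolynomial.X (Fin.castLE hmn i)) (f i) :
      MvPolynomial (Fin n) R)


/-- Unimodular rows. -/
def UMod {A : Type*} [CommRing A] {N : ℕ} (v : Fin N → A) : Prop := ∃ w : Fin N → A, v ⬝ᵥ w = 1

/-- Two rows are isotopic if they are related by an invertible matrix that is
homotopic to the identity through invertible matrices. -/
def Isot {A : Type*} [CommRing A] {N : ℕ} (v w : Fin N → A) : Prop :=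
  ∃ G G' : Matrix (Fin N) (Fin N) A[X], G * G' = 1 ∧ (evalRingHom 0).mapMatrix G = 1 ∧
    Matrix.vecMul v ((evalRingHom 1).mapMatrix G) = w

section basics
variable {A B : Type*} [CommRing A] [CommRing B] {N : ℕ}

theorem map_vecMul' (φ : A →+* B) (v : Fin N → A) (G : Matrix (Fin N) (Fin N) A) :
    (φ ∘ Matrix.vecMul v G) = Matrix.vecMul (φ ∘ v) (φ.mapMatrix G) := by
  ext i
  simp [Matrix.vecMul, dotProduct, map_sum]

theorem UMod.map {v : Fin N → A} (φ : A →+* B) (h : UMod v) : UMod (φ ∘ v) := by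
  obtain ⟨w, hw⟩ := h
  refine ⟨φ ∘ w, ?_⟩
  rw [← map_one φ, ← hw]
  simp [dotProduct, map_sum]

theorem Isot.refl (v : Fin N → A) : Isot v v := ⟨1, 1, by simp, by simp, by simp⟩

theorem Isot.trans {u v w : Fin N → A} (h1 : Isot u v) (h2 : Isot v w) : Isot u w := by
  obtain ⟨G, G', h, h0, hv⟩ := h1
  obtain ⟨H, H', k, k0, kv⟩ := h2
  refine ⟨G * H, H' * G', ?_, ?_, ?_⟩
  · rw [mul_assoc, ← mul_assoc H, k, one_mul, h]
  · rw [map_mul, h0, k0, one_mul]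
  · rw [map_mul, ← Matrix.vecMul_vecMul, hv, kv]

theorem Isot.symm {v w : Fin N → A} (h1 : Isot v w) : Isot w v := by
  obtain ⟨G, G', h, h0, hv⟩ := h1
  refine ⟨G', G, mul_eq_one_comm.1 h, ?_, ?_⟩
  · have := congrArg ((evalRingHom (0 : A)).mapMatrix) h
    rwa [map_mul, h0, one_mul, map_one] at this
  · rw [← hv, Matrix.vecMul_vecMul, ← map_mul, h, map_one, Matrix.vecMul_one]

theorem eval_mapRingHom_matrix (φ : A →+* B) (a : A) (G : Matrix (Fin N) (Fin N) A[X]) :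
    (evalRingHom (φ a)).mapMatrix ((mapRingHom φ).mapMatrix G) =
      φ.mapMatrix ((evalRingHom a).mapMatrix G) := by
  ext i j
  simp [Polynomial.eval_map]

theorem Isot.map {v w : Fin N → A} (φ : A →+* B) (h1 : Isot v w) : Isot (φ ∘ v) (φ ∘ w) := by
  obtain ⟨G, G', h, h0, hv⟩ := h1
  refine ⟨(mapRingHom φ).mapMatrix G, (mapRingHom φ).mapMatrix G', ?_, ?_, ?_⟩
  · rw [← map_mul, h, map_one]
  · have := eval_mapRingHom_matrix φ 0 G
    rw [map_zero] at this
    rw [this, h0, map_one]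
  · have := eval_mapRingHom_matrix φ 1 G
    rw [map_one] at this
    rw [this, ← hv, map_vecMul']

theorem UMod.mul {v : Fin N → A} (h : UMod v) (M M' : Matrix (Fin N) (Fin N) A)
    (hM : M * M' = 1) : UMod (Matrix.vecMul v M) := by
  obtain ⟨w, hw⟩ := h
  refine ⟨Matrix.mulVec M' w, ?_⟩
  rw [← Matrix.dotProduct_mulVec, Matrix.mulVec_mulVec, hM, Matrix.one_mulVec, hw]

/-- isotopic implies related by an invertible matrix -/
theorem Isot.gl {v w : Fin N → A} (h1 : Isot v w) :
    ∃ M M' : Matrix (Fin N) (Fin N) A, M * M' = 1 ∧ Matrix.vecMul v M = w := by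
  obtain ⟨G, G', h, h0, hv⟩ := h1
  exact ⟨_, (evalRingHom 1).mapMatrix G', by rw [← map_mul, h, map_one], hv⟩

theorem Isot.umod {v w : Fin N → A} (h : Isot v w) (hv : UMod v) : UMod w := by
  obtain ⟨M, M', h1, rfl⟩ := h.gl
  exact hv.mul M M' h1

/-- A path of invertible matrices evaluated at two points. -/
theorem Isot.of_path (v : Fin N → A) (G G' : Matrix (Fin N) (Fin N) A[X]) (h : G * G' = 1)
    (h0 : (evalRingHom 0).mapMatrix G = 1) (a : A) :
    Isot v (Matrix.vecMul v ((evalRingHom a).mapMatrix G)) := by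
  refine ⟨(compRingHom (C a * X)).mapMatrix G, (compRingHom (C a * X)).mapMatrix G', ?_, ?_, ?_⟩
  · rw [← map_mul, h, map_one]
  · rw [← h0]
    ext i j; simp
  · congr 1
    ext i j; simp

theorem Isot.of_sq_zero (v : Fin N → A) (E : Matrix (Fin N) (Fin N) A) (hE : E * E = 0) :
    Isot v (v + Matrix.vecMul v E) := by
  have hE' : (C : A →+* A[X]).mapMatrix E * (C : A →+* A[X]).mapMatrix E = 0 := by
    rw [← map_mul, hE, map_zero]
  refine ⟨1 + (X : A[X]) • (C : A →+* A[X]).mapMatrix E,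
    1 - (X : A[X]) • (C : A →+* A[X]).mapMatrix E, ?_, ?_, ?_⟩
  · rw [add_mul, one_mul, mul_sub, mul_one, Matrix.smul_mul, Matrix.mul_smul, hE']
    simp
  · ext i j; simp [Matrix.one_apply]; split_ifs <;> simp
  · have : (evalRingHom (1 : A)).mapMatrix (1 + (X : A[X]) • (C : A →+* A[X]).mapMatrix E)
        = 1 + E := by
      ext i j; simp [Matrix.one_apply]; split_ifs <;> simp
    rw [this, Matrix.vecMul_add, Matrix.vecMul_one]

/-- add to all entries other than `j` multiples of the `j`th. -/
theorem Isot.add_mul_entry (v : Fin N → A) (j : Fin N) (x : Fin N → A) (hx : x j = 0) :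
    Isot v (fun i => v i + x i * v j) := by
  have := Isot.of_sq_zero v (Matrix.of fun a b => if a = j then x b else 0) (by
    ext a b
    simp [Matrix.mul_apply, hx])
  convert this using 1
  ext i
  simp [Matrix.vecMul, dotProduct, mul_comm]

/-- add to the `j`th entry a combination of the others. -/
theorem Isot.add_comb (v : Fin N → A) (j : Fin N) (x : Fin N → A) (hx : x j = 0) :
    Isot v (Function.update v j (v j + x ⬝ᵥ v)) := by
  have := Isot.of_sq_zero v (Matrix.of fun a b => if b = j then x a else 0) (by
    ext a b
    simp only [Matrix.mul_apply, Matrix.of_apply, Matrix.zero_apply]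
    apply Finset.sum_eq_zero
    intro c _
    by_cases h : c = j
    · subst h; simp [hx]
    · simp [h])
  convert this using 1
  ext i
  by_cases h : i = j
  · subst h
    simp [Matrix.vecMul, dotProduct, mul_comm]
  · simp [Matrix.vecMul, dotProduct, h]

end basics

/-- the standard row -/
def stdRow (A : Type*) [CommRing A] (N : ℕ) : Fin (N + 1) → A := Pi.single 0 1

theorem stdRow_map {A B : Type*} [CommRing A] [CommRing B] (φ : A →+* B) (N : ℕ) :
    φ ∘ stdRow A N = stdRow B N := by
  ext i
  simp only [stdRow, Function.comp, Pi.single_apply]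
  split_ifs <;> simp

theorem UMod.std (A : Type*) [CommRing A] (N : ℕ) : UMod (stdRow A N) :=
  ⟨stdRow A N, by simp [stdRow]⟩

/-- A row with `1` at place `j`, plus any other place, is trivial. -/
theorem Isot.of_entry_one {A : Type*} [CommRing A] {N : ℕ} (v : Fin (N + 1) → A) (j : Fin (N + 1))
    (hj : v j = 1) : Isot v (stdRow A N) := by
  by_cases h0 : j = 0
  · subst h0
    have := Isot.add_mul_entry v 0 (fun i => if i = 0 then 0 else - v i) (by simp)
    convert this using 1
    ext i
    by_cases h : i = 0
    · subst h; simp [stdRow, hj]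
    · simp [h, stdRow, hj]
  · have h1 := Isot.add_comb v 0 (Pi.single j (1 - v 0)) (by
      simp [h0])
    refine h1.trans ?_
    set w := Function.update v 0 (v 0 + Pi.single j (1 - v 0) ⬝ᵥ v) with hw
    have hw0 : w 0 = 1 := by simp [hw, hj]
    have := Isot.add_mul_entry w 0 (fun i => if i = 0 then 0 else - w i) (by simp)
    convert this using 1
    ext i
    by_cases h : i = 0
    · subst h; simp [stdRow, hw0]
    · simp [h, stdRow, hw0]

/-- A row with unimodular truncation is trivial. -/
theorem Isot.of_comb {A : Type*} [CommRing A] {N : ℕ} (v : Fin (N + 1) → A) (j : Fin (N + 1))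
    (x : Fin (N + 1) → A) (hx : x j = 0) (h : x ⬝ᵥ v = 1) : Isot v (stdRow A N) := by
  have h1 := Isot.add_comb v j ((1 - v j) • x) (by simp [hx])
  refine h1.trans (Isot.of_entry_one _ j ?_)
  simp [h]


/-- The two conditions saying that `φ` is a localization at `S`, up to units. -/
def LocLike {B B' : Type*} [CommRing B] [CommRing B'] (φ : B →+* B') (S : Submonoid B) : Prop :=
  (∀ b' : B', ∃ s ∈ S, ∃ b, φ b = φ s * b') ∧ (∀ b, φ b = 0 → ∃ s ∈ S, s * b = 0)

section loclike
variable {B B' : Type*} [CommRing B] [CommRing B'] {N : ℕ} {φ : B →+* B'} {S : Submonoid B}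

theorem LocLike.of_isLocalization {B B' : Type*} [CommRing B] [CommRing B'] [Algebra B B']
    (S : Submonoid B) [IsLocalization S B'] : LocLike (algebraMap B B') S := by
  constructor
  · intro b'
    obtain ⟨⟨b, s⟩, h⟩ := IsLocalization.surj S b'
    exact ⟨s, s.2, b, by rw [mul_comm]; exact h.symm⟩
  · intro b hb
    obtain ⟨s, hs⟩ := (IsLocalization.map_eq_zero_iff S B' b).1 hb
    exact ⟨s, s.2, hs⟩

theorem LocLike.clear (h : LocLike φ S) {ι : Type*} (F : Finset ι) (x : ι → B') :
    ∃ s ∈ S, ∀ i ∈ F, ∃ b, φ b = φ s * x i := by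
  classical
  induction F using Finset.induction_on with
  | empty => exact ⟨1, S.one_mem, by simp⟩
  | insert a F ha ih =>
    obtain ⟨s, hs, hF⟩ := ih
    obtain ⟨t, ht, b, hb⟩ := h.1 (x a)
    refine ⟨s * t, S.mul_mem hs ht, ?_⟩
    intro i hi
    rcases Finset.mem_insert.1 hi with rfl | hi
    · exact ⟨s * b, by rw [map_mul, hb, map_mul, mul_assoc]⟩
    · obtain ⟨c, hc⟩ := hF i hi
      exact ⟨t * c, by rw [map_mul, hc, map_mul]; ring⟩

theorem LocLike.kill (h : LocLike φ S) {ι : Type*} (F : Finset ι) (x : ι → B)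
    (hx : ∀ i ∈ F, φ (x i) = 0) : ∃ s ∈ S, ∀ i ∈ F, s * x i = 0 := by
  classical
  induction F using Finset.induction_on with
  | empty => exact ⟨1, S.one_mem, by simp⟩
  | insert a F ha ih =>
    obtain ⟨s, hs, hF⟩ := ih (fun i hi => hx i (Finset.mem_insert_of_mem hi))
    obtain ⟨t, ht, hb⟩ := h.2 (x a) (hx a (Finset.mem_insert_self _ _))
    refine ⟨s * t, S.mul_mem hs ht, ?_⟩
    intro i hi
    rcases Finset.mem_insert.1 hi with rfl | hi
    · rw [mul_assoc, hb, mul_zero]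
    · rw [mul_right_comm, hF i hi, zero_mul]

theorem LocLike.clear_matrix (h : LocLike φ S) (G : Matrix (Fin N) (Fin N) B'[X]) :
    ∃ s ∈ S, ∀ i j n, ∃ b, φ b = φ s * (G i j).coeff n := by
  obtain ⟨s, hs, hF⟩ := h.clear (Finset.univ.sigma fun ij : Fin N × Fin N => (G ij.1 ij.2).support)
    (fun x => (G x.1.1 x.1.2).coeff x.2)
  refine ⟨s, hs, fun i j n => ?_⟩
  by_cases hn : (G i j).coeff n = 0
  · exact ⟨0, by simp [hn]⟩
  · exact hF ⟨(i, j), n⟩ (by simpa using hn)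

theorem LocLike.kill_vec (h : LocLike φ S) {ι : Type*} [Fintype ι] (v : ι → B[X])
    (hv : ∀ i, (v i).map φ = 0) (h0 : ∀ i, (v i).coeff 0 = 0) :
    ∃ s ∈ S, ∀ i, (v i).comp (C s * X) = 0 := by
  obtain ⟨s, hs, hF⟩ := h.kill (Finset.univ.sigma fun i : ι => (v i).support)
    (fun x => (v x.1).coeff x.2) (fun x _ => by
      rw [← coeff_map, hv, coeff_zero])
  refine ⟨s, hs, fun i => ?_⟩
  ext n
  rw [comp_C_mul_X_coeff, coeff_zero]
  rcases n with _ | n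
  · simp [h0]
  · by_cases hn : (v i).coeff (n + 1) = 0
    · simp [hn]
    · have := hF ⟨i, n + 1⟩ (by simpa using hn)
      simp only at this
      rw [pow_succ, mul_comm, mul_assoc, this, mul_zero]

theorem lift_poly (s : B) (q : B'[X]) (hs : ∀ n, ∃ b, φ b = φ s * q.coeff n) (b0 : B)
    (h0 : φ b0 = q.coeff 0) : ∃ p : B[X], p.coeff 0 = b0 ∧ p.map φ = q.comp (C (φ s) * X) := by
  choose b hb using hs
  refine ⟨C b0 + X * ∑ n ∈ Finset.range q.natDegree, C (s ^ n * b (n + 1)) * X ^ n, ?_, ?_⟩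
  · simp
  · ext n
    rw [comp_C_mul_X_coeff, coeff_map]
    rcases n with _ | n
    · simp [h0]
    · simp only [coeff_add, coeff_C_succ, zero_add, coeff_X_mul, finsetSum_coeff,
        coeff_C_mul_X_pow]
      rw [Finset.sum_ite_eq]
      split_ifs with hn
      · rw [map_mul, hb, map_pow]; ring
      · rw [map_zero, coeff_eq_zero_of_natDegree_lt, zero_mul]
        simp at hn; omega

theorem compRingHom_map (s : B) (p : B[X]) :
    (p.comp (C s * X)).map φ = (p.map φ).comp (C (φ s) * X) := by
  simp [Polynomial.map_comp]

theorem LocLike.lift_path (h : LocLike φ S) (G G' : Matrix (Fin N) (Fin N) B'[X]) (hG : G * G' = 1)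
    (h0 : (evalRingHom 0).mapMatrix G = 1) :
    ∃ s ∈ S, ∃ L L' : Matrix (Fin N) (Fin N) B[X], L * L' = 1 ∧
      (evalRingHom 0).mapMatrix L = 1 ∧
      (mapRingHom φ).mapMatrix L = (compRingHom (C (φ s) * X)).mapMatrix G := by
  have h0' : (evalRingHom (0 : B')).mapMatrix G' = 1 := by
    have := congrArg ((evalRingHom (0 : B')).mapMatrix) hG
    rwa [map_mul, h0, one_mul, map_one] at this
  obtain ⟨s1, hs1, hc1⟩ := h.clear_matrix G
  obtain ⟨s2, hs2, hc2⟩ := h.clear_matrix G'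
  have key : ∀ G : Matrix (Fin N) (Fin N) B'[X], (evalRingHom 0).mapMatrix G = 1 →
      (∀ i j n, ∃ b, φ b = φ (s1 * s2) * (G i j).coeff n) →
      ∃ L : Matrix (Fin N) (Fin N) B[X], (evalRingHom 0).mapMatrix L = 1 ∧
      (mapRingHom φ).mapMatrix L = (compRingHom (C (φ (s1 * s2)) * X)).mapMatrix G := by
    intro G h0 hc
    have : ∀ i j, ∃ p : B[X], p.coeff 0 = (1 : Matrix (Fin N) (Fin N) B) i j ∧
        p.map φ = (G i j).comp (C (φ (s1 * s2)) * X) := by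
      intro i j
      refine lift_poly _ _ (hc i j) _ ?_
      have := congrFun (congrFun h0 i) j
      simp only [RingHom.mapMatrix_apply, Matrix.map_apply, coe_evalRingHom] at this
      rw [coeff_zero_eq_eval_zero, this]
      simp only [Matrix.one_apply]; split_ifs <;> simp
    choose L hL1 hL2 using this
    refine ⟨Matrix.of L, ?_, ?_⟩
    · ext i j
      simp [← coeff_zero_eq_eval_zero, hL1]
    · ext1 i j
      simp [hL2]
  obtain ⟨L, hL0, hL⟩ := key G h0 (fun i j n => by
    obtain ⟨b, hb⟩ := hc1 i j n
    exact ⟨s2 * b, by rw [map_mul, hb, map_mul]; ring⟩)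
  obtain ⟨L', hL0', hL'⟩ := key G' h0' (fun i j n => by
    obtain ⟨b, hb⟩ := hc2 i j n
    exact ⟨s1 * b, by rw [map_mul, hb, map_mul]; ring⟩)
  obtain ⟨t, ht, hk⟩ := h.kill_vec (fun ij : Fin N × Fin N => (L * L' - 1) ij.1 ij.2) (by
    intro ij
    have : (mapRingHom φ).mapMatrix (L * L' - 1) = 0 := by
      rw [map_sub, map_mul, hL, hL', ← map_mul, hG, map_one, map_one, sub_self]
    simpa using congrFun (congrFun this ij.1) ij.2) (by
    intro ij
    have : (evalRingHom 0).mapMatrix (L * L' - 1) = 0 := by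
      rw [map_sub, map_mul, hL0, hL0', map_one, one_mul, sub_self]
    have := congrFun (congrFun this ij.1) ij.2
    rw [coeff_zero_eq_eval_zero]
    simpa using this)
  refine ⟨s1 * s2 * t, S.mul_mem (S.mul_mem hs1 hs2) ht, (compRingHom (C t * X)).mapMatrix L,
    (compRingHom (C t * X)).mapMatrix L', ?_, ?_, ?_⟩
  · rw [← map_mul, ← sub_eq_zero, ← map_one (compRingHom (C t * X)).mapMatrix, ← map_sub]
    ext1 i j
    simpa using hk (i, j)
  · rw [← hL0]
    ext i j
    simp
  · have : (mapRingHom φ).mapMatrix ((compRingHom (C t * X)).mapMatrix L) =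
      (compRingHom (C (φ t) * X)).mapMatrix ((mapRingHom φ).mapMatrix L) := by
      ext1 i j
      simp [Polynomial.map_comp]
    rw [this, hL]
    ext1 i j
    simp [comp_assoc, mul_assoc]

end loclike

/-- Splitting an isotopy over a comaximal pair. -/
theorem Isot.split {A A1 A2 A12 : Type*} [CommRing A] [CommRing A1] [CommRing A2] [CommRing A12]
    {N : ℕ} (i1 : A →+* A1) (i2 : A →+* A2) (j1 : A1 →+* A12) (j2 : A2 →+* A12)
    (hcomm : j1.comp i1 = j2.comp i2) (U1 U2 : Submonoid A)
    (hco : ∀ a ∈ U1, ∀ b ∈ U2, IsCoprime a b)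
    (h1 : LocLike j1 (U2.map i1)) (h2 : LocLike j2 (U1.map i2))
    (v1 : Fin N → A1) (v2 : Fin N → A2) (hv : Isot (j1 ∘ v1) (j2 ∘ v2)) :
    ∃ w1 w2, Isot v1 w1 ∧ Isot v2 w2 ∧ j1 ∘ w1 = j2 ∘ w2 := by
  obtain ⟨G, G', hG, hG0, hvG⟩ := hv
  -- lift `G (s X)` to `A1`
  obtain ⟨_, ⟨s, hs, rfl⟩, L1, L1', hL1, hL10, hL1G⟩ := h1.lift_path G G' hG hG0
  -- the other path, `G(1 - X)⁻¹ G(1)`... reversed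
  set M := (compRingHom (1 - X : A12[X])).mapMatrix G with hM
  set M' := (compRingHom (1 - X : A12[X])).mapMatrix G' with hM'
  have hMM : M * M' = 1 := by rw [hM, hM', ← map_mul, hG, map_one]
  set G1 := (evalRingHom 1).mapMatrix G with hG1
  set G1' := (evalRingHom 1).mapMatrix G' with hG1'
  have hGG1 : G1 * G1' = 1 := by rw [hG1, hG1', ← map_mul, hG, map_one]
  have hGG1' : G1' * G1 = 1 := mul_eq_one_comm.1 hGG1
  obtain ⟨_, ⟨t, ht, rfl⟩, L2, L2', hL2, hL20, hL2G⟩ := h2.lift_path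
    ((C : A12 →+* A12[X]).mapMatrix G1' * M) (M' * (C : A12 →+* A12[X]).mapMatrix G1) (by
      rw [mul_assoc, ← mul_assoc M, hMM, one_mul, ← map_mul, hGG1', map_one]) (by
      rw [map_mul]
      have e1 : (evalRingHom (0 : A12)).mapMatrix ((C : A12 →+* A12[X]).mapMatrix G1') = G1' := by
        ext i j; simp
      have e2 : (evalRingHom (0 : A12)).mapMatrix M = G1 := by
        ext i j; simp [hM, hG1, eval_comp]
      rw [e1, e2, hGG1'])
  obtain ⟨α, β, hαβ⟩ := hco t ht s hs
  -- `α t + β s = 1`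
  refine ⟨_, _, Isot.of_path v1 L1 L1' hL1 hL10 (i1 β), Isot.of_path v2 L2 L2' hL2 hL20 (i2 α), ?_⟩
  have c2 : ∀ x, j2 (i2 x) = j1 (i1 x) := fun x => (RingHom.congr_fun hcomm x).symm
  rw [map_vecMul', map_vecMul', ← eval_mapRingHom_matrix, ← eval_mapRingHom_matrix, hL1G, hL2G,
    ← hvG, Matrix.vecMul_vecMul]
  congr 1
  set a := j1 (i1 (β * s)) with ha
  have e1 : (evalRingHom (j1 (i1 β))).mapMatrix ((compRingHom (C (j1 (i1 s)) * X)).mapMatrix G)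
      = (evalRingHom a).mapMatrix G := by
    ext i j; simp only [RingHom.mapMatrix_apply, Matrix.map_apply, coe_compRingHom, coe_evalRingHom, eval_comp, eval_mul, eval_C, eval_X]
    rw [ha, map_mul, map_mul, mul_comm]
  have e2 : (evalRingHom (j2 (i2 α))).mapMatrix ((compRingHom (C (j2 (i2 t)) * X)).mapMatrix
      ((C : A12 →+* A12[X]).mapMatrix G1' * M)) = G1' * (evalRingHom a).mapMatrix G := by
    rw [map_mul, map_mul]
    congr 1
    · ext i j; simp
    · ext i j
      have : a = 1 - j2 (i2 t) * j2 (i2 α) := by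
        rw [c2, c2, ← map_mul, ← map_mul, ha, ← map_one (j1.comp i1)]
        rw [← hαβ]
        simp only [RingHom.comp_apply, map_add, map_mul]
        ring
      rw [this]
      simp [hM, eval_comp]
  rw [e1, e2, ← mul_assoc, hGG1, one_mul]

/-- sheaf property for a comaximal pair of localizations -/
theorem glue_elem {A A1 A2 A12 : Type*} [CommRing A] [CommRing A1] [CommRing A2] [CommRing A12]
    [Algebra A A1] [Algebra A A2] [Algebra A A12] (j1 : A1 →+* A12) (j2 : A2 →+* A12)
    (hj1 : j1.comp (algebraMap A A1) = algebraMap A A12)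
    (hj2 : j2.comp (algebraMap A A2) = algebraMap A A12)
    (U1 U2 : Submonoid A) (hco : ∀ a ∈ U1, ∀ b ∈ U2, IsCoprime a b)
    [IsLocalization U1 A1] [IsLocalization U2 A2] [IsLocalization (U1 ⊔ U2) A12]
    (x : A1) (y : A2) (h : j1 x = j2 y) :
    ∃ a : A, algebraMap A A1 a = x ∧ algebraMap A A2 a = y := by
  obtain ⟨⟨a, u1⟩, hx⟩ := IsLocalization.surj U1 x
  obtain ⟨⟨b, u2⟩, hy⟩ := IsLocalization.surj U2 y
  have c1 : ∀ x, j1 (algebraMap A A1 x) = algebraMap A A12 x := RingHom.congr_fun hj1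
  have c2 : ∀ x, j2 (algebraMap A A2 x) = algebraMap A A12 x := RingHom.congr_fun hj2
  simp only at hx hy
  have hx' := congrArg j1 hx
  have hy' := congrArg j2 hy
  rw [map_mul, c1, c1] at hx'
  rw [map_mul, c2, c2] at hy'
  have e : algebraMap A A12 (a * u2) = algebraMap A A12 (b * u1) := by
    rw [map_mul, map_mul, ← hx', ← hy', h]; ring
  obtain ⟨⟨t, ht⟩, e⟩ := (IsLocalization.eq_iff_exists (U1 ⊔ U2) A12).1 e
  obtain ⟨t1, ht1, t2, ht2, rfl⟩ := Submonoid.mem_sup.1 ht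
  simp only at e
  obtain ⟨α, β, hαβ⟩ := hco (u1 * t1) (U1.mul_mem u1.2 ht1) (u2 * t2) (U2.mul_mem u2.2 ht2)
  have q1 : (β * (b * t2) + α * (a * t1)) * (u1 * t1) = a * t1 := by
    linear_combination (-β) * e + (a * t1) * hαβ
  have q2 : (β * (b * t2) + α * (a * t1)) * (u2 * t2) = b * t2 := by
    linear_combination α * e + (b * t2) * hαβ
  refine ⟨β * (b * t2) + α * (a * t1), ?_, ?_⟩
  · have hu : IsUnit (algebraMap A A1 (u1 * t1)) :=
      IsLocalization.map_units A1 ⟨u1 * t1, U1.mul_mem u1.2 ht1⟩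
    apply hu.mul_right_cancel
    rw [← map_mul, q1, map_mul, map_mul, ← hx]; ring
  · have hu : IsUnit (algebraMap A A2 (u2 * t2)) :=
      IsLocalization.map_units A2 ⟨u2 * t2, U2.mul_mem u2.2 ht2⟩
    apply hu.mul_right_cancel
    rw [← map_mul, q2, map_mul, map_mul, ← hy]; ring

theorem locLike_sup {A A1 A12 : Type*} [CommRing A] [CommRing A1] [CommRing A12]
    [Algebra A A1] [Algebra A A12] (j1 : A1 →+* A12)
    (hj1 : j1.comp (algebraMap A A1) = algebraMap A A12) (U1 U2 : Submonoid A)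
    [IsLocalization U1 A1] [IsLocalization (U1 ⊔ U2) A12] :
    LocLike j1 (U2.map (algebraMap A A1)) := by
  have c1 : ∀ x, j1 (algebraMap A A1 x) = algebraMap A A12 x := RingHom.congr_fun hj1
  constructor
  · intro y
    obtain ⟨⟨a, ⟨u, hu⟩⟩, hx⟩ := IsLocalization.surj (U1 ⊔ U2) y
    obtain ⟨t1, ht1, t2, ht2, rfl⟩ := Submonoid.mem_sup.1 hu
    refine ⟨_, ⟨t2, ht2, rfl⟩, IsLocalization.mk' A1 a ⟨t1, ht1⟩, ?_⟩
    have hu : IsUnit (algebraMap A A12 t1) :=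
      IsLocalization.map_units A12 (⟨t1, Submonoid.mem_sup_left ht1⟩ : (U1 ⊔ U2 : Submonoid A))
    apply hu.mul_right_cancel
    rw [← c1 t1, ← map_mul]
    have := IsLocalization.mk'_spec A1 a (⟨t1, ht1⟩ : U1)
    simp only at this
    rw [this, c1, c1, c1]
    simp only [map_mul] at hx
    rw [← hx]; ring
  · intro x hx0
    obtain ⟨⟨a, u1⟩, hx⟩ := IsLocalization.surj U1 x
    simp only at hx
    have e : algebraMap A A12 a = 0 := by rw [← c1, ← hx, map_mul, hx0, zero_mul]
    obtain ⟨⟨t, ht⟩, e⟩ := (IsLocalization.map_eq_zero_iff (U1 ⊔ U2) A12 a).1 e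
    obtain ⟨t1, ht1, t2, ht2, rfl⟩ := Submonoid.mem_sup.1 ht
    refine ⟨_, ⟨t2, ht2, rfl⟩, ?_⟩
    have hu : IsUnit (algebraMap A A1 (u1 * t1)) :=
      IsLocalization.map_units A1 ⟨u1 * t1, U1.mul_mem u1.2 ht1⟩
    apply hu.mul_right_cancel
    rw [map_mul, zero_mul]
    calc _ = (x * algebraMap A A1 u1) * algebraMap A A1 (t1 * t2) := by rw [map_mul]; ring
      _ = _ := by
        rw [hx, ← map_mul, mul_comm]
        simp only at e
        rw [e, map_zero]

theorem umod_clear {A : Type*} [CommRing A] {N : ℕ} (w : Fin N → A) (A1 : Type*) [CommRing A1]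
    [Algebra A A1] (U : Submonoid A) [IsLocalization U A1] (h : UMod (algebraMap A A1 ∘ w)) :
    ∃ u ∈ U, ∃ x : Fin N → A, w ⬝ᵥ x = u := by
  obtain ⟨y, hy⟩ := h
  obtain ⟨s, hs⟩ := IsLocalization.exist_integer_multiples_of_finite U y
  choose x hx using hs
  have : algebraMap A A1 (w ⬝ᵥ x) = algebraMap A A1 s := by
    have : algebraMap A A1 (s : A) = algebraMap A A1 s * ((algebraMap A A1 ∘ w) ⬝ᵥ y) := by
      rw [hy, mul_one]
    rw [this]
    simp only [dotProduct, map_sum, map_mul, hx, Finset.mul_sum, Function.comp, Algebra.smul_def]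
    exact Finset.sum_congr rfl fun i _ => by ring
  obtain ⟨c, hc⟩ := (IsLocalization.eq_iff_exists U A1).1 this
  refine ⟨c * s, U.mul_mem c.2 s.2, (c : A) • x, ?_⟩
  rw [dotProduct_smul, smul_eq_mul, hc]

/-- Gluing of unimodular rows. -/
theorem glue_rows {A A1 A2 A12 : Type*} [CommRing A] [CommRing A1] [CommRing A2] [CommRing A12]
    [Algebra A A1] [Algebra A A2] [Algebra A A12] (j1 : A1 →+* A12) (j2 : A2 →+* A12)
    (hj1 : j1.comp (algebraMap A A1) = algebraMap A A12)
    (hj2 : j2.comp (algebraMap A A2) = algebraMap A A12)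
    (U1 U2 : Submonoid A) (hco : ∀ a ∈ U1, ∀ b ∈ U2, IsCoprime a b)
    [IsLocalization U1 A1] [IsLocalization U2 A2] [IsLocalization (U1 ⊔ U2) A12]
    {N : ℕ} (v1 : Fin N → A1) (v2 : Fin N → A2) (hu1 : UMod v1) (hu2 : UMod v2)
    (hv : Isot (j1 ∘ v1) (j2 ∘ v2)) :
    ∃ w : Fin N → A, UMod w ∧ Isot v1 (algebraMap A A1 ∘ w) ∧ Isot v2 (algebraMap A A2 ∘ w) := by
  have : IsLocalization (U2 ⊔ U1) A12 := by rw [sup_comm]; infer_instance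
  obtain ⟨w1, w2, hw1, hw2, hw⟩ := Isot.split (algebraMap A A1) (algebraMap A A2) j1 j2
    (hj1.trans hj2.symm) U1 U2 hco (locLike_sup j1 hj1 U1 U2) (locLike_sup j2 hj2 U2 U1) v1 v2 hv
  have := fun i => glue_elem j1 j2 hj1 hj2 U1 U2 hco (w1 i) (w2 i) (congrFun hw i)
  choose w hwa hwb using this
  have e1 : algebraMap A A1 ∘ w = w1 := funext hwa
  have e2 : algebraMap A A2 ∘ w = w2 := funext hwb
  refine ⟨w, ?_, e1 ▸ hw1, e2 ▸ hw2⟩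
  obtain ⟨u1, h1, x1, hx1⟩ := umod_clear w A1 U1 (e1 ▸ hw1.umod hu1)
  obtain ⟨u2, h2, x2, hx2⟩ := umod_clear w A2 U2 (e2 ▸ hw2.umod hu2)
  obtain ⟨α, β, hαβ⟩ := hco u1 h1 u2 h2
  refine ⟨α • x1 + β • x2, ?_⟩
  rw [dotProduct_add, dotProduct_smul, dotProduct_smul, hx1, hx2, smul_eq_mul, smul_eq_mul, hαβ]


/-- The submonoid of monic polynomials. -/
def monics (D : Type*) [CommRing D] : Submonoid D[X] where
  carrier := {p | p.Monic}
  one_mem' := monic_one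
  mul_mem' := fun h1 h2 => Monic.mul h1 h2

theorem ideal_top_of_monic {D : Type*} [CommRing D] [IsLocalRing D] (I : Ideal D[X])
    (s e : D[X]) (hs : s.Monic) (hsI : s ∈ I) (heI : e ∈ I)
    (he : e.map (IsLocalRing.residue D) = 1) : I = ⊤ := by
  by_contra hI
  obtain ⟨n, hn, hIn⟩ := Ideal.exists_le_maximal I hI
  have hintg : (algebraMap D (D[X] ⧸ n)).IsIntegral := by
    have hx : IsIntegral D (Ideal.Quotient.mk n (X : D[X])) := by
      refine ⟨s, hs, ?_⟩
      have : eval₂ (algebraMap D (D[X] ⧸ n)) (Ideal.Quotient.mk n X) s = Ideal.Quotient.mk n s := by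
        have : algebraMap D (D[X] ⧸ n) = (Ideal.Quotient.mk n).comp C := rfl
        rw [this, ← hom_eval₂]
        congr 1
        exact eval₂_C_X
      rw [this]
      exact Ideal.Quotient.eq_zero_iff_mem.2 (hIn hsI)
    intro y
    obtain ⟨p, rfl⟩ := Ideal.Quotient.mk_surjective y
    change IsIntegral D _
    have : Ideal.Quotient.mk n p = aeval (Ideal.Quotient.mk n (X : D[X])) p := by
      have := Polynomial.aeval_algHom_apply (Ideal.Quotient.mkₐ D n) (X : D[X]) p
      rw [aeval_X_left_apply] at this
      exact this.symm
    rw [this]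
    have h2 := adjoin_le_integralClosure hx
    exact h2 (aeval_mem_adjoin_singleton D _)
  have hf : (C : D →+* D[X]).comp (RingHom.id D) = C := rfl
  have hmax : (n.comap (C : D →+* D[X])).IsMaximal := by
    let _ := Ideal.Quotient.field n
    have := Ideal.isMaximal_comap_of_isIntegral_of_isMaximal' _ hintg (⊥ : Ideal (D[X] ⧸ n))
    have e : (⊥ : Ideal (D[X] ⧸ n)).comap (algebraMap D (D[X] ⧸ n)) = n.comap C := by
      ext x
      simp only [Ideal.mem_comap, Ideal.mem_bot]
      exact Ideal.Quotient.eq_zero_iff_mem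
    rwa [e] at this
  have hm := IsLocalRing.eq_maximalIdeal hmax
  have hle : (IsLocalRing.maximalIdeal D).map C ≤ n := by
    rw [Ideal.map_le_iff_le_comap, hm]
  have h1 : e - 1 ∈ (IsLocalRing.maximalIdeal D).map (C : D →+* D[X]) := by
    rw [Ideal.mem_map_C_iff]
    intro k
    rw [← IsLocalRing.residue_eq_zero_iff, ← coeff_map, Polynomial.map_sub, he]
    simp
  apply hn.ne_top
  rw [Ideal.eq_top_iff_one]
  have := n.sub_mem (hIn heI) (hle h1)
  simpa using this

theorem exists_ker_unimod {A : Type*} [CommRing A] [IsDomain A] [IsPrincipalIdealRing A] {n : ℕ}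
    (M : Matrix (Fin n) (Fin n) A) (S : Finset (Fin n)) (hS : S ≠ Finset.univ) :
    ∃ ξ q : Fin n → A, (∀ i ∈ S, M i ⬝ᵥ ξ = 0) ∧ q ⬝ᵥ ξ = 1 := by
  classical
  obtain ⟨j, hj⟩ : ∃ j, j ∉ S := by
    by_contra h; push Not at h; exact hS (Finset.eq_univ_iff_forall.2 h)
  have hdet : (Matrix.of fun i => if i ∈ S then M i else 0).det = 0 :=
    Matrix.det_eq_zero_of_row_eq_zero j (fun c => by simp [hj])
  obtain ⟨v, hv0, hv⟩ := Matrix.exists_mulVec_eq_zero_iff.2 hdet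
  have hvS : ∀ i ∈ S, M i ⬝ᵥ v = 0 := by
    intro i hi
    have := congrFun hv i
    simpa [Matrix.mulVec, hi] using this
  obtain ⟨g, hg⟩ := (IsPrincipalIdealRing.principal (Ideal.span (Set.range v))).principal
  change Ideal.span (Set.range v) = Ideal.span {g} at hg
  have h1 : ∀ i, ∃ x, v i = g * x := fun i => by
    have : v i ∈ Ideal.span {g} := hg ▸ Ideal.subset_span ⟨i, rfl⟩
    exact Ideal.mem_span_singleton.1 this
  choose ξ hξ using h1
  have hg0 : g ≠ 0 := by
    rintro rfl
    apply hv0; ext i; simp [hξ]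
  have hgm : g ∈ Ideal.span (Set.range v) := hg ▸ Ideal.mem_span_singleton_self g
  obtain ⟨q, hq⟩ := (Submodule.mem_span_range_iff_exists_fun A).1 hgm
  have hvξ : v = g • ξ := by ext i; simp [hξ]
  refine ⟨ξ, q, ?_, ?_⟩
  · intro i hi
    have := hvS i hi
    rw [hvξ, dotProduct_smul, smul_eq_mul] at this
    exact (mul_eq_zero.1 this).resolve_left hg0
  · apply mul_left_cancel₀ hg0
    rw [mul_one]
    conv_rhs => rw [← hq]
    simp only [dotProduct, Finset.mul_sum, smul_eq_mul, hξ]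
    exact Finset.sum_congr rfl fun i _ => by ring

/-- rows of `M` in `S` have `W` as a partial right inverse -/
def Frame {A : Type*} [CommRing A] {n : ℕ} (M W : Fin n → Fin n → A) (S : Finset (Fin n)) : Prop :=
  ∀ i ∈ S, ∀ j ∈ S, M i ⬝ᵥ W j = if i = j then 1 else 0

theorem Frame.insert_row {A : Type*} [CommRing A] {n : ℕ} {M W : Fin n → Fin n → A}
    {S : Finset (Fin n)} (h : Frame M W S) (j : Fin n) (hj : j ∉ S) (p y : Fin n → A)
    (hpy : p ⬝ᵥ y = 1) (hy : ∀ i ∈ S, M i ⬝ᵥ y = 0) :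
    Frame (Function.update M j p) (fun c => if c = j then y else W c - (p ⬝ᵥ W c) • y)
      (insert j S) := by
  intro i hi c hc
  rw [Finset.mem_insert] at hi hc
  by_cases hij : i = j
  · subst hij
    by_cases hcj : c = i
    · subst hcj; simp [hpy]
    · simp [hcj, Ne.symm hcj, hpy, dotProduct_sub]
  · have hiS := hi.resolve_left hij
    by_cases hcj : c = j
    · subst hcj; simp [hij, hy i hiS]
    · have hcS := hc.resolve_left hcj
      simp [hij, hcj, dotProduct_sub, hy i hiS, h i hiS c hcS]

theorem Frame.map {A B : Type*} [CommRing A] [CommRing B] (φ : A →+* B) {n : ℕ}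
    {M W : Fin n → Fin n → A} {S : Finset (Fin n)} (h : Frame M W S) :
    Frame (fun i => φ ∘ M i) (fun i => φ ∘ W i) S := by
  intro i hi j hj
  rw [← RingHom.map_dotProduct, h i hi j hj]
  split_ifs <;> simp

theorem Frame.full {A : Type*} [CommRing A] {n : ℕ} {M W : Fin n → Fin n → A}
    (h : Frame M W Finset.univ) : (Matrix.of M) * (Matrix.of W).transpose = 1 := by
  ext i j
  rw [Matrix.mul_apply', Matrix.one_apply]
  exact h i (Finset.mem_univ _) j (Finset.mem_univ _)

theorem det_updateRow_eq_sum {A : Type*} [CommRing A] {n : ℕ} (M : Matrix (Fin n) (Fin n) A)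
    (j : Fin n) (w : Fin n → A) :
    (M.updateRow j w).det = w ⬝ᵥ fun c => M.adjugate c j := by
  have h := congrFun (congrFun (Matrix.mul_adjugate (M.updateRow j w)) j) j
  rw [Matrix.mul_apply'] at h
  simp only [Matrix.smul_apply, Matrix.one_apply_eq, smul_eq_mul, mul_one] at h
  rw [← h]
  congr 1
  · ext c; simp
  · ext c
    rw [Matrix.adjugate_apply, Matrix.adjugate_apply, Matrix.updateRow_idem]

/-- completing a frame with one missing row -/
theorem Frame.complete {A : Type*} [CommRing A] {n : ℕ} {M W : Fin n → Fin n → A} (j : Fin n)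
    (h : Frame M W (Finset.univ.erase j)) :
    ∃ w, IsUnit (Matrix.updateRow (Matrix.of M) j w).det := by
  classical
  set I : Ideal A := Ideal.span (Set.range fun c => (Matrix.of M).adjugate c j) with hI
  by_cases hIt : I = ⊤
  · have : (1 : A) ∈ I := hIt ▸ Submodule.mem_top
    obtain ⟨q, hq⟩ := (Submodule.mem_span_range_iff_exists_fun A).1 this
    refine ⟨q, ?_⟩
    rw [det_updateRow_eq_sum]
    have : q ⬝ᵥ (fun c => (Matrix.of M).adjugate c j) = 1 := by
      rw [← hq]; simp [dotProduct]
    rw [this]; exact isUnit_one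
  · exfalso
    obtain ⟨P, hP, hIP⟩ := Ideal.exists_le_maximal I hIt
    let _ := Ideal.Quotient.field P
    set φ := Ideal.Quotient.mk P with hφ
    have h' := h.map φ
    obtain ⟨ξ, q, hξ, hq⟩ := exists_ker_unimod (Matrix.of fun i => φ ∘ M i) (Finset.univ.erase j)
      (by intro e; have := Finset.mem_univ j; rw [← e] at this; simp at this)
    have h2 := h'.insert_row j (by simp) q ξ hq hξ
    rw [Finset.insert_erase (Finset.mem_univ j)] at h2
    have h3 := congrArg Matrix.det h2.full
    rw [Matrix.det_mul, Matrix.det_one] at h3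
    have h4 : (Matrix.of (Function.update (fun i => φ ∘ M i) j q)).det = 0 := by
      change (Matrix.updateRow (φ.mapMatrix (Matrix.of M)) j q).det = 0
      rw [det_updateRow_eq_sum]
      rw [← RingHom.map_adjugate]
      apply Finset.sum_eq_zero
      intro c _
      have : φ ((Matrix.of M).adjugate c j) = 0 :=
        Ideal.Quotient.eq_zero_iff_mem.2 (hIP (Ideal.subset_span ⟨c, rfl⟩))
      simp [this]
    rw [h4, zero_mul] at h3
    exact zero_ne_one h3

theorem monic_add_mul_X_pow {D : Type*} [CommRing D] (a s : D[X]) (hs : s.Monic) :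
    ∃ L : ℕ, (a + s * X ^ L).Monic := by
  nontriviality D
  refine ⟨a.natDegree + 1, Monic.add_of_right (hs.mul (monic_X_pow _)) ?_⟩
  rw [degree_mul' (by simp [hs.leadingCoeff]), degree_X_pow, degree_eq_natDegree hs.ne_zero]
  refine lt_of_le_of_lt degree_le_natDegree ?_
  norm_cast
  omega

theorem row_dot_adjugate {A : Type*} [CommRing A] {n : ℕ} (M : Fin n → Fin n → A) (i j : Fin n) :
    M i ⬝ᵥ (fun c => (Matrix.of M).adjugate c j) = if i = j then (Matrix.of M).det else 0 := by
  have := congrFun (congrFun (Matrix.mul_adjugate (Matrix.of M)) i) j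
  rw [Matrix.mul_apply'] at this
  rw [Matrix.smul_apply, Matrix.one_apply, smul_eq_mul, mul_ite, mul_one, mul_zero] at this
  exact this

/-- enlarging a frame, local case -/
theorem Frame.enlarge {D : Type*} [CommRing D] [IsLocalRing D] {n : ℕ}
    (M W : Fin n → Fin n → D[X]) (S : Finset (Fin n)) (h : Frame M W S)
    (j : Fin n) (hj : j ∉ S) (hS : insert j S ≠ Finset.univ)
    (hdet : ∃ δ s : D[X], s.Monic ∧ (Matrix.of M).det * δ = s) :
    ∃ p W', Frame (Function.update M j p) W' (insert j S) ∧
      ∃ s : D[X], s.Monic ∧ (Matrix.of (Function.update M j p)).det = s := by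
  classical
  obtain ⟨δ, s, hs, hδ⟩ := hdet
  set φ := mapRingHom (IsLocalRing.residue D) with hφ
  have hφs : Function.Surjective φ := Polynomial.map_surjective _ IsLocalRing.residue_surjective
  obtain ⟨ξ, q', hξ, hq'⟩ := exists_ker_unimod (Matrix.of fun i => φ ∘ M i) (insert j S) hS
  obtain ⟨x0, rfl⟩ := hφs.comp_left ξ
  obtain ⟨q, rfl⟩ := hφs.comp_left q'
  change ∀ i ∈ insert j S, (φ ∘ M i) ⬝ᵥ (φ ∘ x0) = 0 at hξ
  set x := x0 - ∑ c ∈ S, (M c ⬝ᵥ x0) • W c with hx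
  have hxS : ∀ i ∈ S, M i ⬝ᵥ x = 0 := by
    intro i hi
    rw [hx, dotProduct_sub, dotProduct_sum]
    rw [Finset.sum_eq_single_of_mem i hi]
    · rw [dotProduct_smul, h i hi i hi]; simp
    · intro c hc hci
      rw [dotProduct_smul, h i hi c hc, if_neg (Ne.symm hci), smul_zero]
  have hφx : φ ∘ x = φ ∘ x0 := by
    ext1 c
    simp only [hx, Function.comp, Pi.sub_apply, Finset.sum_apply, map_sub, map_sum, Pi.smul_apply,
      smul_eq_mul, map_mul]
    rw [Finset.sum_eq_zero, sub_zero]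
    intro i hi
    rw [RingHom.map_dotProduct, hξ i (Finset.mem_insert_of_mem hi), zero_mul]
  obtain ⟨L, hL⟩ := monic_add_mul_X_pow ((Matrix.of M).updateRow j q).det s hs
  set p := q + (δ * X ^ L) • M j with hp
  have hdet' : (Matrix.of (Function.update M j p)).det =
      ((Matrix.of M).updateRow j q).det + s * X ^ L := by
    change ((Matrix.of M).updateRow j p).det = _
    rw [hp, Matrix.det_updateRow_add, Matrix.det_updateRow_smul]
    have : (Matrix.of M).updateRow j (M j) = Matrix.of M := Matrix.updateRow_eq_self _ _
    rw [this, ← hδ]; ring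
  set I : Ideal D[X] :=
    { carrier := {a | ∃ y, (∀ i ∈ S, M i ⬝ᵥ y = 0) ∧ p ⬝ᵥ y = a}
      add_mem' := by
        rintro a b ⟨y, hy, rfl⟩ ⟨z, hz, rfl⟩
        exact ⟨y + z, fun i hi => by rw [dotProduct_add, hy i hi, hz i hi, add_zero],
          dotProduct_add _ _ _⟩
      zero_mem' := ⟨0, fun i _ => dotProduct_zero _, dotProduct_zero _⟩
      smul_mem' := by
        rintro c a ⟨y, hy, rfl⟩
        exact ⟨c • y, fun i hi => by rw [dotProduct_smul, hy i hi, smul_zero],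
          dotProduct_smul _ _ _⟩ } with hI
  have hIt : I = ⊤ := by
    apply ideal_top_of_monic I _ (p ⬝ᵥ x) hL ?_ ⟨x, hxS, rfl⟩
    · change φ (p ⬝ᵥ x) = 1
      rw [hp, add_dotProduct, smul_dotProduct, map_add, smul_eq_mul, map_mul,
        RingHom.map_dotProduct, RingHom.map_dotProduct, hφx, hξ j (Finset.mem_insert_self _ _),
        mul_zero, add_zero]
      exact hq'
    · rw [← hdet']
      refine ⟨fun c => (Matrix.of (Function.update M j p)).adjugate c j, ?_, ?_⟩
      · intro i hi
        have hij : i ≠ j := by rintro rfl; exact hj hi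
        have := row_dot_adjugate (Function.update M j p) i j
        rwa [Function.update_of_ne hij, if_neg hij] at this
      · have := row_dot_adjugate (Function.update M j p) j j
        rwa [Function.update_self, if_pos rfl] at this
  obtain ⟨y, hy, hpy⟩ : (1 : D[X]) ∈ I := hIt ▸ Submodule.mem_top
  exact ⟨p, _, h.insert_row j hj p y hpy hy, _, hL, hdet'⟩

theorem Frame.finish {D : Type*} [CommRing D] [IsLocalRing D] {n : ℕ} (j0 : Fin n) (k : ℕ) :
    ∀ (M W : Fin n → Fin n → D[X]) (S : Finset (Fin n)) (_ : Frame M W S) (_ : j0 ∈ S)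
    (_ : ∃ δ s : D[X], s.Monic ∧ (Matrix.of M).det * δ = s) (_ : S.card + k = n),
    ∃ M' M'' : Matrix (Fin n) (Fin n) D[X], M' * M'' = 1 ∧ M' j0 = M j0 := by
  induction k with
  | zero =>
    intro M W S h hj0 _ hc
    have : S = Finset.univ := by rw [← Finset.card_eq_iff_eq_univ]; simpa using hc
    subst this
    exact ⟨_, _, h.full, rfl⟩
  | succ k ih =>
    intro M W S h hj0 hdet hc
    obtain ⟨j, hj⟩ : ∃ j, j ∉ S := by
      by_contra hh; push Not at hh
      rw [Finset.eq_univ_iff_forall.2 hh] at hc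
      simp at hc
    have hjj : j0 ≠ j := by rintro rfl; exact hj hj0
    by_cases hS : insert j S = Finset.univ
    · have : S = Finset.univ.erase j := by rw [← hS, Finset.erase_insert hj]
      subst this
      obtain ⟨w, hw⟩ := h.complete
      refine ⟨_, _, Matrix.mul_nonsing_inv _ hw, ?_⟩
      exact Matrix.updateRow_ne hjj
    · obtain ⟨p, W', h', s, hs, hd⟩ := h.enlarge M W S j hj hS hdet
      obtain ⟨M', M'', h1, h2⟩ := ih _ W' (insert j S) h' (Finset.mem_insert_of_mem hj0)
        ⟨1, s, hs, by rw [hd, mul_one]⟩ (by rw [Finset.card_insert_of_notMem hj]; omega)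
      exact ⟨M', M'', h1, by rw [h2, Function.update_of_ne hjj]⟩

/-- Horrocks' theorem for unimodular rows over a local ring. -/
theorem local_horrocks {D : Type*} [CommRing D] [IsLocalRing D] {N : ℕ} (v : Fin (N + 1) → D[X])
    (hv : UMod v) (L : Type*) [CommRing L] [Algebra D[X] L] [IsLocalization (monics D) L]
    (h : Isot (algebraMap D[X] L ∘ v) (stdRow L N)) :
    ∃ M M' : Matrix (Fin (N + 1)) (Fin (N + 1)) D[X], M * M' = 1 ∧
      Matrix.vecMul v M = stdRow D[X] N := by
  classical
  obtain ⟨G, G', hG, hvG⟩ := h.gl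
  have hG' : G' * G = 1 := mul_eq_one_comm.1 hG
  have hrow : G' 0 = algebraMap D[X] L ∘ v := by
    have : Matrix.vecMul (Matrix.vecMul (algebraMap D[X] L ∘ v) G) G' = algebraMap D[X] L ∘ v := by
      rw [Matrix.vecMul_vecMul, hG, Matrix.vecMul_one]
    rw [← this, hvG, stdRow, Matrix.single_one_vecMul]
    rfl
  obtain ⟨s, hs⟩ := IsLocalization.exist_integer_multiples_of_finite (monics D)
    (fun p : Fin (N+1) × Fin (N+1) => G' p.1 p.2)
  choose a ha using hs
  set M : Fin (N+1) → Fin (N+1) → D[X] := fun i => if i = 0 then v else fun c => a (i, c) with hM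
  have hMG : (algebraMap D[X] L).mapMatrix (Matrix.of M) =
      Matrix.diagonal (fun i => if i = 0 then 1 else algebraMap D[X] L s) * G' := by
    ext i c
    rw [Matrix.diagonal_mul]
    by_cases hi : i = 0
    · subst hi
      simp [hM, hrow]
    · simp [hM, hi, ha, Algebra.smul_def]
  have hunit : IsUnit (algebraMap D[X] L (Matrix.of M).det) := by
    rw [RingHom.map_det, hMG, Matrix.det_mul, Matrix.det_diagonal]
    apply IsUnit.mul
    · rw [IsUnit.prod_univ_iff]
      intro i
      split_ifs
      · exact isUnit_one
      · exact IsLocalization.map_units L s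
    · exact Matrix.isUnit_iff_isUnit_det _ |>.1 (IsUnit.of_mul_eq_one _ hG')
  have hdet : ∃ δ s : D[X], s.Monic ∧ (Matrix.of M).det * δ = s := by
    obtain ⟨u, hu⟩ := hunit.exists_right_inv
    obtain ⟨⟨b, t⟩, hb⟩ := IsLocalization.surj (monics D) u
    simp only at hb
    have : algebraMap D[X] L ((Matrix.of M).det * b) = algebraMap D[X] L t := by
      rw [map_mul, ← hb, ← mul_assoc, hu, one_mul]
    obtain ⟨c, hc⟩ := (IsLocalization.eq_iff_exists (monics D) L).1 this
    exact ⟨c * b, c * t, Monic.mul c.2 t.2, by rw [← hc]; ring⟩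
  obtain ⟨w, hw⟩ := hv
  obtain ⟨M', M'', h1, h2⟩ := Frame.finish (0 : Fin (N+1)) N M (fun _ => w) {0}
    (by
      intro i hi j hj
      rw [Finset.mem_singleton] at hi hj
      subst hi; subst hj; simpa [hM] using hw) (by simp) hdet (by simp; omega)
  refine ⟨M'', M', mul_eq_one_comm.1 h1, ?_⟩
  have : v = Matrix.vecMul (stdRow D[X] N) M' := by
    rw [stdRow, Matrix.single_one_vecMul]
    change v = M' 0
    rw [h2]; simp [hM]
  rw [this, Matrix.vecMul_vecMul, h1, Matrix.vecMul_one]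


/-- `p(X) ↦ p(X + cY)` -/
noncomputable def shiftHom {D : Type*} [CommRing D] (c : D) : D[X] →+* D[X][X] :=
  eval₂RingHom ((C : D[X] →+* D[X][X]).comp C) (C X + C (C c) * X)

section vas
variable {D : Type*} [CommRing D] {n : ℕ}

@[simp] theorem shiftHom_C (c a : D) : shiftHom c (C a) = C (C a) := by simp [shiftHom]
@[simp] theorem shiftHom_X (c : D) : shiftHom c X = C X + C (C c) * X := by simp [shiftHom]

theorem shiftHom_zero : shiftHom (0 : D) = C := by
  ext <;> simp

theorem compRingHom_C' {B : Type*} [CommRing B] (p : B[X]) : (compRingHom p).comp C = C := by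
  ext; simp

theorem shiftHom_smul (a c : D) :
    (compRingHom (C (C a) * X : D[X][X])).comp (shiftHom c) = shiftHom (a * c) := by
  refine Polynomial.ringHom_ext (fun b => by simp) ?_
  simp; ring

theorem eval_shiftHom (c : D) : (evalRingHom (0 : D[X])).comp (shiftHom c) = RingHom.id _ := by
  ext <;> simp

/-- substitution `X ↦ X + cY`, `Y ↦ Y` -/
noncomputable def shift2 (c : D) : D[X][X] →+* D[X][X] := eval₂RingHom (shiftHom c) X

theorem shift2_C (c : D) : (shift2 c).comp C = shiftHom c := by
  apply RingHom.ext; intro p; simp [shift2]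

theorem shift2_shift (c c' : D) : (shift2 c).comp (shiftHom c') = shiftHom (c + c') := by
  refine Polynomial.ringHom_ext (fun b => by simp [shift2]) ?_
  simp [shift2]; ring

theorem eval_shift2 (c : D) :
    (evalRingHom (0 : D[X])).comp (shift2 c) = evalRingHom (0 : D[X]) := by
  ext <;> simp [shift2]

theorem mapMatrix_comp_apply {A B C : Type*} [CommRing A] [CommRing B] [CommRing C] (g : B →+* C)
    (f : A →+* B) (M : Matrix (Fin n) (Fin n) A) :
    g.mapMatrix (f.mapMatrix M) = (g.comp f).mapMatrix M := by
  ext; simp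

/-- the ideal in Vaserstein's argument -/
def vasIdeal (v : Fin n → D[X]) : Ideal D where
  carrier := {c | ∃ G G' : Matrix (Fin n) (Fin n) D[X][X], G * G' = 1 ∧
    (evalRingHom 0).mapMatrix G = 1 ∧ Matrix.vecMul ((C : D[X] →+* D[X][X]) ∘ v) G = shiftHom c ∘ v}
  add_mem' := by
    rintro c c' ⟨G, G', h, h0, hv⟩ ⟨H, H', k, k0, kv⟩
    refine ⟨G * (shift2 c).mapMatrix H, (shift2 c).mapMatrix H' * G', ?_, ?_, ?_⟩
    · rw [mul_assoc, ← mul_assoc _ _ G', ← map_mul, k, map_one, one_mul, h]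
    · rw [map_mul, h0, mapMatrix_comp_apply, eval_shift2, k0, one_mul]
    · rw [← Matrix.vecMul_vecMul, hv]
      have := congrArg (fun w => shift2 c ∘ w) kv
      simp only [map_vecMul'] at this
      rw [← Function.comp_assoc, ← Function.comp_assoc, ← RingHom.coe_comp, ← RingHom.coe_comp,
        shift2_C, shift2_shift] at this
      exact this
  zero_mem' := ⟨1, 1, by simp, by simp, by simp [shiftHom_zero]⟩
  smul_mem' := by
    rintro a c ⟨G, G', h, h0, hv⟩
    refine ⟨(compRingHom (C (C a) * X)).mapMatrix G, (compRingHom (C (C a) * X)).mapMatrix G',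
      ?_, ?_, ?_⟩
    · rw [← map_mul, h, map_one]
    · rw [← h0]; ext i j; simp
    · have := congrArg (fun w => compRingHom (C (C a) * X : D[X][X]) ∘ w) hv
      simp only [map_vecMul'] at this
      rw [← Function.comp_assoc, ← Function.comp_assoc, ← RingHom.coe_comp, ← RingHom.coe_comp,
        compRingHom_C', shiftHom_smul] at this
      exact this

theorem locLike_poly {A : Type*} [CommRing A] [Algebra D A] (S : Submonoid D) [IsLocalization S A] :
    LocLike (mapRingHom (algebraMap D A)) (S.map (C : D →+* D[X])) := by
  let _ := Polynomial.algebra D A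
  have := Polynomial.isLocalization S A
  exact LocLike.of_isLocalization (B := D[X]) (B' := A[X]) (S.map C)

theorem shiftHom_map {A : Type*} [CommRing A] (φ : D →+* A) (c : D) :
    (mapRingHom (mapRingHom φ)).comp (shiftHom c) = (shiftHom (φ c)).comp (mapRingHom φ) := by
  ext <;> simp

theorem vas_local (v : Fin n → D[X]) (S : Submonoid D) (A : Type*) [CommRing A] [Algebra D A]
    [IsLocalization S A] (M M' : Matrix (Fin n) (Fin n) A[X]) (hM : M * M' = 1) (c : Fin n → A)
    (h : Matrix.vecMul (mapRingHom (algebraMap D A) ∘ v) M = (C : A →+* A[X]) ∘ c) :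
    ∃ s ∈ S, s ∈ vasIdeal v := by
  set φ := algebraMap D A with hφ
  set v' := mapRingHom φ ∘ v with hv'
  have hM' : M' * M = 1 := mul_eq_one_comm.1 hM
  set Γ := (C : A[X] →+* A[X][X]).mapMatrix M * (shiftHom (1 : A)).mapMatrix M' with hΓ
  have hvM : v' = Matrix.vecMul ((C : A →+* A[X]) ∘ c) M' := by
    rw [← h, Matrix.vecMul_vecMul, hM, Matrix.vecMul_one]
  have hvΓ : Matrix.vecMul ((C : A[X] →+* A[X][X]) ∘ v') Γ = shiftHom (1 : A) ∘ v' := by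
    rw [hΓ, ← Matrix.vecMul_vecMul, ← map_vecMul', h, hvM, map_vecMul']
    congr 1
    ext1 i; simp
  obtain ⟨_, ⟨s, hs, rfl⟩, L, L', hL, hL0, hLΓ⟩ := (locLike_poly (A := A) S).lift_path Γ
    ((shiftHom (1 : A)).mapMatrix M * (C : A[X] →+* A[X][X]).mapMatrix M') (by
      rw [hΓ, mul_assoc, ← mul_assoc _ _ ((C : A[X] →+* A[X][X]).mapMatrix M'), ← map_mul, hM',
        map_one, one_mul, ← map_mul, hM, map_one]) (by
      rw [hΓ, map_mul, mapMatrix_comp_apply, mapMatrix_comp_apply, eval_shiftHom]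
      have : (evalRingHom (0 : A[X])).comp C = RingHom.id _ := by ext <;> simp
      rw [this, ← map_mul, hM, map_one])
  have key : mapRingHom (mapRingHom φ) ∘ Matrix.vecMul ((C : D[X] →+* D[X][X]) ∘ v) L =
      mapRingHom (mapRingHom φ) ∘ shiftHom s ∘ v := by
    rw [map_vecMul', hLΓ, ← Function.comp_assoc, ← Function.comp_assoc, ← RingHom.coe_comp,
      ← RingHom.coe_comp, shiftHom_map]
    have e1 : (mapRingHom (mapRingHom φ)).comp (C : D[X] →+* D[X][X]) = C.comp (mapRingHom φ) := by
      ext <;> simp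
    have := congrArg (fun w => compRingHom (C ((mapRingHom φ) (C s)) * X : A[X][X]) ∘ w) hvΓ
    simp only [map_vecMul'] at this
    rw [← Function.comp_assoc, ← RingHom.coe_comp, compRingHom_C'] at this
    have e2 : (mapRingHom φ) (C s) = C (φ s) := by simp
    have e3 : compRingHom (C (C (φ s)) * X : A[X][X]) ∘ shiftHom (1 : A) ∘ v' =
        shiftHom (φ s) ∘ v' := by
      ext1 i
      have := RingHom.congr_fun (shiftHom_smul (φ s) 1) (v' i)
      rwa [mul_one] at this
    rw [e2, e3] at this
    rw [e1, ← hφ, e2, RingHom.coe_comp (shiftHom (φ s)), Function.comp_assoc (shiftHom (φ s)), ← hv']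
    exact this
  obtain ⟨_, ⟨t, ht, rfl⟩, hk⟩ := (locLike_poly (A := A) S).kill_vec
    (fun i => Matrix.vecMul ((C : D[X] →+* D[X][X]) ∘ v) L i - shiftHom s (v i)) (by
      intro i
      rw [Polynomial.map_sub, sub_eq_zero]
      exact congrFun key i) (by
      intro i
      have e : (evalRingHom (0 : D[X])) ∘ Matrix.vecMul ((C : D[X] →+* D[X][X]) ∘ v) L = v := by
        rw [map_vecMul', hL0, Matrix.vecMul_one]
        ext1 i; simp
      have e := congrFun e i
      have e' := RingHom.congr_fun (eval_shiftHom s) (v i)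
      simp only [RingHom.comp_apply, Function.comp, coe_evalRingHom, RingHom.id_apply] at e e'
      rw [coeff_sub, coeff_zero_eq_eval_zero, coeff_zero_eq_eval_zero]
      rw [sub_eq_zero, e', ← e])
  refine ⟨t * s, S.mul_mem ht hs, (compRingHom (C (C t) * X)).mapMatrix L,
    (compRingHom (C (C t) * X)).mapMatrix L', ?_, ?_, ?_⟩
  · rw [← map_mul, hL, map_one]
  · rw [← hL0]; ext i j; simp
  · rw [← shiftHom_smul, RingHom.coe_comp, Function.comp_assoc]
    ext1 i
    have := hk i
    rw [sub_comp, sub_eq_zero] at this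
    change _ = (shiftHom s (v i)).comp _
    rw [← this]
    have e := congrFun (map_vecMul' (compRingHom (C (C t) * X : D[X][X]))
      ((C : D[X] →+* D[X][X]) ∘ v) L) i
    rw [← Function.comp_assoc, ← RingHom.coe_comp, compRingHom_C'] at e
    exact e.symm

/-- Local-global principle of Vaserstein. -/
theorem vaserstein (v : Fin n → D[X])
    (hloc : ∀ (m : Ideal D) [m.IsMaximal], ∃ M M' : Matrix (Fin n) (Fin n) (Localization.AtPrime m)[X],
      M * M' = 1 ∧ ∃ c : Fin n → Localization.AtPrime m,
        Matrix.vecMul (mapRingHom (algebraMap D (Localization.AtPrime m)) ∘ v) M =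
          (C : _ →+* (Localization.AtPrime m)[X]) ∘ c) :
    Isot v (fun i => C ((v i).eval 0)) := by
  have h1 : vasIdeal v = ⊤ := by
    by_contra h
    obtain ⟨m, hm, hle⟩ := Ideal.exists_le_maximal _ h
    obtain ⟨M, M', hM, c, hc⟩ := hloc m
    obtain ⟨s, hs, hsv⟩ := vas_local v m.primeCompl (Localization.AtPrime m) M M' hM c hc
    exact hs (hle hsv)
  obtain ⟨G, G', hG, hG0, hv⟩ : (1 : D) ∈ vasIdeal v := h1 ▸ Submodule.mem_top
  apply Isot.symm
  -- substitute `X ↦ 0`, `Y ↦ X Y`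
  set θ : D[X][X] →+* D[X][X] :=
    (eval₂RingHom ((C : D[X] →+* D[X][X]).comp C) (C X * X : D[X][X])).comp
      (mapRingHom (evalRingHom (0 : D))) with hθ
  refine ⟨θ.mapMatrix G, θ.mapMatrix G', ?_, ?_, ?_⟩
  · rw [← map_mul, hG, map_one]
  · have e : (evalRingHom (0 : D[X])).comp θ = (C.comp (evalRingHom 0)).comp (evalRingHom 0) := by
      ext <;> simp [hθ]
    rw [mapMatrix_comp_apply, e, ← mapMatrix_comp_apply, hG0, map_one]
  · have := congrArg (fun w => ((evalRingHom (1 : D[X])).comp θ) ∘ w) hv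
    simp only [map_vecMul', ← mapMatrix_comp_apply] at this
    rw [← Function.comp_assoc, ← Function.comp_assoc, ← RingHom.coe_comp, ← RingHom.coe_comp] at this
    have e1 : ((evalRingHom (1 : D[X])).comp θ).comp C = C.comp (evalRingHom 0) := by
      ext <;> simp [hθ]
    have e2 : ((evalRingHom (1 : D[X])).comp θ).comp (shiftHom 1) = RingHom.id _ := by
      ext <;> simp [hθ]
    rw [e1, e2] at this
    exact this

end vas


/-- localization of `D_m[X]` at monics -/
abbrev LocMon (D : Type*) [CommRing D] : Type _ := Localization (monics D)

noncomputable def toLocMon {D D' : Type*} [CommRing D] [CommRing D'] (φ : D →+* D') :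
    D[X] →+* LocMon D' := (algebraMap D'[X] (LocMon D')).comp (mapRingHom φ)

theorem toLocMon_isUnit {D D' : Type*} [CommRing D] [CommRing D'] (φ : D →+* D') (p : D[X])
    (hp : p.Monic) : IsUnit (toLocMon φ p) :=
  IsLocalization.map_units (M := monics D') (LocMon D') ⟨p.map φ, hp.map φ⟩

theorem horrocks_const {D : Type*} [CommRing D] {N : ℕ} (w : Fin (N + 1) → D[X]) (hw : UMod w)
    (h : ∀ (m : Ideal D) [m.IsMaximal],
      Isot (toLocMon (algebraMap D (Localization.AtPrime m)) ∘ w)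
        (stdRow (LocMon (Localization.AtPrime m)) N)) :
    Isot w (fun i => C ((w i).eval 0)) := by
  apply vaserstein
  intro m hm
  obtain ⟨M, M', hM, hv⟩ := local_horrocks
    (mapRingHom (algebraMap D (Localization.AtPrime m)) ∘ w) (hw.map _)
    (LocMon (Localization.AtPrime m)) (h m)
  refine ⟨M, M', hM, stdRow _ N, ?_⟩
  rw [hv, stdRow_map]

theorem isot_of_local {D : Type*} [CommRing D] [IsLocalRing D] {N : ℕ} (hN : 1 ≤ N)
    (u : Fin (N + 1) → D) (hu : UMod u) : Isot u (stdRow D N) := by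
  obtain ⟨w, hw⟩ := hu
  have : ∃ i, IsUnit (u i) := by
    by_contra h
    push Not at h
    have h1 : (1 : D) ∈ IsLocalRing.maximalIdeal D := by
      rw [← hw]
      apply Ideal.sum_mem
      intro i _
      exact Ideal.mul_mem_right _ _ ((IsLocalRing.mem_maximalIdeal _).2 (h i))
    exact (IsLocalRing.maximalIdeal.isMaximal D).ne_top ((Ideal.eq_top_iff_one _).2 h1)
  obtain ⟨i, hi⟩ := this
  obtain ⟨b, hb⟩ := hi.exists_left_inv
  have : Nontrivial (Fin (N + 1)) := by
    obtain ⟨k, rfl⟩ : ∃ k, N = k + 1 := ⟨N - 1, by omega⟩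
    infer_instance
  obtain ⟨j, hj⟩ := exists_ne i
  refine Isot.of_comb u j (Pi.single i b) ?_ ?_
  · simp [hj]
  · simpa using hb

/-- polynomials with constant coefficient one -/
def constOne (D : Type*) [CommRing D] : Submonoid D[X] where
  carrier := {p | p.eval 0 = 1}
  one_mem' := by simp
  mul_mem' := by
    intro a b ha hb
    simp only [Set.mem_ofPred_eq] at *
    rw [eval_mul, ha, hb, one_mul]

theorem horrocks_base {D : Type*} [CommRing D] {N : ℕ} (hN : 1 ≤ N) (u : Fin (N + 1) → D)
    (hu : UMod u) (h : Isot (toLocMon (RingHom.id D) ∘ (C : D →+* D[X]) ∘ u) (stdRow (LocMon D) N)) :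
    Isot u (stdRow D N) := by
  set U1 : Submonoid D[X] := Submonoid.powers X with hU1
  set U2 := constOne D with hU2
  set A1 := Localization U1
  set A2 := Localization U2
  set A12 := Localization (U1 ⊔ U2)
  have un1 : ∀ y : U1, IsUnit (algebraMap D[X] A12 y) := fun y =>
    IsLocalization.map_units (M := U1 ⊔ U2) A12 ⟨y, Submonoid.mem_sup_left y.2⟩
  have un2 : ∀ y : U2, IsUnit (algebraMap D[X] A12 y) := fun y =>
    IsLocalization.map_units (M := U1 ⊔ U2) A12 ⟨y, Submonoid.mem_sup_right y.2⟩
  set j1 : A1 →+* A12 := IsLocalization.lift un1 with hj1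
  set j2 : A2 →+* A12 := IsLocalization.lift un2 with hj2
  have hco : ∀ a ∈ U1, ∀ b ∈ U2, IsCoprime a b := by
    rintro a ⟨k, rfl⟩ b hb
    apply IsCoprime.pow_left
    have hb : b.eval 0 = 1 := hb
    refine ⟨- b.divX, 1, ?_⟩
    have := divX_mul_X_add b
    rw [coeff_zero_eq_eval_zero, hb, map_one] at this
    linear_combination (-1 : D[X]) * this
  -- the map from `LocMon D`
  have unX : IsUnit (algebraMap D[X] A12 X) := un1 ⟨X, Submonoid.mem_powers _⟩
  obtain ⟨z, hz⟩ := unX.exists_right_inv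
  let inv : Invertible z := ⟨algebraMap D[X] A12 X, hz, by rw [mul_comm]; exact hz⟩
  set h0 : D[X] →+* A12 := eval₂RingHom ((algebraMap D[X] A12).comp C) z with hh0
  have hunit : ∀ y : monics D, IsUnit (h0 y) := by
    rintro ⟨g, hg⟩
    have e := eval₂_reverse_mul_pow ((algebraMap D[X] A12).comp C) z g
    change IsUnit (eval₂ _ z g)
    rw [← e]
    apply IsUnit.mul
    · have : eval₂ ((algebraMap D[X] A12).comp C) (⅟z) (reverse g) = algebraMap D[X] A12 (reverse g) := by
        change eval₂ ((algebraMap D[X] A12).comp C) (algebraMap D[X] A12 X) (reverse g) = _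
        rw [← hom_eval₂, eval₂_C_X]
      rw [this]
      refine un2 ⟨_, ?_⟩
      change eval 0 (reverse g) = 1
      rw [← coeff_zero_eq_eval_zero, coeff_zero_reverse]
      exact hg
    · exact (isUnit_of_invertible z).pow _
  set ψ : LocMon D →+* A12 := IsLocalization.lift hunit with hψ
  have hψu : ψ ∘ toLocMon (RingHom.id D) ∘ (C : D →+* D[X]) ∘ u =
      j1 ∘ algebraMap D[X] A1 ∘ C ∘ u := by
    ext1 i
    simp only [Function.comp, toLocMon, RingHom.comp_apply, hψ, hj1, IsLocalization.lift_eq]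
    simp [hh0]
  have hI : Isot (j1 ∘ algebraMap D[X] A1 ∘ C ∘ u) (j2 ∘ stdRow A2 N) := by
    rw [← hψu, stdRow_map, ← stdRow_map ψ]
    exact h.map ψ
  obtain ⟨w, hw, hw1, hw2⟩ := glue_rows j1 j2 (IsLocalization.lift_comp _)
    (IsLocalization.lift_comp _) U1 U2 hco (algebraMap D[X] A1 ∘ C ∘ u) (stdRow A2 N)
    ((hu.map C).map _) (UMod.std _ _) hI
  -- evaluations
  have ev0 : ∀ y : U2, IsUnit (evalRingHom (0 : D) (y : D[X])) := by
    rintro ⟨y, hy⟩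
    have hy : y.eval 0 = 1 := hy
    simp [hy]
  have ev1 : ∀ y : U1, IsUnit (evalRingHom (1 : D) (y : D[X])) := by
    rintro ⟨_, k, rfl⟩
    simp
  have c0 : Isot (stdRow D N) (fun i => (w i).eval 0) := by
    have := hw2.map (IsLocalization.lift ev0 : A2 →+* D)
    rw [stdRow_map] at this
    convert this using 1
    ext1 i
    simp only [Function.comp, IsLocalization.lift_eq, coe_evalRingHom]
  have c1 : Isot u (fun i => (w i).eval 1) := by
    have := hw1.map (IsLocalization.lift ev1 : A1 →+* D)
    convert this using 1
    · ext1 i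
      simp only [Function.comp, IsLocalization.lift_eq, coe_evalRingHom, eval_C]
    · ext1 i
      simp only [Function.comp, IsLocalization.lift_eq, coe_evalRingHom]
  have c2 : Isot w (fun i => C ((w i).eval 0)) := by
    apply horrocks_const w hw
    intro m hm
    set φ := algebraMap D (Localization.AtPrime m)
    have unm : ∀ y : U1, IsUnit (toLocMon φ y) := by
      rintro ⟨_, k, rfl⟩
      exact toLocMon_isUnit φ _ (monic_X_pow k)
    have d1 := hw1.map (IsLocalization.lift unm : A1 →+* _)
    have d2 := (isot_of_local hN (φ ∘ u) (hu.map φ)).map ((toLocMon (RingHom.id _)).comp C)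
    rw [stdRow_map] at d2
    have e1 : (IsLocalization.lift unm : A1 →+* _) ∘ algebraMap D[X] A1 ∘ w = toLocMon φ ∘ w := by
      ext1 i
      simp only [Function.comp, IsLocalization.lift_eq]
    have e2 : (IsLocalization.lift unm : A1 →+* _) ∘ algebraMap D[X] A1 ∘ C ∘ u =
        ((toLocMon (RingHom.id _)).comp C) ∘ φ ∘ u := by
      ext1 i
      simp only [Function.comp, IsLocalization.lift_eq, toLocMon, RingHom.comp_apply]
      simp
    rw [e1, e2] at d1
    exact d1.symm.trans d2
  have c3 := c2.map (evalRingHom (1 : D))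
  have e3 : evalRingHom (1 : D) ∘ (fun i => C ((w i).eval 0)) = fun i => (w i).eval 0 := by
    ext1 i; simp
  rw [e3] at c3
  exact c1.trans (c3.trans c0.symm)

/-- monic polynomials congruent to one modulo `f` -/
def monCong {D : Type*} [CommRing D] (f : D[X]) : Submonoid D[X] where
  carrier := {h | h.Monic ∧ f ∣ h - 1}
  one_mem' := ⟨monic_one, by simp⟩
  mul_mem' := by
    rintro a b ⟨ha, ha'⟩ ⟨hb, hb'⟩
    refine ⟨ha.mul hb, ?_⟩
    have : a * b - 1 = (a - 1) * b + (b - 1) := by ring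
    rw [this]
    exact dvd_add (Dvd.dvd.mul_right ha' b) hb'

/-- Horrocks' theorem, global form. -/
theorem horrocks_global {D : Type*} [CommRing D] {N : ℕ} (hN : 1 ≤ N) (f : D[X])
    (A1 : Type*) [CommRing A1] [Algebra D[X] A1] [IsLocalization (Submonoid.powers f) A1]
    (L : Type*) [CommRing L] [Algebra D[X] L] [IsLocalization (Submonoid.powers f ⊔ monCong f) L]
    (j : A1 →+* L) (hj : j.comp (algebraMap D[X] A1) = algebraMap D[X] L)
    (v : Fin (N + 1) → A1) (hv : UMod v) (h : Isot (j ∘ v) (stdRow L N)) :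
    Isot v (stdRow A1 N) := by
  set U1 : Submonoid D[X] := Submonoid.powers f with hU1
  set U2 := monCong f with hU2
  set A2 := Localization U2
  have un2 : ∀ y : U2, IsUnit (algebraMap D[X] L y) := fun y =>
    IsLocalization.map_units (M := U1 ⊔ U2) L ⟨y, Submonoid.mem_sup_right y.2⟩
  set j2 : A2 →+* L := IsLocalization.lift un2 with hj2
  have hco : ∀ a ∈ U1, ∀ b ∈ U2, IsCoprime a b := by
    rintro a ⟨k, rfl⟩ b hb
    apply IsCoprime.pow_left
    obtain ⟨-, c, hc⟩ := hb
    exact ⟨-c, 1, by linear_combination hc⟩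
  obtain ⟨w, hw, hw1, hw2⟩ := glue_rows j j2 hj (IsLocalization.lift_comp _) U1 U2 hco v
    (stdRow A2 N) hv (UMod.std _ _) (by rw [stdRow_map]; exact h)
  have hm : ∀ {D' : Type _} [CommRing D'] (φ : D →+* D'),
      Isot (toLocMon φ ∘ w) (stdRow (LocMon D') N) := by
    intro D' _ φ
    have un : ∀ y : U2, IsUnit (toLocMon φ y) := fun y => toLocMon_isUnit φ _ y.2.1
    have := hw2.map (IsLocalization.lift un : A2 →+* _)
    rw [stdRow_map] at this
    convert this.symm using 1
    ext1 i
    simp only [Function.comp, IsLocalization.lift_eq]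
  have c := horrocks_const w hw (fun m _ => hm _)
  have c1 := (c.map (toLocMon (RingHom.id D))).symm.trans (hm (RingHom.id D))
  have c2 := horrocks_base hN (fun i => (w i).eval 0) (hw.map (evalRingHom (0 : D))) c1
  have c3 := c2.map (C : D →+* D[X])
  rw [stdRow_map] at c3
  have c4 := (c.trans c3).map (algebraMap D[X] A1)
  rw [stdRow_map] at c4
  exact hw1.trans c4


/-- `HT n P`: `P` is the top of a chain of primes of length `n`. -/
def HT {R : Type*} [CommRing R] : ℕ → Ideal R → Prop
  | 0, P => P.IsPrime
  | n + 1, P => P.IsPrime ∧ ∃ Q, Q < P ∧ HT n Q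

theorem HT.isPrime {R : Type*} [CommRing R] {n : ℕ} {P : Ideal R} (h : HT n P) : P.IsPrime := by
  cases n with
  | zero => exact h
  | succ n => exact h.1

theorem HT.transfer {R S : Type*} [CommRing R] [CommRing S] (Φ : Ideal R → Ideal S)
    (good : Ideal R → Prop) (hgood : ∀ P Q, Q ≤ P → good P → good Q)
    (hprime : ∀ P, good P → P.IsPrime → (Φ P).IsPrime)
    (hlt : ∀ P Q, good P → P.IsPrime → Q.IsPrime → Q < P → Φ Q < Φ P) :
    ∀ (n : ℕ) (P : Ideal R), good P → HT n P → HT n (Φ P) := by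
  intro n
  induction n with
  | zero => exact fun P hP h => hprime P hP h
  | succ n ih =>
    rintro P hP ⟨hp, Q, hQP, hQ⟩
    exact ⟨hprime P hP hp, Φ Q, hlt P Q hP hp hQ.isPrime hQP, ih Q (hgood P Q hQP.le hP) hQ⟩

theorem HT.comap_surj {R S : Type*} [CommRing R] [CommRing S] (φ : R →+* S)
    (hφ : Function.Surjective φ) {n : ℕ} {P : Ideal S} (h : HT n P) : HT n (P.comap φ) := by
  refine HT.transfer (fun P => P.comap φ) (fun _ => True) (fun _ _ _ _ => trivial)
    (fun P _ hP => Ideal.comap_isPrime φ P) (fun P Q _ _ _ h => ?_) n P trivial h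
  exact lt_of_le_of_ne (Ideal.comap_mono h.le)
    (fun e => h.ne (Ideal.comap_injective_of_surjective φ hφ e))

theorem HT.extend {R S : Type*} [CommRing R] [CommRing S] (φ : R →+* S)
    (hφ : Function.Surjective φ)
    (h0 : ∀ P : Ideal S, P.IsPrime → ∃ q < P.comap φ, q.IsPrime) :
    ∀ {n : ℕ} {P : Ideal S}, HT n P → HT (n + 1) (P.comap φ) := by
  intro n
  induction n with
  | zero =>
    intro P h
    obtain ⟨q, hq, hq'⟩ := h0 P h
    have hP : P.IsPrime := h
    exact ⟨Ideal.comap_isPrime φ P, q, hq, hq'⟩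
  | succ n ih =>
    rintro P ⟨hP, Q, hQP, hQ⟩
    exact ⟨Ideal.comap_isPrime φ P, Q.comap φ, lt_of_le_of_ne (Ideal.comap_mono hQP.le)
      (fun e => hQP.ne (Ideal.comap_injective_of_surjective φ hφ e)), ih hQ⟩

/-- the boundary ideal -/
def bdry {R : Type*} [CommRing R] (a : R) : Ideal R :=
  Ideal.span {a} ⊔ Submodule.comap (LinearMap.mulLeft R a) (nilradical R)

theorem mem_bdry {R : Type*} [CommRing R] (a y : R) :
    y ∈ bdry a ↔ ∃ c z, IsNilpotent (a * z) ∧ y = c * a + z := by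
  rw [bdry, Submodule.mem_sup]
  constructor
  · rintro ⟨u, hu, z, hz, rfl⟩
    obtain ⟨c, rfl⟩ := Ideal.mem_span_singleton'.1 hu
    exact ⟨c, z, mem_nilradical.1 hz, rfl⟩
  · rintro ⟨c, z, hz, rfl⟩
    exact ⟨c * a, Ideal.mem_span_singleton'.2 ⟨c, rfl⟩, z, mem_nilradical.2 hz, rfl⟩

theorem bdry_lt {R : Type*} [CommRing R] (a : R) (Q : Ideal R) (hQ : Q.IsPrime) (h : bdry a ≤ Q) :
    ∃ q < Q, q.IsPrime := by
  have hdisj : Disjoint ((⊥ : Ideal R) : Set R) (Q.primeCompl ⊔ Submonoid.powers a : Submonoid R) := by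
    rw [Set.disjoint_left]
    rintro x hx hx'
    have hx : x = 0 := hx
    subst hx
    obtain ⟨s, hs, _, ⟨k, rfl⟩, hsk⟩ := Submonoid.mem_sup.1 hx'
    apply hs
    apply h
    rw [mem_bdry]
    refine ⟨0, s, ⟨k + 1, ?_⟩, by simp⟩
    have : (a * s) ^ (k + 1) = (s * a ^ k) * (a * s ^ k) := by ring
    rw [this, hsk, zero_mul]
  obtain ⟨q, hq, -, hd⟩ := Ideal.exists_le_prime_disjoint _ _ hdisj
  rw [Set.disjoint_left] at hd
  have hle : q ≤ Q := by
    intro s hs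
    by_contra hsQ
    exact hd hs (Submonoid.mem_sup_left hsQ)
  have ha : a ∉ q := fun haq => hd haq (Submonoid.mem_sup_right (Submonoid.mem_powers a))
  have haQ : a ∈ Q := h ((mem_bdry a a).2 ⟨1, 0, by simp, by simp⟩)
  exact ⟨q, lt_of_le_of_ne hle (fun e => ha (e ▸ haQ)), hq⟩

theorem bass_prime (k : ℕ) : ∀ (R : Type*) [CommRing R] (_ : ∀ P : Ideal R, ¬ HT k P)
    (a : Fin k → R) (b : R), ∃ x : Fin k → R, ∀ P : Ideal R, P.IsPrime →
      (∀ i, a i + b * x i ∈ P) → b ∈ P := by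
  induction k with
  | zero => exact fun R _ h a b => ⟨a, fun P hP _ => (h P hP).elim⟩
  | succ k ih =>
    intro R _ h a b
    set φ := Ideal.Quotient.mk (bdry (a 0)) with hφ
    have hs : Function.Surjective φ := Ideal.Quotient.mk_surjective
    obtain ⟨x', hx'⟩ := ih (R ⧸ bdry (a 0)) (fun P hP => by
      refine h _ (HT.extend φ hs (fun P hP => ?_) hP)
      refine bdry_lt (a 0) _ (Ideal.comap_isPrime φ P) ?_
      intro y hy
      rw [Ideal.mem_comap, hφ, Ideal.Quotient.eq_zero_iff_mem.2 hy]
      exact P.zero_mem) (fun i => φ (a i.succ)) (φ b)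
    obtain ⟨x, rfl⟩ := hs.comp_left x'
    have hrad : b ∈ (Ideal.span (Set.range fun i => a i.succ + b * x i) ⊔ bdry (a 0)).radical := by
      rw [Ideal.radical_eq_sInf, Submodule.mem_sInf]
      rintro P ⟨hle, hP⟩
      have hker : RingHom.ker φ ≤ P := by
        rw [hφ, Ideal.mk_ker]; exact le_sup_right.trans hle
      have hP' := Ideal.map_isPrime_of_surjective hs hker
      have e : Ideal.comap φ (Ideal.map φ P) = P := by
        rw [Ideal.comap_map_of_surjective' φ hs]
        exact sup_eq_left.2 hker
      have := hx' (Ideal.map φ P) hP' (fun i => by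
        have : a i.succ + b * x i ∈ P :=
          hle (Ideal.mem_sup_left (Ideal.subset_span ⟨i, rfl⟩))
        have := Ideal.mem_map_of_mem φ this
        rwa [map_add, map_mul] at this)
      rw [← Ideal.mem_comap, e] at this
      exact this
    obtain ⟨e, he⟩ := hrad
    obtain ⟨y, hy, t, ht, hyt⟩ := Submodule.mem_sup.1 he
    obtain ⟨c, z, hz, rfl⟩ := (mem_bdry _ _).1 ht
    refine ⟨Fin.cons z x, fun P hP hmem => ?_⟩
    have h0 := hmem 0
    rw [Fin.cons_zero] at h0
    have hyP : y ∈ P := by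
      refine Ideal.span_le.2 ?_ hy
      rintro _ ⟨i, rfl⟩
      have := hmem i.succ
      rwa [Fin.cons_succ] at this
    have hzP : a 0 * z ∈ P := by
      obtain ⟨k, hk⟩ := hz
      exact hP.mem_of_pow_mem k (hk ▸ P.zero_mem)
    by_contra hb
    have hz' : z ∈ P := by
      rcases hP.mem_or_mem hzP with h1 | h1
      · have : b * z ∈ P := (P.add_mem_iff_right h1).1 h0
        exact (hP.mem_or_mem this).resolve_left hb
      · exact h1
    have ha' : a 0 ∈ P := (P.add_mem_iff_left (P.mul_mem_left b hz')).1 h0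
    apply hb
    refine hP.mem_of_pow_mem e ?_
    rw [← hyt]
    exact P.add_mem hyP (P.add_mem (P.mul_mem_left c ha') hz')

/-- Bass' cancellation for rows -/
theorem bass_isot {R : Type*} [CommRing R] {N : ℕ} (h : ∀ P : Ideal R, ¬ HT N P)
    (v : Fin (N + 1) → R) (hv : UMod v) : Isot v (stdRow R N) := by
  obtain ⟨x, hx⟩ := bass_prime N R h (fun i => v i.castSucc) (v (Fin.last N))
  have h1 := Isot.add_mul_entry v (Fin.last N) (Fin.snoc x 0) (by simp)
  refine h1.trans ?_
  obtain ⟨w, hw⟩ := hv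
  have htop : Ideal.span (Set.range fun i => v (Fin.castSucc i) + v (Fin.last N) * x i) = ⊤ := by
    by_contra hne
    obtain ⟨P, hP, hle⟩ := Ideal.exists_le_maximal _ hne
    have hmem : ∀ i, v (Fin.castSucc i) + v (Fin.last N) * x i ∈ P :=
      fun i => hle (Ideal.subset_span ⟨i, rfl⟩)
    have hb := hx P hP.isPrime hmem
    have hall : ∀ i, v i ∈ P := by
      intro i
      refine Fin.lastCases hb (fun i => ?_) i
      exact (P.add_mem_iff_left (P.mul_mem_right _ hb)).1 (hmem i)
    apply hP.ne_top
    rw [Ideal.eq_top_iff_one, ← hw]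
    exact P.sum_mem fun i _ => P.mul_mem_right _ (hall i)
  have h1 : (1 : R) ∈ Ideal.span (Set.range fun i => v (Fin.castSucc i) + v (Fin.last N) * x i) :=
    htop ▸ Submodule.mem_top
  obtain ⟨q, hq⟩ := (Submodule.mem_span_range_iff_exists_fun R).1 h1
  refine Isot.of_comb _ (Fin.last N) (Fin.snoc q 0) (by simp) ?_
  rw [← hq, dotProduct, Fin.sum_univ_castSucc]
  simp only [Fin.snoc_castSucc, Fin.snoc_last, zero_mul, add_zero, smul_eq_mul]
  exact Finset.sum_congr rfl fun i _ => by ring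

/-- relation to Krull dimension -/
theorem HT.le_dim {R : Type*} [CommRing R] : ∀ {n : ℕ} {P : Ideal R} (_ : HT n P),
    ∃ l : LTSeries (PrimeSpectrum R), l.length = n ∧ l.last.asIdeal = P := by
  intro n
  induction n with
  | zero =>
    intro P h
    exact ⟨RelSeries.singleton _ ⟨P, h⟩, rfl, rfl⟩
  | succ n ih =>
    rintro P ⟨hP, Q, hQP, hQ⟩
    obtain ⟨l, hl, hl'⟩ := ih hQ
    have hlt : l.last < ⟨P, hP⟩ := by
      change l.last.asIdeal < P
      rwa [hl']
    exact ⟨l.snoc ⟨P, hP⟩ hlt, by simp [hl], by simp⟩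

theorem HT.not_of_dim {R : Type*} [CommRing R] {n : ℕ} {P : Ideal R} (h : HT n P)
    (hd : ringKrullDim R < n) : False := by
  obtain ⟨l, hl, -⟩ := h.le_dim
  have := Order.LTSeries.length_le_krullDim l
  rw [hl] at this
  exact absurd (lt_of_le_of_lt this hd) (lt_irrefl _)


theorem exists_monCong {C B : Type*} [CommRing C] [CommRing B] [Algebra C B] (f : C[X])
    (hf : f.Monic) (x y : B) (hx : IsIntegral C x) (hy : IsIntegral C y)
    (hxy : aeval x f * y = 1) : ∃ h ∈ monCong f, aeval x h = 0 := by
  rcases subsingleton_or_nontrivial C with hC | hC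
  · have : Subsingleton B := (algebraMap C B).codomain_trivial
    exact ⟨1, (monCong f).one_mem, Subsingleton.elim _ _⟩
  obtain ⟨g, hg, hgx⟩ := hx
  obtain ⟨q, hq, hqy⟩ := hy
  have hgx : aeval x g = 0 := hgx
  have hqy : aeval y q = 0 := hqy
  set u : Bˣ := ⟨y, aeval x f, by rw [mul_comm]; exact hxy, hxy⟩ with hu
  have h1 : aeval (aeval x f) q.reverse = 0 := by
    let _ : Invertible y := ⟨aeval x f, hxy, by rw [mul_comm]; exact hxy⟩
    have := eval₂_reverse_mul_pow (algebraMap C B) y q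
    rw [show eval₂ (algebraMap C B) y q = 0 from hqy] at this
    have hun : IsUnit (y ^ q.natDegree) := (IsUnit.of_mul_eq_one (aeval x f)
      (by rw [mul_comm]; exact hxy)).pow _
    exact (hun.mul_left_eq_zero).1 this
  have h0 : q.reverse.coeff 0 = 1 := by rw [coeff_zero_reverse, hq.leadingCoeff]
  set s := q.reverse.divX with hs
  have hrev : q.reverse = s * X + 1 := by
    have := divX_mul_X_add q.reverse
    rw [h0, C_1] at this
    exact this.symm
  set w := s.comp f with hw
  have h2 : aeval x (w * f + 1) = 0 := by
    rw [hrev] at h1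
    simpa [hw, aeval_comp] using h1
  set L := (w * f + 1).natDegree + 1 with hL
  refine ⟨f * g * X ^ L + (w * f + 1), ⟨?_, ?_⟩, ?_⟩
  · have hm : (f * g * X ^ L).Monic := (hf.mul hg).mul (monic_X_pow L)
    apply hm.add_of_left
    apply degree_lt_degree
    rw [(hf.mul hg).natDegree_mul (monic_X_pow L), natDegree_X_pow]
    omega
  · exact ⟨g * X ^ L + w, by ring⟩
  · rw [map_add, h2, map_mul, map_mul, hgx]; simp

open LaurentPolynomial in
/-- the reciprocal of an ideal of a polynomial ring -/
noncomputable def recip {E : Type*} [CommRing E] (p : Ideal E[X]) : Ideal E[X] :=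
  (((p.map (algebraMap E[X] E[T;T⁻¹])).comap
    (LaurentPolynomial.invert (R := E)).toRingEquiv.toRingHom)).comap (algebraMap E[X] E[T;T⁻¹])

theorem disj_powers {A : Type*} [CommRing A] {p : Ideal A} (hp : p.IsPrime) {x : A} (hx : x ∉ p) :
    Disjoint (Submonoid.powers x : Set A) (p : Set A) := by
  rw [Set.disjoint_left]
  rintro _ ⟨k, rfl⟩ h
  exact hx (hp.mem_of_pow_mem k h)

open LaurentPolynomial in
theorem mem_recip {E : Type*} [CommRing E] (p : Ideal E[X]) (a : E[X]) :
    a ∈ recip p ↔ invert (toLaurent a) ∈ p.map (algebraMap E[X] E[T;T⁻¹]) := Iff.rfl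

open LaurentPolynomial in
theorem recip_prime {E : Type*} [CommRing E] (p : Ideal E[X]) (hX : X ∉ p) (hp : p.IsPrime) :
    (recip p).IsPrime := by
  have := IsLocalization.isPrime_of_isPrime_disjoint (Submonoid.powers (X : E[X])) E[T;T⁻¹] p hp
    (disj_powers hp hX)
  rw [recip]
  infer_instance

open LaurentPolynomial in
theorem recip_lt {E : Type*} [CommRing E] (p q : Ideal E[X]) (hX : X ∉ p) (hp : p.IsPrime)
    (hq : q.IsPrime) (h : q < p) : recip q < recip p := by
  refine lt_of_le_of_ne (Ideal.comap_mono (Ideal.comap_mono (Ideal.map_mono h.le))) fun e => ?_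
  have e1 := congrArg (Ideal.map (algebraMap E[X] E[T;T⁻¹])) e
  rw [recip, recip, IsLocalization.map_under (Submonoid.powers (X : E[X])),
    IsLocalization.map_under (Submonoid.powers (X : E[X]))] at e1
  have e2 := Ideal.comap_injective_of_surjective _
    (LaurentPolynomial.invert (R := E)).toRingEquiv.surjective e1
  have e3 := congrArg (Ideal.comap (algebraMap E[X] E[T;T⁻¹])) e2
  have k1 := IsLocalization.under_map_of_isPrime_disjoint (Submonoid.powers (X : E[X])) E[T;T⁻¹] hq
    (disj_powers hq fun h' => hX (h.le h'))
  have k2 := IsLocalization.under_map_of_isPrime_disjoint (Submonoid.powers (X : E[X])) E[T;T⁻¹] hp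
    (disj_powers hp hX)
  apply h.ne
  rw [← k1, ← k2]
  exact e3

open LaurentPolynomial in
theorem no_monic_step {E : Type*} [CommRing E] {k : ℕ} (p : Ideal E[X]) (h : HT k p)
    (hm : ∀ g ∈ p, ¬ g.Monic) :
    ∃ P' : Ideal E[X], HT (k + 1) P' ∧ X ∈ P' ∧ ∀ e : E, Polynomial.C e ∈ p → Polynomial.C e ∈ P' := by
  have hX : X ∉ p := fun hx => hm X hx monic_X
  have hp := h.isPrime
  have hht : HT k (recip p) := HT.transfer recip (fun P => X ∉ P) (fun P Q hQP hP hQ => hP (hQP hQ))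
    recip_prime recip_lt k p hX h
  have hpr := hht.isPrime
  have hXr : X ∉ recip p := by
    intro hx
    rw [mem_recip, toLaurent_X, invert_T] at hx
    have := IsLocalization.isPrime_of_isPrime_disjoint (Submonoid.powers (X : E[X])) E[T;T⁻¹] p hp
      (disj_powers hp hX)
    exact this.ne_top (Ideal.eq_top_of_isUnit_mem _ hx (isUnit_T _))
  have hne : recip p ⊔ Ideal.span {X} ≠ ⊤ := by
    intro htop
    have h1 : (1 : E[X]) ∈ recip p ⊔ Ideal.span {X} := htop ▸ Submodule.mem_top
    obtain ⟨a, ha, b, hb, hab⟩ := Submodule.mem_sup.1 h1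
    obtain ⟨c, rfl⟩ := Ideal.mem_span_singleton'.1 hb
    have ha0 : a.coeff 0 = 1 := by
      have := congrArg (fun q => coeff q 0) hab
      simpa using this
    have : Nontrivial E := by
      by_contra hn
      rw [not_nontrivial_iff_subsingleton] at hn
      exact hp.ne_top (Subsingleton.elim _ _)
    refine hm a.reverse ?_ ?_
    · rw [← IsLocalization.under_map_of_isPrime_disjoint (Submonoid.powers (X : E[X])) E[T;T⁻¹] hp
        (disj_powers hp hX)]
      rw [Ideal.under, Ideal.mem_comap, LaurentPolynomial.algebraMap_eq_toLaurent]
      rw [toLaurent_reverse]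
      exact Ideal.mul_mem_right _ _ ha
    · rw [Monic, reverse_leadingCoeff, trailingCoeff,
        natTrailingDegree_eq_zero.2 (Or.inr (by rw [ha0]; exact one_ne_zero)), ha0]
  obtain ⟨P', hP', hle⟩ := Ideal.exists_le_maximal _ hne
  have hXP : X ∈ P' := hle (Ideal.mem_sup_right (Ideal.mem_span_singleton_self _))
  have hrP : recip p ≤ P' := le_sup_left.trans hle
  refine ⟨P', ⟨hP'.isPrime, recip p, lt_of_le_of_ne hrP fun e => hXr (e ▸ hXP), hht⟩, hXP, ?_⟩
  intro e he
  apply hrP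
  rw [mem_recip, toLaurent_C, invert_C, ← toLaurent_C]
  exact Ideal.mem_map_of_mem (algebraMap E[X] E[T;T⁻¹]) he


theorem HT.comap_inj {R S : Type*} [CommRing R] [CommRing S] (φ : R →+* S)
    (hφ : Function.Injective (Ideal.comap φ)) {n : ℕ} {P : Ideal S} (h : HT n P) :
    HT n (P.comap φ) := by
  refine HT.transfer (fun P => P.comap φ) (fun _ => True) (fun _ _ _ _ => trivial)
    (fun P _ hP => Ideal.comap_isPrime φ P) (fun P Q _ _ _ h => ?_) n P trivial h
  exact lt_of_le_of_ne (Ideal.comap_mono h.le) (fun e => h.ne (hφ e))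

/-- interchange of variables -/
noncomputable def swapHom (C : Type*) [CommRing C] (n : ℕ) :
    (MvPolynomial (Fin n) C)[X] →+* MvPolynomial (Fin n) C[X] :=
  eval₂RingHom (MvPolynomial.map Polynomial.C) (MvPolynomial.C Polynomial.X)

theorem swapHom_X (C : Type*) [CommRing C] (n : ℕ) :
    swapHom C n X = MvPolynomial.C Polynomial.X := by
  simp [swapHom]

theorem swapHom_C (C : Type*) [CommRing C] (n : ℕ) (e : MvPolynomial (Fin n) C) :
    swapHom C n (Polynomial.C e) = MvPolynomial.map Polynomial.C e := by
  simp [swapHom]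

theorem swapHom_map (C : Type*) [CommRing C] (n : ℕ) (a : C[X]) :
    swapHom C n (a.map MvPolynomial.C) = MvPolynomial.C a := by
  have : (swapHom C n).comp (mapRingHom MvPolynomial.C) = MvPolynomial.C := by
    apply Polynomial.ringHom_ext
    · intro a
      simp [swapHom]
    · simp [swapHom]
  exact congrArg (fun φ => φ a) this

theorem swapHom_surj (C : Type*) [CommRing C] (n : ℕ) : Function.Surjective (swapHom C n) := by
  intro z
  induction z using MvPolynomial.induction_on with
  | C a => exact ⟨_, swapHom_map C n a⟩
  | add a b ha hb =>
    obtain ⟨a, rfl⟩ := ha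
    obtain ⟨b, rfl⟩ := hb
    exact ⟨a + b, map_add _ _ _⟩
  | mul_X a i ha =>
    obtain ⟨a, rfl⟩ := ha
    exact ⟨a * Polynomial.C (MvPolynomial.X i), by rw [map_mul, swapHom_C, MvPolynomial.map_X]⟩

/-- all the variables are integral modulo `P` -/
def VInt {R C : Type*} [CommRing R] [CommRing C] (ι : R →+* C) {n : ℕ}
    (P : Ideal (MvPolynomial (Fin n) C)) : Prop :=
  ∀ i, ∃ g : R[X], g.Monic ∧ eval₂ (MvPolynomial.C.comp ι) (MvPolynomial.X i) g ∈ P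

theorem comap_map_inj {A : Type*} [CommRing A] (T : Submonoid A) (A' : Type*) [CommRing A']
    [Algebra A A'] [IsLocalization T A'] (n : ℕ) :
    Function.Injective (Ideal.comap (MvPolynomial.map (σ := Fin n) (algebraMap A A'))) := by
  let _ : Algebra (MvPolynomial (Fin n) A) (MvPolynomial (Fin n) A') :=
    MvPolynomial.algebraMvPolynomial
  have := MvPolynomial.isLocalization (σ := Fin n) T A'
  intro I J hIJ
  have k1 := IsLocalization.map_under (T.map (MvPolynomial.C (σ := Fin n)))
    (MvPolynomial (Fin n) A') I
  have k2 := IsLocalization.map_under (T.map (MvPolynomial.C (σ := Fin n)))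
    (MvPolynomial (Fin n) A') J
  rw [← k1, ← k2]
  exact congrArg (Ideal.map (MvPolynomial.map (σ := Fin n) (algebraMap A A'))) hIJ

theorem contr_aux {C B : Type*} [CommRing C] [CommRing B] {n : ℕ}
    (π : (MvPolynomial (Fin n) C)[X] →+* B)
    (hV : ∀ i, ∃ g : C[X], g.Monic ∧
      π (eval₂ (Polynomial.C.comp MvPolynomial.C) (Polynomial.C (MvPolynomial.X i)) g) = 0)
    (q : (MvPolynomial (Fin n) C)[X]) (hq : q.Monic) (hqp : π q = 0) (f : C[X]) (hf : f.Monic)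
    (c : (MvPolynomial (Fin n) C)[X]) (hc : π (f.map MvPolynomial.C * c) = 1) :
    ∃ h ∈ monCong f, π (h.map MvPolynomial.C) = 0 := by
  let _ : Algebra C B := (π.comp (Polynomial.C.comp MvPolynomial.C)).toAlgebra
  have hVi : ∀ i, IsIntegral C (π (Polynomial.C (MvPolynomial.X i))) := by
    intro i
    obtain ⟨g, hg, hgp⟩ := hV i
    refine ⟨g, hg, ?_⟩
    rw [hom_eval₂] at hgp
    exact hgp
  have hEi : ∀ e : MvPolynomial (Fin n) C, IsIntegral C (π (Polynomial.C e)) := by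
    intro e
    induction e using MvPolynomial.induction_on with
    | C a => exact isIntegral_algebraMap (R := C) (A := B) (x := a)
    | add a b ha hb => rw [map_add, map_add]; exact ha.add hb
    | mul_X a i ha => rw [map_mul, map_mul]; exact ha.mul (hVi i)
  have hX : IsIntegral C (π X) := by
    let e : MvPolynomial (Fin n) C →+* integralClosure C B :=
      (π.comp Polynomial.C).codRestrict (integralClosure C B).toSubring hEi
    have : IsIntegral (integralClosure C B) (π X) := by
      refine ⟨q.map e, hq.map e, ?_⟩
      rw [eval₂_map]
      have h2 : q = eval₂ Polynomial.C X q := by simp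
      rw [h2, hom_eval₂] at hqp
      exact hqp
    exact isIntegral_trans (π X) this
  have hall : ∀ z, IsIntegral C (π z) := by
    intro z
    induction z using Polynomial.induction_on' with
    | add a b ha hb => rw [map_add]; exact ha.add hb
    | monomial m a =>
      rw [← C_mul_X_pow_eq_monomial, map_mul, map_pow]
      exact (hEi a).mul (hX.pow m)
  have haev : ∀ t : C[X], aeval (π X) t = π (t.map MvPolynomial.C) := by
    intro t
    have h2 : t.map MvPolynomial.C = eval₂ (Polynomial.C.comp MvPolynomial.C)
        (X : (MvPolynomial (Fin n) C)[X]) t := by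
      rw [← eval₂_map]; simp
    rw [h2, hom_eval₂]
    rfl
  obtain ⟨h, hh, hh0⟩ := exists_monCong f hf (π X) (π c) hX (hall c) (by
    rw [haev, ← map_mul, hc])
  rw [haev] at hh0
  exact ⟨h, hh, hh0⟩

set_option maxHeartbeats 1000000 in
theorem dim_step {R C C' : Type*} [CommRing R] [CommRing C] [CommRing C'] (ι : R →+* C) (f : R[X])
    (hf : f.Monic) [Algebra C[X] C']
    [IsLocalization (Submonoid.powers (f.map ι) ⊔ monCong (f.map ι)) C'] (n k : ℕ)
    (P : Ideal (MvPolynomial (Fin n) C')) (hP : HT k P)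
    (hV : VInt (((algebraMap C[X] C').comp Polynomial.C).comp ι) P) :
    ∃ P' : Ideal (MvPolynomial (Fin (n + 1)) C), HT (k + 1) P' ∧ VInt ι P' := by
  set T := Submonoid.powers (f.map ι) ⊔ monCong (f.map ι) with hT
  set E := MvPolynomial (Fin n) C with hE
  set μ : MvPolynomial (Fin n) C[X] →+* MvPolynomial (Fin n) C' :=
    MvPolynomial.map (algebraMap C[X] C') with hμ
  have hμinj : Function.Injective (Ideal.comap μ) := comap_map_inj T C' n
  set p : Ideal E[X] := (P.comap μ).comap (swapHom C n) with hp
  have hpk : HT k p := (hP.comap_inj μ hμinj).comap_surj _ (swapHom_surj C n)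
  have hpp := hpk.isPrime
  have hmem : ∀ z, z ∈ p ↔ μ (swapHom C n z) ∈ P := fun z => Iff.rfl
  -- elements of `T` are not in `p`
  have hTp : ∀ t ∈ T, (t.map MvPolynomial.C : E[X]) ∉ p := by
    intro t ht h
    rw [hmem, swapHom_map, hμ, MvPolynomial.map_C] at h
    exact hP.isPrime.ne_top (Ideal.eq_top_of_isUnit_mem _ h
      ((IsLocalization.map_units C' ⟨t, ht⟩).map MvPolynomial.C))
  have hVp : ∀ i, ∃ g : R[X], g.Monic ∧
      (Polynomial.C (eval₂ (MvPolynomial.C.comp ι) (MvPolynomial.X i) g) : E[X]) ∈ p := by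
    intro i
    obtain ⟨g, hg, hgP⟩ := hV i
    refine ⟨g, hg, ?_⟩
    rw [hmem, swapHom_C, hom_eval₂, hom_eval₂]
    convert hgP using 2
    · ext a
      simp [hμ]
    · simp [hμ]
  -- it suffices to work in `E[X]`
  suffices hs : ∃ P' : Ideal E[X], HT (k + 1) P' ∧
      (∃ g : R[X], g.Monic ∧ eval₂ (Polynomial.C.comp (MvPolynomial.C.comp ι)) X g ∈ P') ∧
      ∀ e : E, Polynomial.C e ∈ p → Polynomial.C e ∈ P' by
    obtain ⟨P', h1, ⟨g, hg, hg'⟩, h3⟩ := hs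
    refine ⟨P'.comap (MvPolynomial.finSuccEquiv C n).toRingEquiv.toRingHom,
      h1.comap_surj _ (MvPolynomial.finSuccEquiv C n).surjective, ?_⟩
    have hc : (MvPolynomial.finSuccEquiv C n).toRingEquiv.toRingHom.comp (MvPolynomial.C.comp ι)
        = Polynomial.C.comp (MvPolynomial.C.comp ι) := by
      ext a
      simp [MvPolynomial.finSuccEquiv_apply]
    intro i
    refine Fin.cases ⟨g, hg, ?_⟩ (fun i => ?_) i
    · rw [Ideal.mem_comap, hom_eval₂, hc]
      convert hg' using 2
      exact MvPolynomial.finSuccEquiv_X_zero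
    · obtain ⟨g, hg, hgp⟩ := hVp i
      refine ⟨g, hg, ?_⟩
      have := h3 _ hgp
      rw [Ideal.mem_comap, hom_eval₂, hc]
      rw [hom_eval₂] at this
      convert this using 2
      exact MvPolynomial.finSuccEquiv_X_succ
  by_cases hm : ∀ g ∈ p, ¬ g.Monic
  · obtain ⟨P', h1, h2, h3⟩ := no_monic_step p hpk hm
    exact ⟨P', h1, ⟨X, monic_X, by simpa using h2⟩, h3⟩
  push Not at hm
  obtain ⟨q, hqp, hq⟩ := hm
  set fE : E[X] := (f.map ι).map MvPolynomial.C with hfE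
  have hne : p ⊔ Ideal.span {fE} ≠ ⊤ := by
    intro htop
    have h1 : (1 : E[X]) ∈ p ⊔ Ideal.span {fE} := htop ▸ Submodule.mem_top
    obtain ⟨a, ha, b, hb, hab⟩ := Submodule.mem_sup.1 h1
    obtain ⟨c, rfl⟩ := Ideal.mem_span_singleton'.1 hb
    set π := Ideal.Quotient.mk p with hπ
    obtain ⟨h, hh, hh0⟩ := contr_aux (C := C) (B := E[X] ⧸ p) (n := n) π (fun i => by
      obtain ⟨g, hg, hgp⟩ := hVp i
      refine ⟨g.map ι, hg.map ι, ?_⟩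
      rw [eval₂_map]
      have := Ideal.Quotient.eq_zero_iff_mem.2 hgp
      rw [hom_eval₂] at this
      exact this) q hq (Ideal.Quotient.eq_zero_iff_mem.2 hqp) (f.map ι) (hf.map ι) c (by
      rw [← map_one π, ← hab, map_add, Ideal.Quotient.eq_zero_iff_mem.2 ha,
        zero_add, mul_comm])
    exact hTp h (Submonoid.mem_sup_right hh) (Ideal.Quotient.eq_zero_iff_mem.1 hh0)
  obtain ⟨P', hP', hle⟩ := Ideal.exists_le_maximal _ hne
  have hfP : fE ∈ P' := hle (Ideal.mem_sup_right (Ideal.mem_span_singleton_self _))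
  have hpP : p ≤ P' := le_sup_left.trans hle
  refine ⟨P', ⟨hP'.isPrime, p, lt_of_le_of_ne hpP fun e => ?_, hpk⟩, ⟨f, hf, ?_⟩,
    fun e he => hpP he⟩
  · exact hTp _ (Submonoid.mem_sup_left (Submonoid.mem_powers _)) (e ▸ hfP)
  · rw [← eval₂_map, ← Polynomial.map_map, eval₂_C_X]
    exact hfP


/-- the product of the polynomials `f i` evaluated at the variables -/
noncomputable def Fprod {R C : Type*} [CommRing R] [CommRing C] (ι : R →+* C) {n : ℕ}
    (f : Fin n → R[X]) : MvPolynomial (Fin n) C :=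
  ∏ i, eval₂ (MvPolynomial.C.comp ι) (MvPolynomial.X i) (f i)

/-- the localized polynomial ring -/
abbrev LA {R C : Type*} [CommRing R] [CommRing C] (ι : R →+* C) {n : ℕ}
    (f : Fin n → R[X]) : Type _ := Localization.Away (Fprod ι f)

section
variable {R C : Type*} [CommRing R] [CommRing C] (ι : R →+* C) {n : ℕ} (f : Fin n → R[X])

/-- constants -/
noncomputable def cA : C →+* LA ι f :=
  (algebraMap (MvPolynomial (Fin n) C) (LA ι f)).comp MvPolynomial.C

/-- variables -/
noncomputable def xA (i : Fin n) : LA ι f :=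
  algebraMap (MvPolynomial (Fin n) C) (LA ι f) (MvPolynomial.X i)

theorem unitA (i : Fin n) : IsUnit (eval₂ ((cA ι f).comp ι) (xA ι f i) (f i)) := by
  have h := IsLocalization.Away.algebraMap_isUnit (S := LA ι f) (Fprod ι f)
  have e : algebraMap (MvPolynomial (Fin n) C) (LA ι f) (Fprod ι f) =
      ∏ i, algebraMap (MvPolynomial (Fin n) C) (LA ι f)
        (eval₂ (MvPolynomial.C.comp ι) (MvPolynomial.X i) (f i)) := by
    exact map_prod (algebraMap (MvPolynomial (Fin n) C) (LA ι f)) _ _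
  rw [e, IsUnit.prod_univ_iff] at h
  have := h i
  rw [hom_eval₂] at this
  exact this

theorem liftA_aux {S : Type*} [CommRing S] (c : C →+* S) (x : Fin n → S)
    (h : ∀ i, IsUnit (eval₂ (c.comp ι) (x i) (f i))) :
    IsUnit (MvPolynomial.eval₂Hom c x (Fprod ι f)) := by
  rw [Fprod, map_prod, IsUnit.prod_univ_iff]
  intro i
  rw [hom_eval₂]
  have e : (MvPolynomial.eval₂Hom c x).comp (MvPolynomial.C.comp ι) = c.comp ι := by
    ext a
    simp
  rw [e, MvPolynomial.eval₂Hom_X']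
  exact h i

/-- universal property -/
noncomputable def liftA {S : Type*} [CommRing S] (c : C →+* S) (x : Fin n → S)
    (h : ∀ i, IsUnit (eval₂ (c.comp ι) (x i) (f i))) : LA ι f →+* S :=
  IsLocalization.Away.lift (Fprod ι f) (liftA_aux ι f c x h)

theorem liftA_c {S : Type*} [CommRing S] (c : C →+* S) (x : Fin n → S)
    (h : ∀ i, IsUnit (eval₂ (c.comp ι) (x i) (f i))) (a : C) :
    liftA ι f c x h (cA ι f a) = c a := by
  rw [liftA, cA, RingHom.comp_apply, IsLocalization.Away.lift_eq]
  simp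

theorem liftA_x {S : Type*} [CommRing S] (c : C →+* S) (x : Fin n → S)
    (h : ∀ i, IsUnit (eval₂ (c.comp ι) (x i) (f i))) (i : Fin n) :
    liftA ι f c x h (xA ι f i) = x i := by
  rw [liftA, xA, IsLocalization.Away.lift_eq]
  simp

theorem extA {S : Type*} [CommRing S] (φ ψ : LA ι f →+* S)
    (h1 : ∀ a, φ (cA ι f a) = ψ (cA ι f a)) (h2 : ∀ i, φ (xA ι f i) = ψ (xA ι f i)) : φ = ψ := by
  apply IsLocalization.ringHom_ext (Submonoid.powers (Fprod ι f))
  apply MvPolynomial.ringHom_ext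
  · exact h1
  · exact h2

end

set_option maxHeartbeats 1000000 in
theorem main_ind.{u, w} (n : ℕ) : ∀ {R : Type w} {C : Type u} [CommRing R] [CommRing C] (ι : R →+* C)
    (f : Fin n → R[X]) (_ : ∀ i, (f i).Monic) (N : ℕ) (_ : 1 ≤ N)
    (_ : ∀ P : Ideal (MvPolynomial (Fin n) C), VInt ι P → ¬ HT (N + n) P)
    (v : Fin (N + 1) → LA ι f) (_ : UMod v), Isot v (stdRow (LA ι f) N) := by
  induction n with
  | zero =>
    intro R C _ _ ι f hf N hN hyp v hv
    refine bass_isot (fun P hP => ?_) v hv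
    refine hyp (P.comap (algebraMap (MvPolynomial (Fin 0) C) (LA ι f))) (fun i => i.elim0)
      (hP.comap_inj _ ?_)
    intro I J hIJ
    rw [← IsLocalization.map_under (Submonoid.powers (Fprod ι f)) (LA ι f) I,
      ← IsLocalization.map_under (Submonoid.powers (Fprod ι f)) (LA ι f) J]
    exact congrArg (Ideal.map (algebraMap (MvPolynomial (Fin 0) C) (LA ι f))) hIJ
  | succ n ih =>
    intro R C _ _ ι f hf N hN hyp v hv
    set f' : Fin n → R[X] := fun i => f i.succ with hf'
    set fC : C[X] := (f 0).map ι with hfC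
    set T := Submonoid.powers fC ⊔ monCong fC with hT
    set C' := Localization T with hC'
    set ι' : R →+* C' := ((algebraMap C[X] C').comp Polynomial.C).comp ι with hι'
    have IH := ih ι' f' (fun i => hf i.succ) N hN (fun P hV hP => by
      obtain ⟨P', h1, h2⟩ := dim_step ι (f 0) (hf 0) n (N + n) P hP hV
      exact hyp P' h2 h1)
    set G := LA ι f' with hG
    set cG := cA ι f' with hcG
    set fG : G[X] := (f 0).map (cG.comp ι) with hfG
    have hfGC : fG = fC.map cG := by rw [hfC, Polynomial.map_map]
    set A1 := Localization (Submonoid.powers fG) with hA1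
    set L := Localization (Submonoid.powers fG ⊔ monCong fG) with hL
    set K := LA ι' f' with hK
    set alg1 := algebraMap G[X] A1 with halg1
    set algL := algebraMap G[X] L with halgL
    have hu1 : IsUnit (alg1 fG) :=
      IsLocalization.map_units A1 (⟨fG, Submonoid.mem_powers fG⟩ : Submonoid.powers fG)
    have huL : ∀ t ∈ Submonoid.powers fG ⊔ monCong fG, IsUnit (algL t) := fun t ht =>
      IsLocalization.map_units L (⟨t, ht⟩ : (Submonoid.powers fG ⊔ monCong fG : Submonoid G[X]))
    -- the map to `A1`
    have hψ : ∀ i, IsUnit (eval₂ ((alg1.comp (Polynomial.C.comp cG)).comp ι)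
        ((Fin.cons (alg1 X) (fun i => alg1 (Polynomial.C (xA ι f' i))) : Fin (n + 1) → A1) i)
        (f i)) := by
      intro i
      refine Fin.cases ?_ (fun i => ?_) i
      · rw [Fin.cons_zero, RingHom.comp_assoc, ← hom_eval₂, RingHom.comp_assoc, ← eval₂_map,
          eval₂_C_X]
        exact hu1
      · rw [Fin.cons_succ, RingHom.comp_assoc, ← hom_eval₂, RingHom.comp_assoc, ← hom_eval₂]
        exact ((unitA ι f' i).map Polynomial.C).map alg1
    set ψ : LA ι f →+* A1 := liftA ι f _ _ hψ with hψd
    -- and back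
    set γ : G →+* LA ι f := liftA ι f' (cA ι f) (fun i => xA ι f i.succ)
      (fun i => unitA ι f i.succ) with hγ
    have hχ : ∀ y : Submonoid.powers fG, IsUnit (eval₂RingHom γ (xA ι f 0) y) := by
      rintro ⟨_, m, rfl⟩
      have h0 : eval₂RingHom γ (xA ι f 0) fG = eval₂ ((cA ι f).comp ι) (xA ι f 0) (f 0) := by
        rw [coe_eval₂RingHom, hfG, eval₂_map]
        congr 1
        ext a
        simp only [RingHom.comp_apply]
        rw [hγ, hcG, liftA_c]
      change IsUnit (eval₂RingHom γ (xA ι f 0) (fG ^ m))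
      rw [map_pow, h0]
      exact (unitA ι f 0).pow m
    set χ : A1 →+* LA ι f := IsLocalization.lift hχ with hχd
    have hχa : ∀ z, χ (alg1 z) = eval₂ γ (xA ι f 0) z := fun z => IsLocalization.lift_eq hχ z
    have hχψ : χ.comp ψ = RingHom.id _ := by
      apply extA
      · intro a
        rw [RingHom.comp_apply, hψd, liftA_c]
        simp only [RingHom.comp_apply, RingHom.id_apply]
        rw [hχa, eval₂_C, hγ, hcG, liftA_c]
      · intro i
        rw [RingHom.comp_apply, hψd, liftA_x, RingHom.id_apply]
        refine Fin.cases ?_ (fun i => ?_) i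
        · rw [Fin.cons_zero, hχa, eval₂_X]
        · rw [Fin.cons_succ, hχa, eval₂_C, hγ, liftA_x]
    -- the map to `L`
    set j : A1 →+* L := IsLocalization.lift (M := Submonoid.powers fG) (g := algL)
      (fun y => huL y (Submonoid.mem_sup_left y.2)) with hj
    have hja : ∀ z, j (alg1 z) = algL z := fun z => IsLocalization.lift_eq _ z
    -- from `C'` to `L`
    have hTL : ∀ t : T, IsUnit (algL.comp (mapRingHom cG) t) := by
      rintro ⟨t, ht⟩
      apply huL
      have hle : T ≤ (Submonoid.powers fG ⊔ monCong fG).comap (mapRingHom cG) := by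
        rw [hT, sup_le_iff]
        constructor
        · rintro _ ⟨m, rfl⟩
          refine Submonoid.mem_sup_left ⟨m, ?_⟩
          simp [hfGC]
        · rintro t ⟨h1, h2⟩
          refine Submonoid.mem_sup_right ⟨h1.map cG, ?_⟩
          have := map_dvd (mapRingHom cG) h2
          rw [map_sub, map_one] at this
          rw [hfGC]
          exact this
      exact hle ht
    set β : C' →+* L := IsLocalization.lift hTL with hβ
    have hβa : ∀ z, β (algebraMap C[X] C' z) = algL (z.map cG) := fun z =>
      IsLocalization.lift_eq hTL z
    have hκ : ∀ i, IsUnit (eval₂ (β.comp ι') (algL (Polynomial.C (xA ι f' i))) (f' i)) := by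
      intro i
      have h1 : β.comp ι' = algL.comp (Polynomial.C.comp (cG.comp ι)) := by
        ext a
        simp only [hι', RingHom.comp_apply, hβa, Polynomial.map_C]
      rw [h1, ← hom_eval₂, ← hom_eval₂]
      exact ((unitA ι f' i).map Polynomial.C).map algL
    set κ : K →+* L := liftA ι' f' β _ hκ with hκd
    -- from the original ring to `K`
    have hρ : ∀ i, IsUnit (eval₂ (((cA ι' f').comp ((algebraMap C[X] C').comp Polynomial.C)).comp ι)
        ((Fin.cons (cA ι' f' (algebraMap C[X] C' X)) (xA ι' f') : Fin (n + 1) → K) i)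
        (f i)) := by
      intro i
      refine Fin.cases ?_ (fun i => ?_) i
      · rw [Fin.cons_zero, RingHom.comp_assoc, ← hom_eval₂, RingHom.comp_assoc, ← hom_eval₂,
          ← eval₂_map, eval₂_C_X]
        exact (IsLocalization.map_units C' (⟨fC, Submonoid.mem_sup_left
          (Submonoid.mem_powers fC)⟩ : T)).map (cA ι' f')
      · rw [Fin.cons_succ]
        exact unitA ι' f' i
    set ρ : LA ι f →+* K := liftA ι f _ _ hρ with hρd
    have hcomm : κ.comp ρ = j.comp ψ := by
      apply extA
      · intro a
        rw [RingHom.comp_apply, RingHom.comp_apply, hρd, hψd, liftA_c, liftA_c]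
        simp only [RingHom.comp_apply]
        rw [hκd, liftA_c, hja, hβa, Polynomial.map_C]
      · intro i
        rw [RingHom.comp_apply, RingHom.comp_apply, hρd, hψd, liftA_x, liftA_x]
        refine Fin.cases ?_ (fun i => ?_) i
        · rw [Fin.cons_zero, Fin.cons_zero, hκd, liftA_c, hja, hβa, Polynomial.map_X]
        · rw [Fin.cons_succ, Fin.cons_succ, hκd, liftA_x, hja]
    have hK1 := (IH (ρ ∘ v) (hv.map ρ)).map κ
    rw [stdRow_map] at hK1
    have e1 : κ ∘ ρ ∘ v = j ∘ ψ ∘ v := by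
      funext i
      exact congrArg (fun φ => φ (v i)) hcomm
    rw [e1] at hK1
    have h2 := (horrocks_global hN fG A1 L j (RingHom.ext hja) (ψ ∘ v) (hv.map ψ) hK1).map χ
    rw [stdRow_map] at h2
    have e2 : χ ∘ ψ ∘ v = v := by
      funext i
      exact congrArg (fun φ => φ (v i)) hχψ
    rwa [e2] at h2


theorem cancel_one {A : Type*} [CommRing A] (N : ℕ)
    (hA : ∀ v : Fin (N + 1) → A, UMod v → Isot v (stdRow A N))
    {Q : Type*} [AddCommGroup Q] [Module A Q] (e : (Q × A) ≃ₗ[A] (Fin (N + 1) → A)) :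
    Nonempty (Q ≃ₗ[A] (Fin N → A)) := by
  set π : (Fin (N + 1) → A) →ₗ[A] A := (LinearMap.snd A Q A).comp e.symm.toLinearMap with hπ
  set v : Fin (N + 1) → A := fun i => π (Pi.single i 1) with hv
  have hπv : ∀ x, π x = v ⬝ᵥ x := by
    intro x
    conv_lhs => rw [pi_eq_sum_univ' x]
    rw [map_sum, dotProduct]
    refine Finset.sum_congr rfl fun i _ => ?_
    rw [map_smul, smul_eq_mul, mul_comm]
  have hum : UMod v := ⟨e (0, 1), by rw [← hπv]; simp [hπ]⟩
  obtain ⟨M, M', hMM, hM⟩ := (hA v hum).gl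
  have hMM' : M' * M = 1 := mul_eq_one_comm.1 hMM
  have key : ∀ x, π (M.mulVec x) = x 0 := by
    intro x
    rw [hπv, Matrix.dotProduct_mulVec, hM, stdRow, single_one_dotProduct]
  have key2 : ∀ z : Q × A, (M'.mulVec (e z)) 0 = z.2 := by
    intro z
    rw [← key (M'.mulVec (e z)), Matrix.mulVec_mulVec, hMM, Matrix.one_mulVec, hπ]
    simp
  let g : Q →ₗ[A] (Fin N → A) :=
    (LinearMap.funLeft A A Fin.succ).comp
      ((Matrix.mulVecLin M').comp (e.toLinearMap.comp (LinearMap.inl A Q A)))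
  have hg : ∀ q i, g q i = M'.mulVec (e (q, 0)) (Fin.succ i) := fun q i => rfl
  refine ⟨LinearEquiv.ofBijective g ⟨?_, ?_⟩⟩
  · rw [injective_iff_map_eq_zero]
    intro q hq
    have h0 : M'.mulVec (e (q, 0)) = 0 := by
      funext i
      refine Fin.cases ?_ (fun i => ?_) i
      · rw [key2]; rfl
      · rw [← hg, hq]; rfl
    have h1 : e (q, 0) = 0 := by
      have := congrArg M.mulVec h0
      rwa [Matrix.mulVec_mulVec, hMM, Matrix.one_mulVec, Matrix.mulVec_zero] at this
    have h2 := e.map_eq_zero_iff.1 h1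
    exact congrArg Prod.fst h2
  · intro y
    set x : Fin (N + 1) → A := Fin.cons 0 y with hx
    set z := e.symm (M.mulVec x) with hz
    have hez : M'.mulVec (e z) = x := by
      rw [hz, e.apply_symm_apply, Matrix.mulVec_mulVec, hMM', Matrix.one_mulVec]
    have hz2 : z.2 = 0 := by
      rw [← key2, hez, hx, Fin.cons_zero]
    refine ⟨z.1, ?_⟩
    funext i
    rw [hg]
    have : (z.1, (0 : A)) = z := by rw [← hz2]
    rw [this, hez, hx, Fin.cons_succ]

theorem cancel_all {A : Type*} [CommRing A] (r : ℕ)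
    (hA : ∀ N, r ≤ N → ∀ v : Fin (N + 1) → A, UMod v → Isot v (stdRow A N))
    {P : Type*} [AddCommGroup P] [Module A P] : ∀ s : ℕ,
    Nonempty ((P × (Fin s → A)) ≃ₗ[A] (Fin (r + s) → A)) → Nonempty (P ≃ₗ[A] (Fin r → A)) := by
  intro s
  induction s with
  | zero =>
    rintro ⟨e⟩
    exact ⟨LinearEquiv.prodUnique.symm.trans e⟩
  | succ s ih =>
    rintro ⟨e⟩
    apply ih
    refine cancel_one (r + s) (hA (r + s) (Nat.le_add_right _ _)) (LinearEquiv.trans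
      ((LinearEquiv.prodAssoc A P (Fin s → A) A).trans
        (LinearEquiv.prodCongr (LinearEquiv.refl A P) ?_)) e)
    exact (LinearEquiv.prodComm A _ _).trans (Fin.consLinearEquiv A (fun _ : Fin (s + 1) => A))

theorem prod_extend {R : Type*} [CommRing R] (n m : ℕ) (hmn : m ≤ n) (f : Fin m → R[X]) :
    (∏ i : Fin m, Polynomial.aeval (MvPolynomial.X (Fin.castLE hmn i)) (f i) :
      MvPolynomial (Fin n) R) =
    Fprod (RingHom.id R) (fun i : Fin n => if h : i.1 < m then f ⟨i.1, h⟩ else 1) := by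
  obtain ⟨k, rfl⟩ := Nat.exists_eq_add_of_le hmn
  rw [Fprod, Fin.prod_univ_add]
  rw [Finset.prod_eq_one (s := (Finset.univ : Finset (Fin k))), mul_one]
  · refine Finset.prod_congr rfl fun i _ => ?_
    simp only [Fin.val_castAdd, Fin.is_lt, dif_pos]
    rfl
  · intro i _
    simp

theorem rows_isot {R : Type*} [CommRing R] (d n : ℕ)
    (hdimA : ringKrullDim (MvPolynomial (Fin n) R) = (d + n : ℕ))
    (m : ℕ) (hmn : m ≤ n) (f : Fin m → Polynomial R) (hf : ∀ i, (f i).Monic) (N : ℕ)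
    (hN : d + 1 ≤ N) (F : MvPolynomial (Fin n) R)
    (hF : F = ∏ i : Fin m, Polynomial.aeval (MvPolynomial.X (Fin.castLE hmn i)) (f i))
    (v : Fin (N + 1) → Localization.Away F) (hv : UMod v) :
    Isot v (stdRow (Localization.Away F) N) := by
  rw [prod_extend] at hF
  subst hF
  refine main_ind n (RingHom.id R) _ (fun i => ?_) N (by omega) (fun P _ hP => ?_) v hv
  · split_ifs with h
    · exact hf _
    · exact monic_one
  · refine hP.not_of_dim ?_
    rw [hdimA]
    exact_mod_cast (by omega : d + n < N + n)

/-- Let `R` be a commutative ring of finite Krull dimension `d` such that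
`dim R[Y₁,…,Yₙ] = d + n`. Let `A = R[Y₁,…,Yₙ][(f₁⋯f_m)⁻¹]` with `m ≤ n` and each
`fᵢ ∈ R[Yᵢ]` monic. Then every finitely generated stably free `A`-module of rank
`r ≥ d + 1` is free. -/
theorem statement_13 (R : Type*) [CommRing R] (d n : ℕ)
    (hdim : ringKrullDim R = d)
    (hdimA : ringKrullDim (MvPolynomial (Fin n) R) = (d + n : ℕ))
    (m : ℕ) (hmn : m ≤ n) (f : Fin m → Polynomial R) (hf : ∀ i, (f i).Monic)
    (P : Type*) [AddCommGroup P] [Module (LocalizedPolynomialRing R n m hmn f) P]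
    [Module.Finite (LocalizedPolynomialRing R n m hmn f) P]
    (r s : ℕ) (hr : d + 1 ≤ r)
    (hstab : Nonempty ((P × (Fin s → LocalizedPolynomialRing R n m hmn f))
      ≃ₗ[LocalizedPolynomialRing R n m hmn f]
      (Fin (r + s) → LocalizedPolynomialRing R n m hmn f))) :
    Nonempty (P ≃ₗ[LocalizedPolynomialRing R n m hmn f]
      (Fin r → LocalizedPolynomialRing R n m hmn f)) := by
  exact cancel_all r (fun N hN v hv => rows_isot d n hdimA m hmn f hf N (by omega) _ rfl v hv)
    s hstab
end
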